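/- Let m ≥ 1 and n ≥ 2 be integers, let B ⊂ ℂ^m be the open Euclidean unit ball, and let G : B → SL_n(ℂ) be a holomorphic map (each matrix entry of G is holomorphic on B and det G(w) = 1 for all w ∈ B). Then there exist an integer M ≥ 1 and matrix-valued maps E_1, …, E_M : B → SL_n(ℂ) with all entries holomorphic on B, such that for each odd i the matrix E_i(w) is unipotent lower triangular for every w ∈ B, for each even i the matrix E_i(w) is unipotent upper triangular for every w ∈ B, and G(w) = E_1(w) E_2(w) ⋯ E_M(w) for all w ∈ B. -/

import Mathlib

open Set Filter Topology Metric MeasureTheory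
open scoped ContDiff

set_option linter.unusedSectionVars false

section Holomorphic

variable {W : Type*} [NormedAddCommGroup W] [NormedSpace ℂ W]
  {F : Type*} [NormedAddCommGroup F] [NormedSpace ℂ F]

theorem norm_fderiv_le_of_norm_le_on_ball {f : W → F} {w : W} {r M : ℝ} (hr : 0 < r)
    (hf : DifferentiableOn ℂ f (ball w r)) (hM : ∀ x ∈ ball w r, ‖f x‖ ≤ M) :
    ‖fderiv ℂ f w‖ ≤ (2 * M) / r := by
  refine Complex.norm_fderiv_le_div_of_mapsTo_ball hf (fun x hx => ?_) hr
  have h1 := hM x hx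
  have h2 := hM w (mem_ball_self hr)
  rw [mem_closedBall, dist_eq_norm]
  calc _ ≤ ‖f x‖ + ‖f w‖ := norm_sub_le _ _
    _ ≤ _ := by linarith

theorem aestronglyMeasurable_fderiv_of_forall [FiniteDimensional ℂ W] {α : Type*}
    [MeasurableSpace α] {μ : Measure α} {f : α → W → F} {U : Set W} (hU : IsOpen U)
    (hmeas : ∀ w ∈ U, AEStronglyMeasurable (fun a => f a w) μ)
    (hdiff : ∀ᵐ a ∂μ, DifferentiableOn ℂ (f a) U) {w : W} (hw : w ∈ U) :
    AEStronglyMeasurable (fun a => fderiv ℂ (f a) w) μ := by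
  have key : ∀ v : W, AEStronglyMeasurable (fun a => fderiv ℂ (f a) w v) μ := by
    intro v
    have hlim : Tendsto (fun n : ℕ => w + (1 / ((n : ℂ) + 1)) • v) atTop (𝓝 w) := by
      have : Tendsto (fun n : ℕ => (1 / ((n : ℂ) + 1))) atTop (𝓝 0) :=
        tendsto_one_div_add_atTop_nhds_zero_nat (𝕜 := ℂ)
      simpa using (this.smul_const v).const_add w
    obtain ⟨n₀, hn₀⟩ := (hlim.eventually (hU.mem_nhds hw)).exists_forall_of_atTop
    refine aestronglyMeasurable_of_tendsto_ae (u := (atTop : Filter ℕ))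
      (f := fun n a => (((n + n₀ : ℕ) : ℂ) + 1) •
        (f a (w + (1 / (((n + n₀ : ℕ) : ℂ) + 1)) • v) - f a w)) ?_ ?_
    · intro n
      exact ((hmeas _ (hn₀ _ (by omega))).sub (hmeas w hw)).const_smul _
    · filter_upwards [hdiff] with a ha
      have hd := ((ha w hw).differentiableAt (hU.mem_nhds hw)).hasFDerivAt
      have h1 : Tendsto (fun n : ℕ => ‖((n : ℂ) + 1)‖) atTop atTop := by
        refine tendsto_atTop_mono (fun n => ?_) tendsto_natCast_atTop_atTop
        have : ‖((n : ℂ) + 1)‖ = (n : ℝ) + 1 := by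
          have := Complex.norm_natCast (n + 1)
          push_cast at this; exact this
        rw [this]; linarith
      have := hd.lim v (c := fun n : ℕ => (((n + n₀ : ℕ) : ℂ) + 1)) (l := atTop)
        (h1.comp (tendsto_add_atTop_nat n₀))
      simpa only [one_div] using this
  let b := Module.finBasis ℂ W
  have hrep : ∀ A : W →L[ℂ] F, A = ∑ i, (LinearMap.toContinuousLinearMap (b.coord i)).smulRight (A (b i)) := by
    intro A
    ext x
    conv_lhs => rw [← b.sum_repr x, map_sum]
    simp
  have : (fun a => fderiv ℂ (f a) w) = fun a => ∑ i,
      (ContinuousLinearMap.smulRightL ℂ W F (LinearMap.toContinuousLinearMap (b.coord i)))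
        (fderiv ℂ (f a) w (b i)) := by
    funext a
    exact hrep _
  rw [this]
  refine Finset.aestronglyMeasurable_fun_sum _ fun i _ => ?_
  exact (ContinuousLinearMap.continuous _).comp_aestronglyMeasurable (key (b i))

/-- Holomorphic dependence of a dominated integral on a parameter. -/
theorem differentiableOn_integral_of_dominated [FiniteDimensional ℂ W] [CompleteSpace F]
    {α : Type*} [MeasurableSpace α] {μ : Measure α} {f : α → W → F} {U : Set W} (hU : IsOpen U)
    {bound : α → ℝ} (hbound : Integrable bound μ)
    (hmeas : ∀ w ∈ U, AEStronglyMeasurable (fun a => f a w) μ)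
    (hdiff : ∀ᵐ a ∂μ, DifferentiableOn ℂ (f a) U)
    (hle : ∀ᵐ a ∂μ, ∀ w ∈ U, ‖f a w‖ ≤ bound a) :
    DifferentiableOn ℂ (fun w => ∫ a, f a w ∂μ) U := by
  intro w hw
  obtain ⟨r, hr, hrU⟩ := Metric.isOpen_iff.1 hU w hw
  have hball : ∀ x ∈ ball w (r / 2), ball x (r / 2) ⊆ U := by
    intro x hx y hy
    apply hrU
    rw [mem_ball] at *
    linarith [dist_triangle y x w]
  refine DifferentiableAt.differentiableWithinAt (HasFDerivAt.differentiableAt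
    (f' := ∫ a, fderiv ℂ (f a) w ∂μ) ?_)
  refine hasFDerivAt_integral_of_dominated_of_fderiv_le (F := fun w a => f a w)
    (F' := fun x a => fderiv ℂ (f a) x)
    (bound := fun a => (2 * bound a) / (r / 2))
    (ball_mem_nhds w (half_pos hr)) ?_ ?_ ?_ ?_ ?_ ?_
  · filter_upwards [hU.mem_nhds hw] with x hx using hmeas x hx
  · exact hbound.mono' (hmeas w hw) (hle.mono fun a ha => ha w hw)
  · exact aestronglyMeasurable_fderiv_of_forall hU hmeas hdiff hw
  · filter_upwards [hdiff, hle] with a ha hla x hx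
    exact norm_fderiv_le_of_norm_le_on_ball (half_pos hr) (ha.mono (hball x hx))
      (fun y hy => hla y (hball x hx hy))
  · exact (hbound.const_mul 2).div_const _
  · filter_upwards [hdiff] with a ha x hx
    have hxU : x ∈ U := hball x hx (mem_ball_self (half_pos hr))
    exact ((ha x hxU).differentiableAt (hU.mem_nhds hxU)).hasFDerivAt

/-- A locally uniform limit of holomorphic functions is holomorphic. -/
theorem differentiableOn_of_tendstoUniformlyOn [CompleteSpace F] {f : ℕ → W → F} {g : W → F}
    {U : Set W} (hU : IsOpen U) (hf : ∀ᶠ n in atTop, DifferentiableOn ℂ (f n) U)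
    (h : TendstoUniformlyOn f g atTop U) : DifferentiableOn ℂ g U := by
  obtain ⟨n₀, hn₀⟩ := hf.exists_forall_of_atTop
  intro w hw
  obtain ⟨r, hr, hrU⟩ := Metric.isOpen_iff.1 hU w hw
  have hball : ∀ x ∈ ball w (r / 2), ball x (r / 2) ⊆ U := by
    intro x hx y hy
    apply hrU
    rw [mem_ball] at *
    linarith [dist_triangle y x w]
  have hd : ∀ n ≥ n₀, ∀ x ∈ U, HasFDerivAt (f n) (fderiv ℂ (f n) x) x := fun n hn x hx =>
    ((hn₀ n hn x hx).differentiableAt (hU.mem_nhds hx)).hasFDerivAt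
  have hC : UniformCauchySeqOn (fun n x => fderiv ℂ (f n) x) atTop (ball w (r / 2)) := by
    rw [Metric.uniformCauchySeqOn_iff]
    intro ε hε
    have hη : 0 < ε * (r / 2) / 4 := by positivity
    obtain ⟨N, hN⟩ := (Metric.uniformCauchySeqOn_iff.1 h.uniformCauchySeqOn) _ hη
    refine ⟨max N n₀, fun k hk l hl x hx => ?_⟩
    have hxU : x ∈ U := hball x hx (mem_ball_self (half_pos hr))
    have hk' := le_trans (le_max_right _ _) hk
    have hl' := le_trans (le_max_right _ _) hl
    rw [dist_eq_norm]
    have he : fderiv ℂ (f k) x - fderiv ℂ (f l) x = fderiv ℂ (f k - f l) x :=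
      (((hd k hk' x hxU).sub (hd l hl' x hxU)).fderiv).symm
    rw [he]
    have := norm_fderiv_le_of_norm_le_on_ball (f := f k - f l) (w := x) (half_pos hr)
      (M := ε * (r / 2) / 4)
      (((hn₀ k hk').sub (hn₀ l hl')).mono (hball x hx)) (fun y hy => by
        have := hN k (le_trans (le_max_left _ _) hk) l (le_trans (le_max_left _ _) hl) y
          (hball x hx hy)
        rw [dist_eq_norm] at this
        exact this.le)
    refine this.trans_lt ?_
    have : 2 * (ε * (r / 2) / 4) / (r / 2) = ε / 2 := by field_simp; ring
    rw [this]; linarith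
  have hlim : ∀ x ∈ ball w (r / 2), ∃ A, Tendsto (fun n => fderiv ℂ (f n) x) atTop (𝓝 A) :=
    fun x hx => cauchySeq_tendsto_of_complete (hC.cauchySeq hx)
  choose! g' hg' using hlim
  have hT := hC.tendstoUniformlyOn_of_tendsto hg'
  have hw' := mem_ball_self (x := w) (half_pos hr)
  refine (HasFDerivAt.differentiableAt (f' := g' w) ?_).differentiableWithinAt
  refine hasFDerivAt_of_tendstoUniformlyOnFilter (l := atTop) (f := f)
    (f' := fun n x => fderiv ℂ (f n) x) ?_ ?_ ?_
  · have := hT.tendstoUniformlyOnFilter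
    exact this.mono_right (le_principal_iff.2 (ball_mem_nhds _ (half_pos hr)))
  · filter_upwards [prod_mem_prod (Ici_mem_atTop n₀) (hU.mem_nhds hw)] with p hp
    exact hd p.1 hp.1 p.2 hp.2
  · filter_upwards [hU.mem_nhds hw] with y hy
    exact h.tendsto_at hy

end Holomorphic

section Taylor

theorem differentiableOn_fderiv_apply {W : Type*} [NormedAddCommGroup W] [NormedSpace ℂ W]
    {F : Type*} [NormedAddCommGroup F] [NormedSpace ℂ F] [FiniteDimensional ℂ W] [CompleteSpace F]
    {f : W → F} {U : Set W} (hU : IsOpen U) (hf : DifferentiableOn ℂ f U) (v : W) :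
    DifferentiableOn ℂ (fun w => fderiv ℂ f w v) U := by
  intro w hw
  obtain ⟨r, hr, hrU, M, hM⟩ : ∃ r > 0, ball w r ⊆ U ∧ ∃ M, ∀ x ∈ ball w r, ‖f x‖ ≤ M := by
    have hc : ContinuousAt f w := ((hf w hw).differentiableAt (hU.mem_nhds hw)).continuousAt
    have h1 : ∀ᶠ x in 𝓝 w, ‖f x‖ ≤ ‖f w‖ + 1 :=
      (hc.norm.eventually_lt_const (lt_add_one _)).mono fun x hx => hx.le
    obtain ⟨r, hr, h⟩ := Metric.mem_nhds_iff.1 (inter_mem (hU.mem_nhds hw) h1)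
    exact ⟨r, hr, fun x hx => (h hx).1, _, fun x hx => (h hx).2⟩
  obtain ⟨ρ, hρ, hρv⟩ : ∃ ρ > 0, ρ * ‖v‖ < r / 2 := by
    refine ⟨r / 2 / (‖v‖ + 1), by positivity, ?_⟩
    rw [div_mul_eq_mul_div, div_lt_iff₀ (by positivity)]
    nlinarith [norm_nonneg v]
  have hin : ∀ x ∈ ball w (r / 2), ∀ t : ℂ, ‖t‖ ≤ ρ → x + t • v ∈ ball w r := by
    intro x hx t ht
    rw [mem_ball, dist_eq_norm] at *
    have : ‖t • v‖ ≤ ρ * ‖v‖ := by rw [norm_smul]; gcongr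
    calc ‖x + t • v - w‖ = ‖(x - w) + t • v‖ := by congr 1; abel
      _ ≤ _ := norm_add_le _ _
      _ < r := by linarith
  have hval : ∀ x ∈ ball w (r / 2), fderiv ℂ f x v =
      (2 * Real.pi * Complex.I : ℂ)⁻¹ • ∮ t in C(0, ρ), ((t - 0) ^ 2)⁻¹ • f (x + t • v) := by
    intro x hx
    have hxU : x ∈ U := hrU (ball_subset_ball (by linarith) hx)
    have hopen : IsOpen ((fun t : ℂ => x + t • v) ⁻¹' U) :=
      hU.preimage (by fun_prop)
    have := Complex.two_pi_I_inv_smul_circleIntegral_sub_sq_inv_smul_of_differentiable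
      (U := (fun t : ℂ => x + t • v) ⁻¹' U) (f := fun t : ℂ => f (x + t • v)) (c := 0) (w₀ := 0)
      (R := ρ) hopen
      (fun t ht => hrU (hin x hx t (by simpa using ht)))
      (hf.comp (by fun_prop) (fun t ht => ht)) (by simpa using hρ)
    rw [this]
    have hd := ((hf x hxU).differentiableAt (hU.mem_nhds hxU)).hasFDerivAt
    have hl : HasDerivAt (fun t : ℂ => x + t • v) v 0 := by
      simpa using ((hasDerivAt_id (0 : ℂ)).smul_const v).const_add x
    have hd' : HasFDerivAt f (fderiv ℂ f x) (x + (0 : ℂ) • v) := by simpa using hd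
    exact ((hd'.comp_hasDerivAt (0 : ℂ) hl).deriv).symm
  have hintble : DifferentiableOn ℂ (fun x => ∮ t in C(0, ρ), ((t - 0) ^ 2)⁻¹ • f (x + t • v))
      (ball w (r / 2)) := by
    simp only [circleIntegral, intervalIntegral.integral_of_le Real.two_pi_pos.le]
    have hcn : ∀ θ : ℝ, ‖circleMap 0 ρ θ‖ = ρ := fun θ => by simp [abs_of_pos hρ]
    refine differentiableOn_integral_of_dominated isOpen_ball (bound := fun _ => ρ * ((ρ ^ 2)⁻¹ * M))
      (integrable_const _) ?_ ?_ ?_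
    · intro x hx
      refine Continuous.aestronglyMeasurable ?_
      have h0 : ∀ θ : ℝ, (circleMap 0 ρ θ - 0) ^ 2 ≠ 0 := fun θ => by
        simp [hρ.ne']
      have h1 : Continuous (fun θ : ℝ => f (x + circleMap 0 ρ θ • v)) := by
        refine (hf.continuousOn.mono hrU).comp_continuous (by fun_prop) (fun θ => ?_)
        exact hin x hx _ (hcn θ).le
      have h2 : Continuous fun θ : ℝ => deriv (circleMap 0 ρ) θ := by
        simp only [deriv_circleMap]; fun_prop
      exact h2.smul (((by fun_prop : Continuous fun θ : ℝ => (circleMap 0 ρ θ - 0) ^ 2).inv₀ h0).smul h1)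
    · refine Eventually.of_forall fun θ => ?_
      have : DifferentiableOn ℂ (fun x => f (x + circleMap 0 ρ θ • v)) (ball w (r / 2)) :=
        (hf.mono hrU).comp (by fun_prop) (fun x hx => hin x hx _ (hcn θ).le)
      exact (this.const_smul _).const_smul _
    · refine Eventually.of_forall fun θ x hx => ?_
      rw [norm_smul, norm_smul, deriv_circleMap, norm_mul, hcn, norm_inv, norm_pow, sub_zero, hcn]
      simp only [Complex.norm_I, mul_one]
      gcongr
      exact hM _ (hin x hx _ (hcn θ).le)
  have hw' : w ∈ ball w (r / 2) := mem_ball_self (half_pos hr)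
  have h3 := (((hintble.const_smul (2 * Real.pi * Complex.I : ℂ)⁻¹).congr hval) w hw').differentiableAt
    (isOpen_ball.mem_nhds hw')
  exact h3.differentiableWithinAt

theorem differentiableOn_fderiv {W : Type*} [NormedAddCommGroup W] [NormedSpace ℂ W]
    {F : Type*} [NormedAddCommGroup F] [NormedSpace ℂ F] [FiniteDimensional ℂ W] [CompleteSpace F]
    {f : W → F} {U : Set W} (hU : IsOpen U) (hf : DifferentiableOn ℂ f U) :
    DifferentiableOn ℂ (fderiv ℂ f) U := by
  let b := Module.finBasis ℂ W
  have : fderiv ℂ f = fun w => ∑ i,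
      (ContinuousLinearMap.smulRightL ℂ W F (LinearMap.toContinuousLinearMap (b.coord i)))
        (fderiv ℂ f w (b i)) := by
    funext w
    ext x
    conv_lhs => rw [← b.sum_repr x, map_sum]
    simp
  rw [this]
  refine DifferentiableOn.fun_sum fun i _ => ?_
  exact (ContinuousLinearMap.differentiable _).comp_differentiableOn
    (differentiableOn_fderiv_apply hU hf (b i))

universe u in
theorem contDiffOn_of_holomorphic {W : Type u} [NormedAddCommGroup W] [NormedSpace ℂ W]
    [FiniteDimensional ℂ W] {U : Set W} (hU : IsOpen U) (n : ℕ) :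
    ∀ {F : Type u} [NormedAddCommGroup F] [NormedSpace ℂ F] [CompleteSpace F]
    {f : W → F}, DifferentiableOn ℂ f U → ContDiffOn ℂ n f U := by
  induction n with
  | zero => intro F _ _ _ f hf; exact contDiffOn_zero.2 hf.continuousOn
  | succ n ih =>
    intro F _ _ _ f hf
    push_cast
    rw [contDiffOn_succ_iff_fderiv_of_isOpen hU]
    exact ⟨hf, by simp, ih (differentiableOn_fderiv hU hf)⟩

/-- Holomorphic maps on a ball are approximated by entire maps on smaller balls. -/
theorem exists_entire_approx_on_ball {W F : Type} [NormedAddCommGroup W] [NormedSpace ℂ W]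
    [FiniteDimensional ℂ W] [NormedAddCommGroup F] [NormedSpace ℂ F] [CompleteSpace F]
    {f : W → F} {r R ε : ℝ} (hr : 0 < r) (hrR : r < R) (hε : 0 < ε)
    (hf : DifferentiableOn ℂ f (ball 0 R)) :
    ∃ g : W → F, Differentiable ℂ g ∧ ∀ w ∈ ball (0 : W) r, ‖g w - f w‖ ≤ ε := by
  obtain ⟨R', hrR', hltR⟩ := exists_between hrR
  have hprop : ProperSpace W := FiniteDimensional.proper ℂ W
  obtain ⟨M, hM⟩ := (isCompact_closedBall (0 : W) R').exists_bound_of_continuousOn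
    (hf.continuousOn.mono (closedBall_subset_ball hltR))
  set ρ := R' / r with hρ
  have hρ1 : 1 < ρ := by rw [hρ, one_lt_div hr]; exact hrR'
  have hq : ρ⁻¹ < 1 := inv_lt_one_of_one_lt₀ hρ1
  have hρ0 : 0 < ρ := by linarith
  have hlim : Tendsto (fun n : ℕ => M * ρ⁻¹ ^ n / (1 - ρ⁻¹)) atTop (𝓝 0) := by
    have := (((tendsto_pow_atTop_nhds_zero_of_lt_one (inv_nonneg.2 hρ0.le) hq).const_mul
      M).div_const (1 - ρ⁻¹))
    simpa using this
  obtain ⟨n, hn⟩ := (hlim.eventually_lt_const hε).exists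
  refine ⟨fun w => ∑ k ∈ Finset.range n,
    ((k.factorial : ℂ)⁻¹ • iteratedFDeriv ℂ k f 0 fun _ => w), ?_, ?_⟩
  · refine Differentiable.fun_sum fun k _ => Differentiable.const_smul ?_ _
    have h1 : ContDiff ℂ ⊤ (fun m : Fin k → W => iteratedFDeriv ℂ k f 0 m) :=
      ContinuousMultilinearMap.contDiff _
    exact (h1.differentiable (by simp)).comp (differentiable_pi.2 fun _ => differentiable_id)
  · intro w hw
    have hw' : ‖w‖ < r := by simpa using hw
    have hmem : ∀ t : ℂ, ‖t‖ ≤ ρ → t • w ∈ closedBall (0 : W) R' := by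
      intro t ht
      rw [mem_closedBall_zero_iff, norm_smul]
      calc ‖t‖ * ‖w‖ ≤ ρ * r := by gcongr
        _ = R' := by rw [hρ]; field_simp
    let g : ℂ → F := fun t => f (t • w)
    have hgo : DifferentiableOn ℂ g ((fun t : ℂ => t • w) ⁻¹' ball 0 R) :=
      hf.comp (by fun_prop) (fun t ht => ht)
    have hcl : closedBall (0 : ℂ) ρ ⊆ ((fun t : ℂ => t • w) ⁻¹' ball 0 R) := fun t ht =>
      closedBall_subset_ball hltR (hmem t (by simpa using ht))
    have hg : DifferentiableOn ℂ g (ball 0 ρ) := hgo.mono (ball_subset_closedBall.trans hcl)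
    have hgc : DiffContOnCl ℂ g (ball 0 ρ) := by
      refine DifferentiableOn.diffContOnCl ?_
      rw [closure_ball _ hρ0.ne']
      exact hgo.mono hcl
    have hsum := Complex.hasSum_taylorSeries_on_ball hg (z := 1) (by simpa using hρ1)
    have hiter : ∀ k, iteratedDeriv k g 0 = iteratedFDeriv ℂ k f 0 (fun _ => w) := by
      intro k
      let L : ℂ →L[ℂ] W := (ContinuousLinearMap.id ℂ ℂ).smulRight w
      have hLo : IsOpen (L ⁻¹' ball 0 R) := isOpen_ball.preimage L.continuous
      have h0 : L 0 ∈ ball (0 : W) R := by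
        rw [map_zero]; exact mem_ball_self (by linarith)
      have := L.iteratedFDerivWithin_comp_right
        (contDiffOn_of_holomorphic isOpen_ball k hf) isOpen_ball.uniqueDiffOn
        hLo.uniqueDiffOn h0 (i := k) le_rfl
      rw [iteratedFDerivWithin_of_isOpen k hLo h0,
        iteratedFDerivWithin_of_isOpen k isOpen_ball h0] at this
      rw [iteratedDeriv_eq_iteratedFDeriv]
      change iteratedFDeriv ℂ k (f ∘ L) 0 _ = _
      rw [this, map_zero]
      simp [L, ContinuousMultilinearMap.compContinuousLinearMap_apply]
    have hb : ∀ k, ‖(k.factorial : ℂ)⁻¹ • ((1 : ℂ) - 0) ^ k • iteratedDeriv k g 0‖ ≤ M * ρ⁻¹ ^ k := by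
      intro k
      have := Complex.norm_iteratedDeriv_le_of_forall_mem_sphere_norm_le k hρ0 hgc (C := M)
        (fun t ht => hM _ (hmem t (by simpa using (mem_sphere_zero_iff_norm.1 ht).le)))
      have hfac : (0 : ℝ) < k.factorial := by positivity
      rw [norm_smul, norm_smul, norm_inv, Complex.norm_natCast]
      simp only [sub_zero, one_pow, norm_one, one_mul]
      calc _ ≤ (k.factorial : ℝ)⁻¹ * (k.factorial * M / ρ ^ k) := by gcongr
        _ = _ := by rw [inv_pow]; field_simp
    have := norm_sub_le_of_geometric_bound_of_hasSum hq hb hsum n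
    simp only [sub_zero, one_pow, one_smul, hiter] at this
    have hg1 : g 1 = f w := by simp [g]
    rw [hg1] at this
    exact this.trans hn.le

end Taylor

section Words

/-- Vectors of length `r + 1`, the letters of the words below. -/
abbrev Vec (r : ℕ) := Fin (r + 1) → ℂ

/-- Row vectors of length `r + 2`, split as first entry and the rest. -/
abbrev Row (r : ℕ) := ℂ × Vec r

variable {r : ℕ}

/-- The elementary operation in slot `k`: upper for even `k`, lower for odd `k`. -/
def slotStep (k : ℕ) (v : Vec r) (s : Row r) : Row r :=
  if Even k then (s.1, s.2 + s.1 • v) else (s.1 + s.2 ⬝ᵥ v, s.2)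

/-- The effect of the first `n` letters of the word `z` on a row. -/
def runWord (z : ℕ → Vec r) : ℕ → Row r → Row r
  | 0, s => s
  | n + 1, s => slotStep n (z n) (runWord z n s)

/-- The first row of the identity matrix. -/
def baseRow (r : ℕ) : Row r := (1, 0)

@[simp] theorem runWord_zero (z : ℕ → Vec r) (s : Row r) : runWord z 0 s = s := rfl

theorem runWord_succ (z : ℕ → Vec r) (n : ℕ) (s : Row r) :
    runWord z (n + 1) s = slotStep n (z n) (runWord z n s) := rfl

theorem slotStep_odd {k : ℕ} (h : ¬ Even k) (v : Vec r) (s : Row r) :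
    slotStep k v s = (s.1 + s.2 ⬝ᵥ v, s.2) := if_neg h

@[simp] theorem slotStep_zero (k : ℕ) (s : Row r) : slotStep k 0 s = s := by
  unfold slotStep; split_ifs <;> simp

theorem slotStep_neg (k : ℕ) (v : Vec r) (s : Row r) : slotStep k (-v) (slotStep k v s) = s := by
  unfold slotStep; split_ifs <;> simp

theorem slotStep_smul (k : ℕ) (v : Vec r) (c : ℂ) (s : Row r) :
    slotStep k v (c • s) = c • slotStep k v s := by
  unfold slotStep
  split_ifs
  · ext <;> simp; ring
  · ext <;> simp [mul_add]

theorem slotStep_injective (k : ℕ) (v : Vec r) : Function.Injective (slotStep (r := r) k v) :=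
  Function.LeftInverse.injective (g := slotStep k (-v)) (slotStep_neg k v)

theorem runWord_smul (z : ℕ → Vec r) (n : ℕ) (c : ℂ) (s : Row r) :
    runWord z n (c • s) = c • runWord z n s := by
  induction n with
  | zero => rfl
  | succ n ih => rw [runWord_succ, ih, slotStep_smul, runWord_succ]

theorem runWord_congr_from {z z' : ℕ → Vec r} {k n : ℕ} {s s' : Row r}
    (h : runWord z k s = runWord z' k s') (hkn : k ≤ n) (hz : ∀ i, k ≤ i → i < n → z i = z' i) :
    runWord z n s = runWord z' n s' := by
  induction n, hkn using Nat.le_induction with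
  | base => exact h
  | succ n hn ih =>
    rw [runWord_succ, runWord_succ, ih fun i h1 h2 => hz i h1 (by omega), hz n hn (by omega)]

theorem runWord_congr {z z' : ℕ → Vec r} {n : ℕ} (s : Row r) (hz : ∀ i, i < n → z i = z' i) :
    runWord z n s = runWord z' n s :=
  runWord_congr_from (k := 0) rfl (Nat.zero_le n) fun i _ h => hz i h

theorem runWord_cancel {z z' : ℕ → Vec r} {k n : ℕ} {s s' : Row r}
    (h : runWord z n s = runWord z' n s') (hkn : k ≤ n) (hz : ∀ i, k ≤ i → i < n → z i = z' i) :
    runWord z k s = runWord z' k s' := by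
  induction n, hkn using Nat.le_induction with
  | base => exact h
  | succ n hn ih =>
    refine ih ?_ fun i h1 h2 => hz i h1 (by omega)
    rw [runWord_succ, runWord_succ, hz n hn (by omega)] at h
    exact slotStep_injective _ _ h

theorem runWord_zero_word {z : ℕ → Vec r} {n : ℕ} (s : Row r) (hz : ∀ i, i < n → z i = 0) :
    runWord z n s = s := by
  induction n with
  | zero => rfl
  | succ n ih => rw [runWord_succ, ih fun i h => hz i (by omega), hz n (by omega), slotStep_zero]

theorem runWord_add {k : ℕ} (hk : Even k) (z : ℕ → Vec r) (n : ℕ) (s : Row r) :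
    runWord z (k + n) s = runWord (fun i => z (k + i)) n (runWord z k s) := by
  induction n with
  | zero => rfl
  | succ n ih =>
    rw [← add_assoc, runWord_succ, ih, runWord_succ]
    have : Even (k + n) ↔ Even n := by simp [Nat.even_add, hk]
    simp only [slotStep, this]

variable {L : ℕ}

end Words

section ExpQuot

/-- The entire function `(exp t - 1) / t`. -/
noncomputable def expQuot (t : ℂ) : ℂ := dslope Complex.exp 0 t

theorem mul_expQuot (t : ℂ) : t * expQuot t = Complex.exp t - 1 := by
  have := sub_smul_dslope Complex.exp 0 t
  simpa [expQuot] using this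

theorem exp_mul_expQuot_neg (t : ℂ) : Complex.exp t * expQuot (-t) = expQuot t := by
  by_cases ht : t = 0
  · simp [ht]
  · have h1 := mul_expQuot t
    have h2 := mul_expQuot (-t)
    have h3 : Complex.exp t * Complex.exp (-t) = 1 := by rw [← Complex.exp_add]; simp
    apply mul_left_cancel₀ ht
    linear_combination (-Complex.exp t) * h2 - h1 - h3

theorem differentiable_expQuot : Differentiable ℂ expQuot := by
  have : DifferentiableOn ℂ (dslope Complex.exp 0) univ :=
    (Complex.differentiableOn_dslope (by simp)).2 Complex.differentiable_exp.differentiableOn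
  exact differentiableOn_univ.1 this

@[fun_prop] theorem contDiff_expQuot {n : WithTop ℕ∞} : ContDiff ℂ n expQuot :=
  differentiable_expQuot.contDiff

@[simp] theorem expQuot_zero : expQuot 0 = 1 := by
  simp [expQuot, Complex.deriv_exp]

/-- The function `log v / (v - 1)` on the slit plane. -/
noncomputable def logQuot (v : ℂ) : ℂ := dslope Complex.log 1 v

theorem sub_one_mul_logQuot (v : ℂ) : (v - 1) * logQuot v = Complex.log v := by
  have := sub_smul_dslope Complex.log 1 v
  simpa [logQuot] using this

@[simp] theorem logQuot_one : logQuot 1 = 1 := by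
  have : deriv Complex.log 1 = 1 := by
    rw [(Complex.hasDerivAt_log (by simp)).deriv]; simp
  simp [logQuot, this]

theorem differentiableOn_logQuot : DifferentiableOn ℂ logQuot Complex.slitPlane :=
  (Complex.differentiableOn_dslope (Complex.isOpen_slitPlane.mem_nhds (by simp))).2
    fun v hv => (Complex.differentiableAt_log hv).differentiableWithinAt

/-- Solving `t * expQuot (D * t) = s` for `t`. -/
theorem mul_expQuot_mul_logQuot (D s : ℂ) (h : 1 + D * s ≠ 0) :
    (s * logQuot (1 + D * s)) * expQuot (D * (s * logQuot (1 + D * s))) = s := by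
  by_cases hD : D = 0
  · simp [hD]
  · have h1 := sub_one_mul_logQuot (1 + D * s)
    have h2 : D * (s * logQuot (1 + D * s)) = Complex.log (1 + D * s) := by
      rw [← h1]; ring
    have h3 := mul_expQuot (Complex.log (1 + D * s))
    rw [Complex.exp_log h, ← h2] at h3
    apply mul_left_cancel₀ hD
    linear_combination h3

end ExpQuot

/-- A function `q` on `J → ℂ`, depending on parameters in `A`, which is affine in every
coordinate, together with its derivative `u` in the direction of the coordinate `o`. -/
structure AffineData (J A : Type) [Fintype J] [DecidableEq J] [NormedAddCommGroup A]
    [NormedSpace ℂ A] where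
  /-- the function -/
  q : (J → ℂ) → A → ℂ
  /-- its derivative in the distinguished direction -/
  u : (J → ℂ) → A → ℂ
  /-- the distinguished coordinate -/
  o : J
  q_smooth : ContDiff ℂ ∞ (fun x : (J → ℂ) × A => q x.1 x.2)
  u_smooth : ContDiff ℂ ∞ (fun x : (J → ℂ) × A => u x.1 x.2)
  q_add_o : ∀ y a c, q (y + Pi.single o c) a = q y a + c * u y a
  u_add_o : ∀ y a c, u (y + Pi.single o c) a = u y a
  q_add : ∀ j y a c, q (y + Pi.single j c) a = q y a + c * (q (y + Pi.single j 1) a - q y a)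
  u_add : ∀ j y a c, u (y + Pi.single j c) a = u y a + c * (u (y + Pi.single j 1) a - u y a)

namespace AffineData

variable {J A : Type} [Fintype J] [DecidableEq J] [NormedAddCommGroup A] [NormedSpace ℂ A]
variable (S : AffineData J A)

/-- The derivative of `q` in the direction `j`. -/
def dq (j : J) (y : J → ℂ) (a : A) : ℂ := S.q (y + Pi.single j 1) a - S.q y a

/-- The derivative of `u` in the direction `j`. -/
def du (j : J) (y : J → ℂ) (a : A) : ℂ := S.u (y + Pi.single j 1) a - S.u y a

/-- The change of the coordinate `j` under the flow. -/
noncomputable def shift (j : J) (t : ℂ) (y : J → ℂ) (a : A) : ℂ :=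
  t * (S.u y a * expQuot (S.du j y a * t))

/-- The flow of `∂q/∂o ∂_j - ∂q/∂j ∂_o`. -/
noncomputable def flow (j : J) (t : ℂ) (y : J → ℂ) (a : A) : J → ℂ :=
  y + Pi.single j (S.shift j t y a) +
    Pi.single S.o (-(t * S.dq j y a * expQuot (-(S.du j y a * t))))

theorem q_flow (j : J) (t : ℂ) (y : J → ℂ) (a : A) : S.q (S.flow j t y a) a = S.q y a := by
  have h1 := mul_expQuot (S.du j y a * t)
  have h2 := exp_mul_expQuot_neg (S.du j y a * t)
  rw [flow, q_add_o, q_add, u_add]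
  change S.q y a + _ * S.dq j y a + _ * (S.u y a + _ * S.du j y a) = _
  rw [shift]
  linear_combination (-(t * S.dq j y a * S.u y a)) * h2 -
    (t * S.dq j y a * expQuot (-(S.du j y a * t))) * S.u y a * h1

@[fun_prop] theorem contDiff_q {E : Type*} [NormedAddCommGroup E] [NormedSpace ℂ E]
    {f : E → J → ℂ} {g : E → A} (hf : ContDiff ℂ ∞ f) (hg : ContDiff ℂ ∞ g) :
    ContDiff ℂ ∞ (fun x => S.q (f x) (g x)) := S.q_smooth.comp (hf.prodMk hg)

@[fun_prop] theorem contDiff_u {E : Type*} [NormedAddCommGroup E] [NormedSpace ℂ E]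
    {f : E → J → ℂ} {g : E → A} (hf : ContDiff ℂ ∞ f) (hg : ContDiff ℂ ∞ g) :
    ContDiff ℂ ∞ (fun x => S.u (f x) (g x)) := S.u_smooth.comp (hf.prodMk hg)

@[fun_prop] theorem contDiff_dq {E : Type*} [NormedAddCommGroup E] [NormedSpace ℂ E] (j : J)
    {f : E → J → ℂ} {g : E → A} (hf : ContDiff ℂ ∞ f) (hg : ContDiff ℂ ∞ g) :
    ContDiff ℂ ∞ (fun x => S.dq j (f x) (g x)) := by
  unfold dq; fun_prop

@[fun_prop] theorem contDiff_du {E : Type*} [NormedAddCommGroup E] [NormedSpace ℂ E] (j : J)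
    {f : E → J → ℂ} {g : E → A} (hf : ContDiff ℂ ∞ f) (hg : ContDiff ℂ ∞ g) :
    ContDiff ℂ ∞ (fun x => S.du j (f x) (g x)) := by
  unfold du; fun_prop

@[fun_prop] theorem contDiff_pi_single {E : Type*} [NormedAddCommGroup E] [NormedSpace ℂ E] (j : J)
    {f : E → ℂ} (hf : ContDiff ℂ ∞ f) : ContDiff ℂ ∞ (fun x => (Pi.single j (f x) : J → ℂ)) :=
  (ContinuousLinearMap.single ℂ (fun _ : J => ℂ) j).contDiff.comp hf

@[fun_prop] theorem contDiff_expQuot_comp {E : Type*} [NormedAddCommGroup E] [NormedSpace ℂ E]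
    {f : E → ℂ} (hf : ContDiff ℂ ∞ f) : ContDiff ℂ ∞ (fun x => expQuot (f x)) :=
  contDiff_expQuot.comp hf

@[fun_prop] theorem contDiff_shift {E : Type*} [NormedAddCommGroup E] [NormedSpace ℂ E] (j : J)
    {t : E → ℂ} {f : E → J → ℂ} {g : E → A} (ht : ContDiff ℂ ∞ t)
    (hf : ContDiff ℂ ∞ f) (hg : ContDiff ℂ ∞ g) :
    ContDiff ℂ ∞ (fun x => S.shift j (t x) (f x) (g x)) := by
  unfold shift; fun_prop

@[fun_prop] theorem contDiff_flow {E : Type*} [NormedAddCommGroup E] [NormedSpace ℂ E] (j : J)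
    {t : E → ℂ} {f : E → J → ℂ} {g : E → A} (ht : ContDiff ℂ ∞ t)
    (hf : ContDiff ℂ ∞ f) (hg : ContDiff ℂ ∞ g) :
    ContDiff ℂ ∞ (fun x => S.flow j (t x) (f x) (g x)) := by
  unfold flow; fun_prop

theorem flow_apply_self {j : J} (hj : j ≠ S.o) (t : ℂ) (y : J → ℂ) (a : A) :
    S.flow j t y a j = y j + S.shift j t y a := by
  simp [flow, hj]

theorem flow_apply_of_ne {j i : J} (hi : i ≠ S.o) (hij : i ≠ j) (t : ℂ) (y : J → ℂ) (a : A) :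
    S.flow j t y a i = y i := by
  simp [flow, hi, hij]

/-- Points with the same value of `q` and the same coordinates other than `o` agree where
`u` does not vanish. -/
theorem eq_of_forall_ne {y y' : J → ℂ} {a : A} (h : ∀ i, i ≠ S.o → y i = y' i)
    (hq : S.q y a = S.q y' a) (hu : S.u y a ≠ 0) : y = y' := by
  have h1 : y' = y + Pi.single S.o (y' S.o - y S.o) := by
    funext i
    by_cases hi : i = S.o
    · subst hi; simp
    · simp [hi, h i hi]
  rw [h1, q_add_o] at hq
  have h2 : y' S.o - y S.o = 0 := by
    have : (y' S.o - y S.o) * S.u y a = 0 := by linear_combination -hq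
    exact (mul_eq_zero.1 this).resolve_right hu
  rw [h1, h2]; simp

theorem u_congr {y y' : J → ℂ} {a : A} (h : ∀ i, i ≠ S.o → y i = y' i) : S.u y a = S.u y' a := by
  have h1 : y' = y + Pi.single S.o (y' S.o - y S.o) := by
    funext i
    by_cases hi : i = S.o
    · subst hi; simp
    · simp [hi, h i hi]
  rw [h1, u_add_o]

/-- A holomorphic family of maps preserving `q`. -/
structure Spray where
  /-- the parameter space -/
  P : Type
  [normed : NormedAddCommGroup P]
  [space : NormedSpace ℂ P]
  [finDim : FiniteDimensional ℂ P]
  /-- the map with a given parameter -/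
  map : P → (J → ℂ) → A → (J → ℂ)
  smooth : ContDiff ℂ ∞ (fun x : P × (J → ℂ) × A => map x.1 x.2.1 x.2.2)
  q_map : ∀ p y a, S.q (map p y a) a = S.q y a
  map_zero : ∀ y a, map 0 y a = y

attribute [instance] Spray.normed Spray.space Spray.finDim

variable {W : Type} [NormedAddCommGroup W] [NormedSpace ℂ W]

/-- `y'` is obtained from `y` by a spray with holomorphic parameter. -/
def Reach (E : Set W) (a : W → A) (y y' : W → J → ℂ) : Prop :=
  ∃ (M : S.Spray) (p : W → M.P), DifferentiableOn ℂ p E ∧ ∀ w ∈ E, y' w = M.map (p w) (y w) (a w)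

variable {S} {E : Set W} {a : W → A} {y y' y'' : W → J → ℂ}

theorem Reach.of_eqOn (h : ∀ w ∈ E, y' w = y w) : S.Reach E a y y' :=
  ⟨{ P := ℂ, map := fun _ y _ => y, smooth := by fun_prop, q_map := fun _ _ _ => rfl,
      map_zero := fun _ _ => rfl },
    fun _ => 0, differentiableOn_const _, h⟩

variable (S) in
/-- Two sprays, one after the other. -/
noncomputable def Spray.comp (M M' : S.Spray) : S.Spray where
  P := M.P × M'.P
  map := fun p y a => M'.map p.2 (M.map p.1 y a) a
  smooth := by
    have h1 : ContDiff ℂ ∞ (fun x : (M.P × M'.P) × (J → ℂ) × A => M.map x.1.1 x.2.1 x.2.2) :=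
      M.smooth.comp (by fun_prop : ContDiff ℂ ∞
        (fun x : (M.P × M'.P) × (J → ℂ) × A => (x.1.1, x.2.1, x.2.2)))
    exact M'.smooth.comp ((by fun_prop : ContDiff ℂ ∞
      (fun x : (M.P × M'.P) × (J → ℂ) × A => x.1.2)).prodMk (h1.prodMk (by fun_prop)))
  q_map := fun p y a => by rw [M'.q_map, M.q_map]
  map_zero := fun y a => by simp [M.map_zero, M'.map_zero]

theorem Reach.trans (h : S.Reach E a y y') (h' : S.Reach E a y' y'') : S.Reach E a y y'' := by
  obtain ⟨M, p, hp, h⟩ := h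
  obtain ⟨M', p', hp', h'⟩ := h'
  exact ⟨Spray.comp S M M', fun w => (p w, p' w), hp.prodMk hp',
    fun w hw => by rw [h' w hw, h w hw]; rfl⟩

theorem Reach.mono {E' : Set W} (h : S.Reach E a y y') (hE : E' ⊆ E) : S.Reach E' a y y' := by
  obtain ⟨M, p, hp, h⟩ := h
  exact ⟨M, p, hp.mono hE, fun w hw => h w (hE hw)⟩

theorem Reach.congr_right (h : S.Reach E a y y') (h' : ∀ w ∈ E, y'' w = y' w) :
    S.Reach E a y y'' := h.trans (Reach.of_eqOn h')

variable (S) in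
/-- The spray given by the flow of a single field. -/
noncomputable def flowSpray (j : J) : S.Spray where
  P := ℂ
  map := S.flow j
  smooth := by fun_prop
  q_map := fun t y a => S.q_flow j t y a
  map_zero := fun y a => by simp [flow, shift]

theorem differentiableOn_q (ha : DifferentiableOn ℂ a E) (hy : DifferentiableOn ℂ y E) :
    DifferentiableOn ℂ (fun w => S.q (y w) (a w)) E :=
  (S.q_smooth.differentiable (by simp)).comp_differentiableOn (hy.prodMk ha)

theorem differentiableOn_u (ha : DifferentiableOn ℂ a E) (hy : DifferentiableOn ℂ y E) :
    DifferentiableOn ℂ (fun w => S.u (y w) (a w)) E :=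
  (S.u_smooth.differentiable (by simp)).comp_differentiableOn (hy.prodMk ha)

theorem differentiableOn_div {f g : W → ℂ} (hf : DifferentiableOn ℂ f E)
    (hg : DifferentiableOn ℂ g E) (h : ∀ w ∈ E, g w ≠ 0) :
    DifferentiableOn ℂ (fun w => f w / g w) E := by
  simp only [div_eq_mul_inv]
  exact hf.mul (hg.inv h)

theorem Reach.step {j : J} (hj : j ≠ S.o) (ha : DifferentiableOn ℂ a E)
    (hy : DifferentiableOn ℂ y E) (hy' : DifferentiableOn ℂ y' E)
    (h : ∀ w ∈ E, ∀ i, i ≠ j → i ≠ S.o → y w i = y' w i)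
    (hq : ∀ w ∈ E, S.q (y w) (a w) = S.q (y' w) (a w))
    (hu : ∀ w ∈ E, S.u (y w) (a w) ≠ 0)
    (hslit : ∀ w ∈ E, S.u (y' w) (a w) / S.u (y w) (a w) ∈ Complex.slitPlane) :
    S.Reach E a y y' := by
  let s : W → ℂ := fun w => (y' w j - y w j) / S.u (y w) (a w)
  have huu : ∀ w ∈ E, S.u (y' w) (a w) / S.u (y w) (a w) = 1 + S.du j (y w) (a w) * s w := by
    intro w hw
    have h1 : S.u (y' w) (a w) = S.u (y w + Pi.single j (y' w j - y w j)) (a w) := by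
      refine S.u_congr fun i hi => ?_
      by_cases hij : i = j
      · subst hij; simp
      · simp [hij, h w hw i hij hi]
    rw [h1, u_add]
    have := hu w hw
    simp only [s, du]
    field_simp
  have hju : DifferentiableOn ℂ (fun w => S.u (y w) (a w)) E := differentiableOn_u ha hy
  have hsd : DifferentiableOn ℂ s E :=
    differentiableOn_div ((differentiableOn_pi.1 hy' j).sub (differentiableOn_pi.1 hy j)) hju hu
  refine ⟨S.flowSpray j, fun w => s w * logQuot (S.u (y' w) (a w) / S.u (y w) (a w)), ?_, ?_⟩
  · exact hsd.mul (differentiableOn_logQuot.comp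
      (differentiableOn_div (differentiableOn_u ha hy') hju hu) hslit)
  · intro w hw
    have hne : S.u (y' w) (a w) ≠ 0 := fun h0 => by
      have := hslit w hw
      rw [h0, zero_div] at this
      exact Complex.slitPlane_ne_zero this rfl
    refine S.eq_of_forall_ne (a := a w) (fun i hi => ?_) ?_ hne
    · change _ = S.flow j _ _ _ i
      by_cases hij : i = j
      · subst hij
        rw [flow_apply_self S hi, shift]
        beta_reduce
        rw [huu w hw]
        have hslit' := Complex.slitPlane_ne_zero (hslit w hw)
        rw [huu w hw] at hslit'
        have h2 := mul_expQuot_mul_logQuot (S.du i (y w) (a w)) (s w) hslit'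
        have h3 : s w * S.u (y w) (a w) = y' w i - y w i := div_mul_cancel₀ _ (hu w hw)
        linear_combination (-h3) - S.u (y w) (a w) * h2
      · rw [flow_apply_of_ne S hi hij, h w hw i hij hi]
    · rw [← hq w hw]
      exact (S.q_flow j _ _ _).symm

end AffineData

namespace AffineData

variable {J A : Type} [Fintype J] [DecidableEq J] [NormedAddCommGroup A] [NormedSpace ℂ A]
variable {W : Type} [NormedAddCommGroup W] [NormedSpace ℂ W]
variable {S : AffineData J A} {E : Set W} {a : W → A} {y y' y'' : W → J → ℂ}

/-- The coordinates of `y'` in `T`, those of `y` elsewhere. -/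
def mix (T : Finset J) (y y' : J → ℂ) : J → ℂ := fun i => if i ∈ T then y' i else y i

theorem mix_self (T : Finset J) (y : J → ℂ) : mix T y y = y := by
  funext i; simp [mix]

theorem continuous_mix (T : Finset J) :
    Continuous (fun x : (J → ℂ) × (J → ℂ) => mix T x.1 x.2) := by
  refine continuous_pi fun i => ?_
  unfold mix
  split_ifs <;> fun_prop

theorem differentiableOn_mix (T : Finset J) (hy : DifferentiableOn ℂ y E)
    (hy' : DifferentiableOn ℂ y' E) : DifferentiableOn ℂ (fun w => mix T (y w) (y' w)) E := by
  refine differentiableOn_pi.2 fun i => ?_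
  unfold mix
  split_ifs
  · exact differentiableOn_pi.1 hy' i
  · exact differentiableOn_pi.1 hy i

variable (S) in
/-- The point `mix T y y'`, corrected in the coordinate `o` to have the same `q` as `y`. -/
noncomputable def corr (T : Finset J) (y y' : J → ℂ) (a : A) : J → ℂ :=
  mix T y y' + Pi.single S.o ((S.q y a - S.q (mix T y y') a) / S.u (mix T y y') a)

theorem q_corr {T : Finset J} {y y' : J → ℂ} {a : A} (h : S.u (mix T y y') a ≠ 0) :
    S.q (S.corr T y y' a) a = S.q y a := by
  rw [corr, q_add_o]; field_simp; ring

theorem u_corr {T : Finset J} {y y' : J → ℂ} {a : A} :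
    S.u (S.corr T y y' a) a = S.u (mix T y y') a := by
  rw [corr, u_add_o]

theorem corr_apply {T : Finset J} {y y' : J → ℂ} {a : A} {i : J} (hi : i ≠ S.o) :
    S.corr T y y' a i = mix T y y' i := by
  simp [corr, hi]

theorem ne_zero_of_near {z : ℂ} (h : ‖z - 1‖ < 1 / 4) : z ≠ 0 := by
  rintro rfl; norm_num at h

theorem div_mem_slitPlane_of_near {z z' : ℂ} (h : ‖z - 1‖ < 1 / 4) (h' : ‖z' - 1‖ < 1 / 4) :
    z' / z ∈ Complex.slitPlane := by
  have hz := ne_zero_of_near h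
  have h1 : z' / z = 1 + (z' - z) / z := by field_simp; ring
  rw [h1]
  refine Complex.mem_slitPlane_of_norm_lt_one ?_
  have h2 : 3 / 4 < ‖z‖ := by
    have := norm_sub_norm_le (1 : ℂ) (1 - z)
    rw [norm_sub_rev 1 z] at this
    simp at this; linarith
  have h3 : ‖z' - z‖ < 1 / 2 := by
    have := norm_sub_le (z' - 1) (z - 1)
    rw [sub_sub_sub_cancel_right] at this; linarith
  rw [norm_div, div_lt_one (by linarith)]; linarith

/-- Nearby points with the same `q` are connected by a spray. -/
theorem Reach.of_near (ha : DifferentiableOn ℂ a E)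
    (hy : DifferentiableOn ℂ y E) (hy' : DifferentiableOn ℂ y' E)
    (hq : ∀ w ∈ E, S.q (y w) (a w) = S.q (y' w) (a w))
    (hu : ∀ w ∈ E, ∀ T : Finset J, ‖S.u (mix T (y w) (y' w)) (a w) - 1‖ < 1 / 4) :
    S.Reach E a y y' := by
  have hdiff : ∀ T : Finset J, DifferentiableOn ℂ (fun w => S.corr T (y w) (y' w) (a w)) E := by
    intro T
    have h1 := differentiableOn_mix T hy hy'
    exact h1.add ((ContinuousLinearMap.single ℂ (fun _ : J => ℂ) S.o).differentiable.comp_differentiableOn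
      (differentiableOn_div ((differentiableOn_q ha hy).sub (differentiableOn_q ha h1))
        (differentiableOn_u ha h1) fun w hw => ne_zero_of_near (hu w hw T)))
  have key : ∀ T : Finset J, S.o ∉ T → S.Reach E a y (fun w => S.corr T (y w) (y' w) (a w)) := by
    intro T
    induction T using Finset.induction_on with
    | empty =>
      intro _
      refine Reach.of_eqOn fun w _ => ?_
      have : mix ∅ (y w) (y' w) = y w := by funext i; simp [mix]
      simp [corr, this]
    | insert j T hjT ih =>
      intro ho
      rw [Finset.mem_insert, not_or] at ho
      refine (ih ho.2).trans (Reach.step (j := j) (Ne.symm ho.1) ha (hdiff T) (hdiff _) ?_ ?_ ?_ ?_)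
      · intro w _ i hij hio
        rw [corr_apply hio, corr_apply hio]
        simp [mix, hij]
      · intro w hw
        rw [q_corr (ne_zero_of_near (hu w hw _)), q_corr (ne_zero_of_near (hu w hw _))]
      · intro w hw
        rw [u_corr]; exact ne_zero_of_near (hu w hw _)
      · intro w hw
        rw [u_corr, u_corr]; exact div_mem_slitPlane_of_near (hu w hw _) (hu w hw _)
  refine (key (Finset.univ.erase S.o) (by simp)).congr_right fun w hw => ?_
  refine (S.eq_of_forall_ne (a := a w) (fun i hi => ?_) ?_ ?_).symm
  · rw [corr_apply hi]; simp [mix, hi]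
  · rw [q_corr (ne_zero_of_near (hu w hw _)), hq w hw]
  · rw [u_corr]; exact ne_zero_of_near (hu w hw _)

/-- The ends of a path along which `q` is constant and `u = 1` are connected by a spray. -/
theorem Reach.of_path {K : Set W} (hK : IsCompact K) (hEK : E ⊆ K) {Y : ℝ → W → J → ℂ}
    (hY : ContinuousOn (fun x : ℝ × W => Y x.1 x.2) (Icc 0 1 ×ˢ K))
    (ha : DifferentiableOn ℂ a E) (hac : ContinuousOn a K)
    (hd : ∀ s ∈ Icc (0 : ℝ) 1, DifferentiableOn ℂ (Y s) E)
    (hq : ∀ s ∈ Icc (0 : ℝ) 1, ∀ w ∈ E, S.q (Y s w) (a w) = S.q (Y 0 w) (a w))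
    (hu : ∀ s ∈ Icc (0 : ℝ) 1, ∀ w ∈ K, S.u (Y s w) (a w) = 1) :
    S.Reach E a (Y 0) (Y 1) := by
  let H : (ℝ × ℝ) × W → Finset J → ℂ := fun x T =>
    S.u (mix T (Y x.1.1 x.2) (Y x.1.2 x.2)) (a x.2)
  have hH : ContinuousOn H ((Icc 0 1 ×ˢ Icc 0 1) ×ˢ K) := by
    refine continuousOn_pi.2 fun T => ?_
    refine S.u_smooth.continuous.comp_continuousOn (ContinuousOn.prodMk ?_ ?_)
    · refine (continuous_mix T).comp_continuousOn (ContinuousOn.prodMk ?_ ?_)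
      · exact hY.comp (f := fun x : (ℝ × ℝ) × W => (x.1.1, x.2)) (by fun_prop)
          fun x hx => ⟨hx.1.1, hx.2⟩
      · exact hY.comp (f := fun x : (ℝ × ℝ) × W => (x.1.2, x.2)) (by fun_prop)
          fun x hx => ⟨hx.1.2, hx.2⟩
    · exact hac.comp (by fun_prop) fun x hx => hx.2
  have hcomp : IsCompact ((Icc (0 : ℝ) 1 ×ˢ Icc (0 : ℝ) 1) ×ˢ K) :=
    (isCompact_Icc.prod isCompact_Icc).prod hK
  obtain ⟨δ, hδ, hHδ⟩ := Metric.uniformContinuousOn_iff.1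
    (hcomp.uniformContinuousOn_of_continuous hH) (1 / 4) (by norm_num)
  obtain ⟨n, hn⟩ := exists_nat_one_div_lt hδ
  have hn0 : (0 : ℝ) < n + 1 := by positivity
  have hmem : ∀ k : ℕ, k ≤ n + 1 → (k / (n + 1) : ℝ) ∈ Icc (0 : ℝ) 1 := by
    intro k hk
    have : (k : ℝ) ≤ n + 1 := by exact_mod_cast hk
    exact ⟨by positivity, by rw [div_le_one hn0]; exact this⟩
  have key : ∀ k : ℕ, k ≤ n + 1 → S.Reach E a (Y 0) (Y (k / (n + 1))) := by
    intro k
    induction k with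
    | zero => intro _; exact Reach.of_eqOn fun w _ => by simp
    | succ k ih =>
      intro hk
      have h1 := hmem k (by omega)
      have h2 := hmem (k + 1) hk
      refine (ih (by omega)).trans (Reach.of_near ha (hd _ h1) (hd _ h2) ?_ ?_)
      · intro w hw; rw [hq _ h1 w hw, hq _ h2 w hw]
      · intro w hw T
        have hwK := hEK hw
        have h3 := hHδ ((k / (n + 1), (k + 1 : ℕ) / (n + 1)), w) ⟨⟨h1, h2⟩, hwK⟩
          ((k / (n + 1), k / (n + 1)), w) ⟨⟨h1, h1⟩, hwK⟩ ?_
        · have h4 := (dist_le_pi_dist _ _ T).trans_lt h3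
          simp only [H, mix_self, hu _ h1 w hwK] at h4
          rwa [dist_eq_norm] at h4
        · simp only [Prod.dist_eq, dist_self, Real.dist_eq]
          rw [show ((k + 1 : ℕ) / (n + 1) - k / (n + 1) : ℝ) = 1 / (n + 1) by push_cast; ring,
            abs_of_pos (by positivity)]
          simpa using ⟨hδ, by simpa using hn⟩
  have h1 := key (n + 1) le_rfl
  have h2 : (((n + 1 : ℕ) : ℝ) / (n + 1)) = 1 := by push_cast; field_simp
  rwa [h2] at h1

end AffineData

/-- A sequence of holomorphic functions with geometrically decaying increments converges. -/
theorem exists_holomorphic_limit {W F : Type*} [NormedAddCommGroup W] [NormedSpace ℂ W]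
    [FiniteDimensional ℂ W] [NormedAddCommGroup F] [NormedSpace ℂ F] [CompleteSpace F]
    {X : Set W} (hX : IsOpen X) {f : ℕ → W → F} (hf : ∀ n, DifferentiableOn ℂ (f n) X) {C : ℝ}
    (hC : ∀ n, ∀ w ∈ X, ‖f (n + 1) w - f n w‖ ≤ C / 2 / 2 ^ n) :
    ∃ g : W → F, DifferentiableOn ℂ g X ∧
      (∀ w ∈ X, Tendsto (fun n => f n w) atTop (𝓝 (g w))) := by
  have hd : ∀ w ∈ X, ∀ n, dist (f n w) (f (n + 1) w) ≤ C / 2 / 2 ^ n := fun w hw n => by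
    rw [dist_comm, dist_eq_norm]; exact hC n w hw
  have h1 : ∀ w, ∃ l, w ∈ X → Tendsto (fun n => f n w) atTop (𝓝 l) := by
    intro w
    by_cases hw : w ∈ X
    · obtain ⟨l, hl⟩ := cauchySeq_tendsto_of_complete (cauchySeq_of_le_geometric_two (hd w hw))
      exact ⟨l, fun _ => hl⟩
    · exact ⟨0, fun h => absurd h hw⟩
  choose g hg using h1
  refine ⟨g, ?_, hg⟩
  refine differentiableOn_of_tendstoUniformlyOn hX (Eventually.of_forall hf) ?_
  rw [Metric.tendstoUniformlyOn_iff]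
  intro ε hε
  have h2 : Tendsto (fun n : ℕ => C / 2 ^ n) atTop (𝓝 0) := by
    have := (tendsto_pow_atTop_nhds_zero_of_lt_one (r := (1 / 2 : ℝ)) (by norm_num)
      (by norm_num)).const_mul C
    simpa [div_eq_mul_inv] using this
  filter_upwards [h2.eventually_lt_const hε] with n hn w hw
  rw [dist_comm]
  exact (dist_le_of_le_geometric_two_of_tendsto (hd w hw) (hg w hw) n).trans_lt hn

/-- Uniform approximation of a family of maps by its linear part. -/
theorem exists_near_linear {P X F : Type*} [NormedAddCommGroup P] [NormedSpace ℂ P]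
    [NormedAddCommGroup X] [NormedSpace ℂ X] [NormedAddCommGroup F] [NormedSpace ℂ F]
    {g : P × X → F} (hg : ContDiff ℂ 1 g) {C : Set X} (hC : IsCompact C) (L : P →L[ℂ] F)
    (hL : ∀ x ∈ C, HasFDerivAt (fun p => g (p, x)) L 0) {θ : ℝ} (hθ : 0 < θ) :
    ∃ δ > 0, ∀ x ∈ C, ∀ x', ‖x' - x‖ ≤ δ → ∀ p p', ‖p‖ ≤ δ → ‖p'‖ ≤ δ →
      ‖g (p, x') - g (p', x') - L (p - p')‖ ≤ θ * ‖p - p'‖ := by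
  let D : P × X → P →L[ℂ] F := fun z => (fderiv ℂ g z).comp (ContinuousLinearMap.inl ℂ P X)
  have hD : ∀ p x, HasFDerivAt (fun p => g (p, x)) (D (p, x)) p := by
    intro p x
    have h1 := (hg.differentiable (by simp) (p, x)).hasFDerivAt
    exact h1.comp p (hasFDerivAt_prodMk_left p x)
  have hDc : Continuous D := by
    have := hg.continuous_fderiv (by simp)
    exact this.clm_comp continuous_const
  have hopen : IsOpen {z : P × X | ‖D z - L‖ < θ} :=
    isOpen_lt (by fun_prop) continuous_const
  have hsub : ({0} : Set P) ×ˢ C ⊆ {z : P × X | ‖D z - L‖ < θ} := by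
    rintro ⟨p, x⟩ ⟨hp, hx⟩
    obtain rfl : p = 0 := hp
    have : D (0, x) = L := (hD 0 x).unique (hL x hx)
    simpa [this] using hθ
  obtain ⟨δ, hδ, hδs⟩ := (isCompact_singleton.prod hC).exists_cthickening_subset_open hopen hsub
  refine ⟨δ, hδ, fun x hx x' hx' p p' hp hp' => ?_⟩
  have hbound : ∀ s ∈ closedBall (0 : P) δ, ‖D (s, x') - L‖ ≤ θ := by
    intro s hs
    refine le_of_lt (hδs (mem_cthickening_of_dist_le (s, x') (0, x) δ _ ⟨rfl, hx⟩ ?_))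
    rw [Prod.dist_eq]
    exact max_le hs (by rw [dist_eq_norm]; exact hx')
  have h1 := (convex_closedBall (0 : P) δ).norm_image_sub_le_of_norm_hasFDerivWithin_le
    (f := fun p => g (p, x') - L p) (f' := fun p => D (p, x') - L) (C := θ)
    (fun s _ => ((hD s x').sub L.hasFDerivAt).hasFDerivWithinAt) hbound
    (mem_closedBall_zero_iff.2 hp') (mem_closedBall_zero_iff.2 hp)
  convert h1 using 2
  rw [map_sub]; abel

/-- Bounded holomorphic functions on `X ∩ X'` are differences of bounded holomorphic functions. -/
def Splits {W : Type} [NormedAddCommGroup W] [NormedSpace ℂ W] (F : Type) [NormedAddCommGroup F]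
    [NormedSpace ℂ F] (X X' : Set W) (K : ℝ) : Prop :=
  ∀ (f : W → F) (B : ℝ), DifferentiableOn ℂ f (X ∩ X') → (∀ w ∈ X ∩ X', ‖f w‖ ≤ B) →
    ∃ g g' : W → F, DifferentiableOn ℂ g X ∧ DifferentiableOn ℂ g' X' ∧
      (∀ w ∈ X, ‖g w‖ ≤ K * B) ∧ (∀ w ∈ X', ‖g' w‖ ≤ K * B) ∧
      ∀ w ∈ X ∩ X', f w = g w - g' w

/-- Solving `Φ (ξ) = Φ' (ξ')` on an intersection for two families of maps close to translations. -/
theorem Splits.solve {W F : Type} [NormedAddCommGroup W] [NormedSpace ℂ W] [FiniteDimensional ℂ W]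
    [NormedAddCommGroup F] [NormedSpace ℂ F] [CompleteSpace F] {X X' : Set W} {K : ℝ}
    (hK : 0 < K) (h : Splits F X X' K) (hX : IsOpen X) (hX' : IsOpen X')
    {Φ Φ' : W → F → F} {δ ε : ℝ} (hε : 0 ≤ ε) (hδ : 4 * K * ε ≤ δ)
    (hΦd : ∀ ξ : W → F, DifferentiableOn ℂ ξ (X ∩ X') →
      DifferentiableOn ℂ (fun w => Φ w (ξ w)) (X ∩ X'))
    (hΦd' : ∀ ξ : W → F, DifferentiableOn ℂ ξ (X ∩ X') →
      DifferentiableOn ℂ (fun w => Φ' w (ξ w)) (X ∩ X'))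
    (hΦ : ∀ w ∈ X ∩ X', ∀ p p', ‖p‖ ≤ δ → ‖p'‖ ≤ δ →
      ‖Φ w p - Φ w p' - (p - p')‖ ≤ 1 / (4 * K) * ‖p - p'‖)
    (hΦ' : ∀ w ∈ X ∩ X', ∀ p p', ‖p‖ ≤ δ → ‖p'‖ ≤ δ →
      ‖Φ' w p - Φ' w p' - (p - p')‖ ≤ 1 / (4 * K) * ‖p - p'‖)
    (hclose : ∀ w ∈ X ∩ X', ‖Φ w 0 - Φ' w 0‖ ≤ 2 * ε)
    (hcont : ∀ w ∈ X ∩ X', Continuous (Φ w)) (hcont' : ∀ w ∈ X ∩ X', Continuous (Φ' w)) :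
    ∃ ξ ξ' : W → F, DifferentiableOn ℂ ξ X ∧ DifferentiableOn ℂ ξ' X' ∧
      (∀ w ∈ X, ‖ξ w‖ ≤ δ) ∧ (∀ w ∈ X', ‖ξ' w‖ ≤ δ) ∧
      ∀ w ∈ X ∩ X', Φ w (ξ w) = Φ' w (ξ' w) := by
  let R : ℕ → ℝ := fun n => 4 * K * ε * (1 - (1 / 2) ^ n)
  have hR : ∀ n, R n ≤ δ := fun n => by
    refine le_trans ?_ hδ
    have h1 : (1 - (1 / 2 : ℝ) ^ n) ≤ 1 := by
      have : (0 : ℝ) ≤ (1 / 2) ^ n := by positivity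
      linarith
    exact mul_le_of_le_one_right (by positivity) h1
  have hRs : ∀ n, R n + K * (2 * ε * (1 / 2) ^ n) = R (n + 1) := fun n => by
    simp only [R]; ring
  let Inv : ℕ → (W → F) × (W → F) → Prop := fun n x =>
    DifferentiableOn ℂ x.1 X ∧ DifferentiableOn ℂ x.2 X' ∧ (∀ w ∈ X, ‖x.1 w‖ ≤ R n) ∧
    (∀ w ∈ X', ‖x.2 w‖ ≤ R n) ∧
    ∀ w ∈ X ∩ X', ‖Φ w (x.1 w) - Φ' w (x.2 w)‖ ≤ 2 * ε * (1 / 2) ^ n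
  have step : ∀ n x, Inv n x → ∃ x', Inv (n + 1) x' ∧
      (∀ w ∈ X, ‖x'.1 w - x.1 w‖ ≤ K * (2 * ε * (1 / 2) ^ n)) ∧
      (∀ w ∈ X', ‖x'.2 w - x.2 w‖ ≤ K * (2 * ε * (1 / 2) ^ n)) := by
    rintro n ⟨x, x'⟩ ⟨hx, hx', hb, hb', hP⟩
    obtain ⟨g, g', hg, hg', hgb, hgb', hgg⟩ := h (fun w => Φ w (x w) - Φ' w (x' w)) _
      ((hΦd x (hx.mono inter_subset_left)).sub (hΦd' x' (hx'.mono inter_subset_right))) hP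
    have hb1 : ∀ w ∈ X, ‖x w - g w‖ ≤ R (n + 1) := fun w hw => by
      rw [← hRs]; exact (norm_sub_le _ _).trans (add_le_add (hb w hw) (hgb w hw))
    have hb1' : ∀ w ∈ X', ‖x' w - g' w‖ ≤ R (n + 1) := fun w hw => by
      rw [← hRs]; exact (norm_sub_le _ _).trans (add_le_add (hb' w hw) (hgb' w hw))
    refine ⟨(fun w => x w - g w, fun w => x' w - g' w), ⟨hx.sub hg, hx'.sub hg', hb1, hb1', ?_⟩,
      fun w hw => by simpa using hgb w hw, fun w hw => by simpa using hgb' w hw⟩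
    intro w hw
    have e1 := hΦ w hw (x w - g w) (x w) ((hb1 w hw.1).trans (hR _)) ((hb w hw.1).trans (hR _))
    have e2 := hΦ' w hw (x' w - g' w) (x' w) ((hb1' w hw.2).trans (hR _))
      ((hb' w hw.2).trans (hR _))
    have e3 := hgg w hw
    simp only [sub_sub_cancel_left, norm_neg, sub_neg_eq_add] at e1 e2
    have e4 : Φ w (x w - g w) - Φ' w (x' w - g' w) =
        (Φ w (x w - g w) - Φ w (x w) + g w) - (Φ' w (x' w - g' w) - Φ' w (x' w) + g' w) := by
      have : Φ w (x w) = g w - g' w + Φ' w (x' w) := by rw [← e3]; abel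
      rw [this]; abel
    have e5 := hgb w hw.1
    have e6 := hgb' w hw.2
    change ‖Φ w (x w - g w) - Φ' w (x' w - g' w)‖ ≤ _
    rw [e4]
    refine (norm_sub_le _ _).trans ((add_le_add e1 e2).trans ?_)
    calc 1 / (4 * K) * ‖g w‖ + 1 / (4 * K) * ‖g' w‖
        ≤ 1 / (4 * K) * (K * (2 * ε * (1 / 2) ^ n)) + 1 / (4 * K) * (K * (2 * ε * (1 / 2) ^ n)) := by
          gcongr
      _ = 2 * ε * (1 / 2) ^ (n + 1) := by field_simp; ring
  choose! f hf using step
  let x : ℕ → (W → F) × (W → F) := fun n => Nat.rec (fun _ => 0, fun _ => 0) (fun n x => f n x) n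
  have hx : ∀ n, Inv n (x n) := by
    intro n
    induction n with
    | zero =>
      refine ⟨differentiableOn_const _, differentiableOn_const _, ?_, ?_, ?_⟩
      · intro w _; simp [x, R]
      · intro w _; simp [x, R]
      · intro w hw; simpa [x] using hclose w hw
    | succ n ih => exact (hf n _ ih).1
  obtain ⟨ξ, hξ, hlim⟩ := exists_holomorphic_limit hX (f := fun n => (x n).1) (C := 4 * K * ε)
    (fun n => (hx n).1) fun n w hw => by
      refine ((hf n _ (hx n)).2.1 w hw).trans (le_of_eq ?_)
      rw [one_div, inv_pow]; field_simp; ring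
  obtain ⟨ξ', hξ', hlim'⟩ := exists_holomorphic_limit hX' (f := fun n => (x n).2) (C := 4 * K * ε)
    (fun n => (hx n).2.1) fun n w hw => by
      refine ((hf n _ (hx n)).2.2 w hw).trans (le_of_eq ?_)
      rw [one_div, inv_pow]; field_simp; ring
  refine ⟨ξ, ξ', hξ, hξ', ?_, ?_, ?_⟩
  · exact fun w hw => le_of_tendsto (hlim w hw).norm
      (Eventually.of_forall fun n => ((hx n).2.2.1 w hw).trans (hR n))
  · exact fun w hw => le_of_tendsto (hlim' w hw).norm
      (Eventually.of_forall fun n => ((hx n).2.2.2.1 w hw).trans (hR n))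
  · intro w hw
    have h1 : Tendsto (fun n => Φ w ((x n).1 w) - Φ' w ((x n).2 w)) atTop
        (𝓝 (Φ w (ξ w) - Φ' w (ξ' w))) :=
      (((hcont w hw).tendsto _).comp (hlim w hw.1)).sub
        (((hcont' w hw).tendsto _).comp (hlim' w hw.2))
    have h2 : Tendsto (fun n => Φ w ((x n).1 w) - Φ' w ((x n).2 w)) atTop (𝓝 0) := by
      refine squeeze_zero_norm (fun n => (hx n).2.2.2.2 w hw) ?_
      have := (tendsto_pow_atTop_nhds_zero_of_lt_one (r := (1 / 2 : ℝ)) (by norm_num)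
        (by norm_num)).const_mul (2 * ε)
      simpa using this
    exact sub_eq_zero.1 (tendsto_nhds_unique h1 h2)

namespace AffineData

variable {J A : Type} [Fintype J] [DecidableEq J] [NormedAddCommGroup A] [NormedSpace ℂ A]
variable (S : AffineData J A)

/-- Successive flows along a list of coordinates. -/
noncomputable def flows (ξ y : J → ℂ) (a : A) : List J → J → ℂ
  | [] => y
  | j :: l => S.flow j (ξ j) (flows ξ y a l) a

theorem q_flows (ξ y : J → ℂ) (a : A) (l : List J) : S.q (S.flows ξ y a l) a = S.q y a := by
  induction l with
  | nil => rfl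
  | cons j l ih => rw [flows, q_flow, ih]

theorem flows_zero (y : J → ℂ) (a : A) (l : List J) : S.flows 0 y a l = y := by
  induction l with
  | nil => rfl
  | cons j l ih => simp [flows, ih, flow, shift]

@[fun_prop] theorem contDiff_flows {E : Type*} [NormedAddCommGroup E] [NormedSpace ℂ E]
    {ξ y : E → J → ℂ} {a : E → A} (hξ : ContDiff ℂ ∞ ξ) (hy : ContDiff ℂ ∞ y)
    (ha : ContDiff ℂ ∞ a) (l : List J) : ContDiff ℂ ∞ (fun x => S.flows (ξ x) (y x) (a x) l) := by
  induction l with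
  | nil => exact hy
  | cons j l ih =>
    have : ContDiff ℂ ∞ (fun x => ξ x j) := contDiff_pi.1 hξ j
    exact S.contDiff_flow j this ih ha

theorem flows_apply_of_notMem {i : J} (hi : i ≠ S.o) (ξ y : J → ℂ) (a : A) {l : List J}
    (hl : i ∉ l) : S.flows ξ y a l i = y i := by
  induction l with
  | nil => rfl
  | cons j l ih =>
    simp only [List.mem_cons, not_or] at hl
    rw [flows, flow_apply_of_ne S hi hl.1, ih hl.2]

theorem hasFDerivAt_flows (y : J → ℂ) (a : A) {l : List J} (hl : l.Nodup) (ho : S.o ∉ l) {i : J}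
    (hi : i ∈ l) : HasFDerivAt (fun ξ => S.flows ξ y a l i)
      (S.u y a • (ContinuousLinearMap.proj i : (J → ℂ) →L[ℂ] ℂ)) 0 := by
  induction l with
  | nil => simp at hi
  | cons j l ih =>
    rw [List.nodup_cons] at hl
    simp only [List.mem_cons, not_or] at ho hi
    by_cases hij : i = j
    · subst hij
      have hio : i ≠ S.o := fun h => ho.1 h.symm
      let G : (J → ℂ) → ℂ := fun ξ => S.u (S.flows ξ y a l) a *
        expQuot (S.du i (S.flows ξ y a l) a * ξ i)
      have h1 : (fun ξ => S.flows ξ y a (i :: l) i) = fun ξ => y i + ξ i * G ξ := by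
        funext ξ
        rw [flows, flow_apply_self S hio, flows_apply_of_notMem S hio ξ y a hl.1, shift]
      have hG : ContDiff ℂ ∞ G := by
        have : ContDiff ℂ ∞ (fun ξ : J → ℂ => ξ i) := contDiff_apply ℂ ℂ i
        fun_prop
      have hG0 : G 0 = S.u y a := by simp [G, flows_zero]
      rw [h1]
      have h2 := ((ContinuousLinearMap.proj (R := ℂ) (φ := fun _ : J => ℂ) i).hasFDerivAt
        (x := (0 : J → ℂ))).mul ((hG.differentiable (by simp) 0).hasFDerivAt)
      refine (h2.const_add (y i)).congr_fderiv ?_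
      ext v
      simp [hG0]
    · have hio : i ≠ S.o := fun h => by
        rcases hi with h' | h'
        · exact hij h'
        · exact ho.2 (h ▸ h')
      have h1 : (fun ξ => S.flows ξ y a (j :: l) i) = fun ξ => S.flows ξ y a l i := by
        funext ξ; rw [flows, flow_apply_of_ne S hio hij]
      rw [h1]
      exact ih hl.2 ho.2 (hi.resolve_left hij)

/-- All flows in succession. -/
noncomputable def fullFlow (ξ y : J → ℂ) (a : A) : J → ℂ :=
  S.flows ξ y a (Finset.univ.erase S.o).toList

/-- The flows in succession, with the coordinate `o` replaced by the parameter. -/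
noncomputable def chart (ξ y : J → ℂ) (a : A) (i : J) : ℂ :=
  if i = S.o then ξ i else S.fullFlow ξ y a i

@[fun_prop] theorem contDiff_fullFlow {E : Type*} [NormedAddCommGroup E] [NormedSpace ℂ E]
    {ξ y : E → J → ℂ} {a : E → A} (hξ : ContDiff ℂ ∞ ξ) (hy : ContDiff ℂ ∞ y)
    (ha : ContDiff ℂ ∞ a) : ContDiff ℂ ∞ (fun x => S.fullFlow (ξ x) (y x) (a x)) :=
  S.contDiff_flows hξ hy ha _

theorem contDiff_chart {E : Type*} [NormedAddCommGroup E] [NormedSpace ℂ E]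
    {ξ y : E → J → ℂ} {a : E → A} (hξ : ContDiff ℂ ∞ ξ) (hy : ContDiff ℂ ∞ y)
    (ha : ContDiff ℂ ∞ a) : ContDiff ℂ ∞ (fun x => S.chart (ξ x) (y x) (a x)) := by
  refine contDiff_pi.2 fun i => ?_
  unfold chart
  split_ifs
  · exact contDiff_pi.1 hξ i
  · exact contDiff_pi.1 (S.contDiff_fullFlow hξ hy ha) i

theorem hasFDerivAt_chart {y : J → ℂ} {a : A} (hu : S.u y a = 1) :
    HasFDerivAt (fun ξ => S.chart ξ y a) (ContinuousLinearMap.id ℂ (J → ℂ)) 0 := by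
  refine hasFDerivAt_pi'.2 fun i => ?_
  unfold chart
  split_ifs with hi
  · exact (ContinuousLinearMap.proj (R := ℂ) (φ := fun _ : J => ℂ) i).hasFDerivAt
  · have := S.hasFDerivAt_flows y a (Finset.nodup_toList (Finset.univ.erase S.o)) (by simp)
      (i := i) (by simp [hi])
    rw [hu, one_smul] at this
    exact this

theorem q_fullFlow (ξ y : J → ℂ) (a : A) : S.q (S.fullFlow ξ y a) a = S.q y a := S.q_flows _ _ _ _

theorem fullFlow_zero (y : J → ℂ) (a : A) : S.fullFlow 0 y a = y := S.flows_zero _ _ _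

variable {W : Type} [NormedAddCommGroup W] [NormedSpace ℂ W] [FiniteDimensional ℂ W]

/-- Two holomorphic maps close to a common reference on `X ∩ X'` can be moved along the level
sets of `q` to agree there. -/
theorem exists_glue {X X' : Set W} {K : ℝ} (hK : 0 < K) (hsplit : Splits (J → ℂ) X X' K)
    (hX : IsOpen X) (hX' : IsOpen X') {C : Set ((J → ℂ) × A)} (hC : IsCompact C)
    (hu : ∀ x ∈ C, S.u x.1 x.2 = 1) {δ₀ : ℝ} (hδ₀ : 0 < δ₀) :
    ∃ ε > 0, ∀ (a : W → A) (c v v' : W → J → ℂ), (∀ w ∈ X ∩ X', (c w, a w) ∈ C) →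
      DifferentiableOn ℂ a (X ∪ X') → DifferentiableOn ℂ v X → DifferentiableOn ℂ v' X' →
      (∀ w ∈ X ∩ X', S.q (v w) (a w) = S.q (v' w) (a w)) →
      (∀ w ∈ X ∩ X', ‖v w - c w‖ ≤ ε) → (∀ w ∈ X ∩ X', ‖v' w - c w‖ ≤ ε) →
      ∃ ξ ξ' : W → J → ℂ, DifferentiableOn ℂ ξ X ∧ DifferentiableOn ℂ ξ' X' ∧
        (∀ w ∈ X, ‖ξ w‖ ≤ δ₀) ∧ (∀ w ∈ X', ‖ξ' w‖ ≤ δ₀) ∧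
        ∀ w ∈ X ∩ X', S.fullFlow (ξ w) (v w) (a w) = S.fullFlow (ξ' w) (v' w) (a w) := by
  have hg : ContDiff ℂ ∞ (fun z : (J → ℂ) × ((J → ℂ) × A) => S.chart z.1 z.2.1 z.2.2) :=
    S.contDiff_chart (by fun_prop) (by fun_prop) (by fun_prop)
  obtain ⟨δ₁, hδ₁, hlin⟩ := exists_near_linear (hg.of_le (by simp)) hC
    (ContinuousLinearMap.id ℂ (J → ℂ)) (fun x hx => S.hasFDerivAt_chart (hu x hx))
    (θ := 1 / (4 * K)) (by positivity)
  have hne : ∃ δ₂ > 0, ∀ x ∈ C, ∀ y, ‖y - x.1‖ ≤ δ₂ → ∀ ξ : J → ℂ, ‖ξ‖ ≤ δ₂ →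
      S.u (S.fullFlow ξ y x.2) x.2 ≠ 0 := by
    have hcd : ContDiff ℂ ∞ (fun z : (J → ℂ) × ((J → ℂ) × A) =>
        S.u (S.fullFlow z.1 z.2.1 z.2.2) z.2.2) := by fun_prop
    have hopen : IsOpen {z : (J → ℂ) × ((J → ℂ) × A) | S.u (S.fullFlow z.1 z.2.1 z.2.2) z.2.2 ≠ 0} :=
      isOpen_ne_fun hcd.continuous continuous_const
    obtain ⟨δ, hδ, hsub⟩ := ((isCompact_singleton (x := (0 : J → ℂ))).prod
      hC).exists_cthickening_subset_open hopen (by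
        rintro ⟨p, x⟩ ⟨hp, hx⟩
        obtain rfl : p = 0 := hp
        simp [fullFlow_zero, hu x hx])
    refine ⟨δ, hδ, fun x hx y hy ξ hξ => ?_⟩
    refine hsub (mem_cthickening_of_dist_le (ξ, (y, x.2)) (0, x) δ _ ⟨rfl, hx⟩ ?_)
    rw [Prod.dist_eq, Prod.dist_eq]
    simp only [dist_zero_right, dist_self]
    exact max_le hξ (max_le (by rw [dist_eq_norm]; exact hy) hδ.le)
  obtain ⟨δ₂, hδ₂, hne⟩ := hne
  set δ := min δ₀ (min δ₁ δ₂) with hδ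
  have hδpos : 0 < δ := lt_min hδ₀ (lt_min hδ₁ hδ₂)
  have hδ0 : δ ≤ δ₀ := min_le_left _ _
  have hδ1 : δ ≤ δ₁ := (min_le_right _ _).trans (min_le_left _ _)
  have hδ2 : δ ≤ δ₂ := (min_le_right _ _).trans (min_le_right _ _)
  refine ⟨min δ (δ / (4 * K)), by positivity, fun a c v v' hc ha hv hv' hq hvc hvc' => ?_⟩
  set ε := min δ (δ / (4 * K))
  have hεδ : ε ≤ δ := min_le_left _ _
  have hdiff : ∀ (v ξ : W → J → ℂ), DifferentiableOn ℂ v (X ∩ X') → DifferentiableOn ℂ ξ (X ∩ X') →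
      DifferentiableOn ℂ (fun w => S.chart (ξ w) (v w) (a w)) (X ∩ X') := fun v ξ hv hξ =>
    (hg.differentiable (by simp)).comp_differentiableOn
      (hξ.prodMk (hv.prodMk (ha.mono (inter_subset_left.trans subset_union_left))))
  have hcont : ∀ (v : W → J → ℂ) (w : W), Continuous (fun ξ => S.chart ξ (v w) (a w)) :=
    fun v w => (S.contDiff_chart contDiff_id contDiff_const contDiff_const).continuous
  have hΦ : ∀ v : W → J → ℂ, (∀ w ∈ X ∩ X', ‖v w - c w‖ ≤ ε) → ∀ w ∈ X ∩ X', ∀ p p' : J → ℂ,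
      ‖p‖ ≤ δ → ‖p'‖ ≤ δ → ‖S.chart p (v w) (a w) - S.chart p' (v w) (a w) - (p - p')‖ ≤
        1 / (4 * K) * ‖p - p'‖ := by
    intro v hv w hw p p' hp hp'
    refine hlin (c w, a w) (hc w hw) (v w, a w) ?_ p p' (hp.trans hδ1) (hp'.trans hδ1)
    rw [Prod.mk_sub_mk, sub_self, Prod.norm_mk, norm_zero]
    exact max_le ((hv w hw).trans (hεδ.trans hδ1)) hδ₁.le
  obtain ⟨ξ, ξ', hξ, hξ', hb, hb', he⟩ := hsplit.solve hK hX hX'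
    (Φ := fun w ξ => S.chart ξ (v w) (a w)) (Φ' := fun w ξ => S.chart ξ (v' w) (a w)) (δ := δ)
    (ε := ε) (by positivity) (by
      have : ε ≤ δ / (4 * K) := min_le_right _ _
      rwa [le_div_iff₀ (by positivity), mul_comm] at this)
    (fun ξ hξ => hdiff v ξ (hv.mono inter_subset_left) hξ)
    (fun ξ hξ => hdiff v' ξ (hv'.mono inter_subset_right) hξ) (hΦ v hvc) (hΦ v' hvc')
    (fun w hw => by
      refine (pi_norm_le_iff_of_nonneg (by positivity)).2 fun i => ?_
      simp only [Pi.sub_apply, chart]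
      split_ifs with hi
      · simp; positivity
      · rw [fullFlow_zero, fullFlow_zero]
        have h1 := norm_le_pi_norm (v w - v' w) i
        have h2 := norm_sub_le (v w - c w) (v' w - c w)
        rw [sub_sub_sub_cancel_right] at h2
        have := hvc w hw
        have := hvc' w hw
        simp only [Pi.sub_apply] at h1
        linarith)
    (fun w _ => hcont v w) (fun w _ => hcont v' w)
  refine ⟨ξ, ξ', hξ, hξ', fun w hw => (hb w hw).trans hδ0, fun w hw => (hb' w hw).trans hδ0,
    fun w hw => ?_⟩
  refine S.eq_of_forall_ne (a := a w) (fun i hi => ?_) ?_ ?_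
  · have := congrFun (he w hw) i
    simpa [chart, hi] using this
  · rw [q_fullFlow, q_fullFlow, hq w hw]
  · exact hne _ (hc w hw) (v w) ((hvc w hw).trans (hεδ.trans hδ2)) _ ((hb w hw.1).trans hδ2)

end AffineData

section Kernel

/-- An integrable bound for the one-dimensional factors of the Cauchy kernel. -/
noncomputable def rootKernel (s : ℝ) : ℝ := |s| ^ (-(1 / 2) : ℝ)

theorem measurable_rootKernel : Measurable rootKernel := by
  unfold rootKernel; fun_prop

theorem rootKernel_nonneg (s : ℝ) : 0 ≤ rootKernel s := by unfold rootKernel; positivity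

theorem integrableOn_rootKernel : IntegrableOn rootKernel (Icc (-1) 1) := by
  have h1 : IntegrableOn rootKernel (Ioc 0 1) := by
    have h := intervalIntegral.intervalIntegrable_rpow' (r := -(1 / 2)) (by norm_num)
      (a := 0) (b := 1)
    rw [intervalIntegrable_iff_integrableOn_Ioc_of_le zero_le_one] at h
    refine h.congr_fun (fun x hx => ?_) measurableSet_Ioc
    simp only [rootKernel, abs_of_pos hx.1]
  have h2 : IntegrableOn rootKernel (Ico (-1) 0) := by
    have h3 := (integrable_indicator_iff measurableSet_Ioc).2 h1
    have h4 := h3.comp_neg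
    rw [← integrable_indicator_iff measurableSet_Ico]
    refine h4.congr (ae_of_all _ fun x => ?_)
    simp only [indicator, mem_Ioc, mem_Ico, rootKernel, abs_neg]
    congr 1
    apply propext; constructor <;> rintro ⟨_, _⟩ <;> constructor <;> linarith
  have h3 : Icc (-1 : ℝ) 1 = Ico (-1) 0 ∪ Icc 0 0 ∪ Ioc 0 1 := by
    ext x; simp only [mem_Icc, mem_union, mem_Ico, mem_Ioc]
    constructor
    · rintro ⟨_, _⟩
      rcases lt_trichotomy x 0 with h | h | h
      · left; left; exact ⟨by linarith, h⟩
      · left; right; constructor <;> linarith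
      · right; exact ⟨h, by linarith⟩
    · rintro ((⟨_, _⟩ | ⟨_, _⟩) | ⟨_, _⟩) <;> constructor <;> linarith
  rw [h3]
  refine (h2.union ?_).union h1
  simp

theorem exists_integral_rootKernel_le (p q : ℝ) : ∃ C, ∀ x : ℝ,
    IntegrableOn (fun b => rootKernel (b - x)) (Ioo p q) ∧
      ∫ b in Ioo p q, rootKernel (b - x) ≤ C := by
  let φ : ℝ → ℝ := (Icc (-1 : ℝ) 1).indicator rootKernel
  have hφ : Integrable φ := (integrable_indicator_iff measurableSet_Icc).2 integrableOn_rootKernel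
  have hφ0 : ∀ s, 0 ≤ φ s := fun s => indicator_nonneg (fun _ _ => rootKernel_nonneg _) s
  have hle : ∀ s, rootKernel s ≤ φ s + 1 := by
    intro s
    by_cases hs : s ∈ Icc (-1 : ℝ) 1
    · simp only [φ, indicator_of_mem hs]; linarith
    · simp only [φ, indicator_of_notMem hs, zero_add, rootKernel]
      refine Real.rpow_le_one_of_one_le_of_nonpos ?_ (by norm_num)
      by_contra h
      exact hs (abs_le.1 (not_le.1 h).le)
  have hi : ∀ x, IntegrableOn (fun b => φ (b - x) + 1) (Ioo p q) := fun x =>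
    (hφ.comp_sub_right x).integrableOn.add (integrableOn_const (by simp))
  have hi' : ∀ x, IntegrableOn (fun b => rootKernel (b - x)) (Ioo p q) := fun x =>
    (hi x).mono' (measurable_rootKernel.comp (by fun_prop)).aestronglyMeasurable
      (ae_of_all _ fun b => by
        rw [Real.norm_of_nonneg (rootKernel_nonneg _)]; exact hle _)
  refine ⟨(∫ s, φ s) + ∫ _ in Ioo p q, (1 : ℝ), fun x => ⟨hi' x, ?_⟩⟩
  calc ∫ b in Ioo p q, rootKernel (b - x) ≤ ∫ b in Ioo p q, (φ (b - x) + 1) :=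
        integral_mono (hi' x) (hi x) fun b => hle _
    _ = (∫ b in Ioo p q, φ (b - x)) + ∫ _ in Ioo p q, (1 : ℝ) :=
        integral_add (hφ.comp_sub_right x).integrableOn (integrableOn_const (by simp))
    _ ≤ (∫ b, φ (b - x)) + ∫ _ in Ioo p q, (1 : ℝ) := by
        gcongr
        · exact ae_of_all _ fun b => hφ0 _
        · exact hφ.comp_sub_right x
        · exact Measure.restrict_le_self
    _ = _ := by rw [integral_sub_right_eq_self φ x]

/-- The point of the complex plane with the given real and imaginary parts. -/
def cplxPt (x : ℝ × ℝ) : ℂ := ⟨x.1, x.2⟩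

theorem continuous_cplxPt : Continuous cplxPt :=
  Complex.equivRealProdCLM.symm.continuous

theorem norm_inv_cplxPt_sub_le (x : ℝ × ℝ) (z : ℂ) (h1 : x.1 ≠ z.re) (h2 : x.2 ≠ z.im) :
    ‖(cplxPt x - z)⁻¹‖ ≤ rootKernel (x.1 - z.re) * rootKernel (x.2 - z.im) := by
  have a1 : 0 < |x.1 - z.re| := abs_pos.2 (sub_ne_zero.2 h1)
  have a2 : 0 < |x.2 - z.im| := abs_pos.2 (sub_ne_zero.2 h2)
  rw [rootKernel, rootKernel, ← Real.mul_rpow a1.le a2.le, norm_inv, Real.rpow_neg (by positivity)]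
  refine inv_anti₀ (by positivity) ?_
  rw [← Real.sqrt_eq_rpow]
  refine Real.sqrt_le_iff.2 ⟨norm_nonneg _, ?_⟩
  have b1 : |x.1 - z.re| ≤ ‖cplxPt x - z‖ := by simpa [cplxPt] using Complex.abs_re_le_norm (cplxPt x - z)
  have b2 : |x.2 - z.im| ≤ ‖cplxPt x - z‖ := by simpa [cplxPt] using Complex.abs_im_le_norm (cplxPt x - z)
  rw [sq]; gcongr

/-- Lebesgue measure on a rectangle. -/
noncomputable def rectMeasure (p q y₁ y₂ : ℝ) : Measure (ℝ × ℝ) :=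
  (volume.restrict (Ioo p q)).prod (volume.restrict (Ioo y₁ y₂))

theorem rectMeasure_eq (p q y₁ y₂ : ℝ) :
    rectMeasure p q y₁ y₂ = (volume : Measure (ℝ × ℝ)).restrict (Ioo p q ×ˢ Ioo y₁ y₂) := by
  rw [rectMeasure, Measure.prod_restrict]; rfl

instance (p q y₁ y₂ : ℝ) : IsFiniteMeasure (rectMeasure p q y₁ y₂) := by
  have : IsFiniteMeasure (volume.restrict (Ioo p q)) := ⟨by simp⟩
  have : IsFiniteMeasure (volume.restrict (Ioo y₁ y₂)) := ⟨by simp⟩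
  unfold rectMeasure; infer_instance

theorem ae_rect_mem (p q y₁ y₂ : ℝ) :
    ∀ᵐ x ∂(rectMeasure p q y₁ y₂), x.1 ∈ Ioo p q ∧ x.2 ∈ Ioo y₁ y₂ := by
  rw [rectMeasure_eq]
  exact ae_restrict_mem (measurableSet_Ioo.prod measurableSet_Ioo)

theorem ae_rect_ne (p q y₁ y₂ : ℝ) (z : ℂ) :
    ∀ᵐ x ∂(rectMeasure p q y₁ y₂), x.1 ≠ z.re ∧ x.2 ≠ z.im := by
  have h1 : ∀ᵐ b ∂(volume.restrict (Ioo p q)), b ≠ z.re :=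
    ae_restrict_of_ae (Measure.ae_ne volume z.re)
  have h2 : ∀ᵐ b ∂(volume.restrict (Ioo y₁ y₂)), b ≠ z.im :=
    ae_restrict_of_ae (Measure.ae_ne volume z.im)
  exact (Measure.quasiMeasurePreserving_fst.ae h1).and (Measure.quasiMeasurePreserving_snd.ae h2)

/-- The Cauchy kernel is integrable on rectangles, uniformly in the pole. -/
theorem exists_integral_cauchy_le (p q y₁ y₂ : ℝ) : ∃ C, 0 ≤ C ∧ ∀ z : ℂ,
    Integrable (fun x => ‖(cplxPt x - z)⁻¹‖) (rectMeasure p q y₁ y₂) ∧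
      ∫ x, ‖(cplxPt x - z)⁻¹‖ ∂(rectMeasure p q y₁ y₂) ≤ C := by
  obtain ⟨C₁, h1⟩ := exists_integral_rootKernel_le p q
  obtain ⟨C₂, h2⟩ := exists_integral_rootKernel_le y₁ y₂
  have hn1 : 0 ≤ C₁ := (integral_nonneg fun _ => rootKernel_nonneg _).trans (h1 0).2
  have hn2 : 0 ≤ C₂ := (integral_nonneg fun _ => rootKernel_nonneg _).trans (h2 0).2
  refine ⟨C₁ * C₂, by positivity, fun z => ?_⟩
  have hprod : Integrable (fun x : ℝ × ℝ => rootKernel (x.1 - z.re) * rootKernel (x.2 - z.im))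
      (rectMeasure p q y₁ y₂) := (h1 z.re).1.mul_prod (h2 z.im).1
  have hle : ∀ᵐ x ∂(rectMeasure p q y₁ y₂),
      ‖(cplxPt x - z)⁻¹‖ ≤ rootKernel (x.1 - z.re) * rootKernel (x.2 - z.im) :=
    (ae_rect_ne p q y₁ y₂ z).mono fun x hx => norm_inv_cplxPt_sub_le x z hx.1 hx.2
  have hintble : Integrable (fun x => ‖(cplxPt x - z)⁻¹‖) (rectMeasure p q y₁ y₂) := by
    refine hprod.mono' ?_ (hle.mono fun x hx => by rwa [norm_norm])
    exact (continuous_cplxPt.measurable.sub_const z).inv.norm.aestronglyMeasurable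
  refine ⟨hintble, (integral_mono_ae hintble hprod hle).trans ?_⟩
  rw [rectMeasure, integral_prod_mul (fun b => rootKernel (b - z.re))
    (fun t => rootKernel (t - z.im))]
  exact mul_le_mul (h1 _).2 (h2 _).2 (integral_nonneg fun _ => rootKernel_nonneg _) hn1

end Kernel

section LogIntegral

theorem log_neg_of_im_pos {v : ℂ} (h : 0 < v.im) :
    Complex.log (-v) = Complex.log v - Real.pi * Complex.I := by
  rw [Complex.log, Complex.log, Complex.arg_neg_eq_arg_sub_pi_of_im_pos h, norm_neg]
  push_cast; ring

theorem log_neg_of_im_neg {v : ℂ} (h : v.im < 0) :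
    Complex.log (-v) = Complex.log v + Real.pi * Complex.I := by
  rw [Complex.log, Complex.log, Complex.arg_neg_eq_arg_add_pi_of_im_neg h, norm_neg]
  push_cast; ring

/-- Difference of logarithms at the end points of a vertical segment. -/
noncomputable def logDiff (y₁ y₂ b : ℝ) (z : ℂ) : ℂ :=
  -Complex.I * (Complex.log (cplxPt (b, y₂) - z) - Complex.log (cplxPt (b, y₁) - z))

theorem hasDerivAt_cplxPt (b t : ℝ) :
    HasDerivAt (fun t : ℝ => cplxPt (b, t)) Complex.I t := by
  have h : (fun t : ℝ => cplxPt (b, t)) = fun t : ℝ => (b : ℂ) + (t : ℂ) * Complex.I := by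
    funext t; apply Complex.ext <;> simp [cplxPt]
  rw [h]
  have := (Complex.ofRealCLM.hasDerivAt (x := t)).mul_const Complex.I
  simpa using this.const_add (b : ℂ)

theorem integral_segment {y₁ y₂ b : ℝ} {z : ℂ} (h1 : y₁ < z.im) (h2 : z.im < y₂) (hb : b ≠ z.re) :
    ∫ t in Ioo y₁ y₂, (cplxPt (b, t) - z)⁻¹ =
      logDiff y₁ y₂ b z - ((if b < z.re then 2 * Real.pi else 0 : ℝ) : ℂ) := by
  have hy : y₁ ≤ y₂ := (h1.trans h2).le
  rw [← integral_Ioc_eq_integral_Ioo, ← intervalIntegral.integral_of_le hy]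
  have hne : ∀ t, cplxPt (b, t) - z ≠ 0 := fun t h => hb (by
    have := congrArg Complex.re h
    simp [cplxPt] at this; linarith)
  have hc : Continuous fun t : ℝ => cplxPt (b, t) - z :=
    (continuous_cplxPt.comp (by fun_prop)).sub continuous_const
  have hintble : IntervalIntegrable (fun t => (cplxPt (b, t) - z)⁻¹) volume y₁ y₂ :=
    (hc.inv₀ hne).intervalIntegrable _ _
  rcases lt_or_gt_of_ne hb with hlt | hgt
  · have hd : ∀ t ∈ uIcc y₁ y₂, HasDerivAt (fun t : ℝ => -Complex.I *
        Complex.log (-(cplxPt (b, t) - z))) ((cplxPt (b, t) - z)⁻¹) t := by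
      intro t _
      have h3 : -(cplxPt (b, t) - z) ∈ Complex.slitPlane := by
        left; simp [cplxPt]; linarith
      have h4 := ((((hasDerivAt_cplxPt b t).sub_const z).neg).clog_real h3).const_mul (-Complex.I)
      refine HasDerivAt.congr_deriv (f' := -Complex.I * (-Complex.I / -(cplxPt (b, t) - z))) h4 ?_
      rw [div_eq_mul_inv, inv_neg]
      linear_combination (-(cplxPt (b, t) - z)⁻¹) * Complex.I_sq
    rw [intervalIntegral.integral_eq_sub_of_hasDerivAt hd hintble, if_pos hlt, logDiff,
      log_neg_of_im_pos (by simpa [cplxPt] using h2), log_neg_of_im_neg (by simpa [cplxPt] using h1)]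
    push_cast
    linear_combination 2 * Real.pi * Complex.I_sq
  · have hd : ∀ t ∈ uIcc y₁ y₂, HasDerivAt (fun t : ℝ => -Complex.I *
        Complex.log (cplxPt (b, t) - z)) ((cplxPt (b, t) - z)⁻¹) t := by
      intro t _
      have h3 : cplxPt (b, t) - z ∈ Complex.slitPlane := by
        left; simp [cplxPt]; linarith
      have h4 := (((hasDerivAt_cplxPt b t).sub_const z).clog_real h3).const_mul (-Complex.I)
      refine h4.congr_deriv ?_
      rw [div_eq_mul_inv]
      linear_combination (-(cplxPt (b, t) - z)⁻¹) * Complex.I_sq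
    rw [intervalIntegral.integral_eq_sub_of_hasDerivAt hd hintble, if_neg (by linarith), logDiff]
    push_cast; ring

/-- The area of the part of `(p, q)` to the left of `x`. -/
noncomputable def leftLength (p q x : ℝ) : ℝ := ∫ b in Ioo p q, if b < x then 2 * Real.pi else 0

theorem integrable_leftLength (p q x : ℝ) :
    IntegrableOn (fun b : ℝ => if b < x then 2 * Real.pi else 0) (Ioo p q) := by
  refine (integrableOn_const (C := 2 * Real.pi) (by simp)).mono' ?_ (ae_of_all _ fun b => ?_)
  · exact (Measurable.ite measurableSet_Iio measurable_const measurable_const).aestronglyMeasurable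
  · split_ifs
    · rw [Real.norm_of_nonneg Real.two_pi_pos.le]
    · simpa using Real.pi_pos.le

theorem leftLength_nonneg (p q x : ℝ) : 0 ≤ leftLength p q x :=
  integral_nonneg fun b => by
    dsimp only [Pi.zero_apply]; split_ifs; exacts [Real.two_pi_pos.le, le_rfl]

theorem leftLength_le {p q : ℝ} (hpq : p < q) (x : ℝ) :
    leftLength p q x ≤ 2 * Real.pi * (q - p) := by
  have h := integral_mono (integrable_leftLength p q x)
    (integrableOn_const (μ := volume) (s := Ioo p q) (C := 2 * Real.pi) (by simp)) fun b => by
      dsimp only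
      split_ifs; exacts [le_rfl, Real.two_pi_pos.le]
  refine h.trans (le_of_eq ?_)
  simp [max_eq_left (sub_nonneg.2 hpq.le)]; ring

theorem leftLength_of_le {p q x : ℝ} (h : x ≤ p) : leftLength p q x = 0 := by
  rw [leftLength, setIntegral_congr_fun (g := fun _ => 0) measurableSet_Ioo, integral_zero]
  intro b hb
  exact if_neg (by linarith [hb.1])

theorem leftLength_of_ge {p q x : ℝ} (hpq : p < q) (h : q ≤ x) :
    leftLength p q x = 2 * Real.pi * (q - p) := by
  rw [leftLength, setIntegral_congr_fun (g := fun _ => 2 * Real.pi) measurableSet_Ioo]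
  · simp [max_eq_left (sub_nonneg.2 hpq.le)]; ring
  · intro b hb
    exact if_pos (by linarith [hb.2])

theorem integral_cauchy_rect {p q y₁ y₂ : ℝ} {z : ℂ} (h1 : y₁ < z.im) (h2 : z.im < y₂) :
    Integrable (fun b => logDiff y₁ y₂ b z) (volume.restrict (Ioo p q)) ∧
    ∫ x, (cplxPt x - z)⁻¹ ∂(rectMeasure p q y₁ y₂) + (leftLength p q z.re : ℂ) =
      ∫ b in Ioo p q, logDiff y₁ y₂ b z := by
  obtain ⟨C, -, hC⟩ := exists_integral_cauchy_le p q y₁ y₂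
  have hintble : Integrable (fun x => (cplxPt x - z)⁻¹) (rectMeasure p q y₁ y₂) := by
    refine (integrable_norm_iff ?_).1 (hC z).1
    exact (continuous_cplxPt.measurable.sub_const z).inv.aestronglyMeasurable
  have h3 := hintble.integral_prod_left
  have h4 : Integrable (fun b => ((if b < z.re then 2 * Real.pi else 0 : ℝ) : ℂ))
      (volume.restrict (Ioo p q)) := (integrable_leftLength p q z.re).ofReal
  have h5 : (fun b => (∫ t in Ioo y₁ y₂, (cplxPt (b, t) - z)⁻¹) +
      ((if b < z.re then 2 * Real.pi else 0 : ℝ) : ℂ)) =ᵐ[volume.restrict (Ioo p q)]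
      fun b => logDiff y₁ y₂ b z := by
    filter_upwards [ae_restrict_of_ae (Measure.ae_ne volume z.re)] with b hb
    rw [integral_segment h1 h2 hb]; ring
  refine ⟨(h3.add h4).congr h5, ?_⟩
  rw [← integral_congr_ae h5, integral_add h3 h4, rectMeasure, integral_prod _ hintble, leftLength]
  congr 1
  exact (integral_ofReal (𝕜 := ℂ)).symm

theorem differentiableOn_integral_logDiff (p q y₁ y₂ : ℝ) :
    DifferentiableOn ℂ (fun z => ∫ b in Ioo p q, logDiff y₁ y₂ b z) {z | y₁ < z.im ∧ z.im < y₂} := by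
  have hopen : IsOpen {z : ℂ | y₁ < z.im ∧ z.im < y₂} :=
    (isOpen_lt continuous_const Complex.continuous_im).inter
      (isOpen_lt Complex.continuous_im continuous_const)
  intro z hz
  obtain ⟨r, hr, hrs⟩ := (nhds_basis_closedBall.mem_iff).1 (hopen.mem_nhds hz)
  have hslit : ∀ b : ℝ, ∀ z : ℂ, y₁ < z.im ∧ z.im < y₂ → cplxPt (b, y₂) - z ∈ Complex.slitPlane ∧
      cplxPt (b, y₁) - z ∈ Complex.slitPlane := fun b z hz =>
    ⟨Or.inr (by simp [cplxPt]; linarith [hz.2]), Or.inr (by simp [cplxPt]; linarith [hz.1])⟩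
  have hcont : ContinuousOn (fun x : ℝ × ℂ => logDiff y₁ y₂ x.1 x.2)
      (univ ×ˢ {z | y₁ < z.im ∧ z.im < y₂}) := by
    unfold logDiff
    have hc : ∀ y, Continuous fun x : ℝ × ℂ => cplxPt (x.1, y) - x.2 := fun y =>
      (continuous_cplxPt.comp (by fun_prop)).sub continuous_snd
    exact continuousOn_const.mul ((((hc y₂).continuousOn).clog fun x hx => (hslit x.1 x.2 hx.2).1).sub
      (((hc y₁).continuousOn).clog fun x hx => (hslit x.1 x.2 hx.2).2))
  obtain ⟨M, hM⟩ := (isCompact_Icc (a := p) (b := q)).prod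
    (isCompact_closedBall z r) |>.exists_bound_of_continuousOn
      (hcont.mono (prod_mono (subset_univ _) hrs))
  have key := differentiableOn_integral_of_dominated (U := ball z r) isOpen_ball
    (μ := volume.restrict (Ioo p q)) (f := fun b z => logDiff y₁ y₂ b z) (bound := fun _ => M)
    (integrableOn_const (by simp)) (fun z' hz' => by
      have h : ContinuousOn (fun b => logDiff y₁ y₂ b z') univ :=
        hcont.comp (f := fun b => (b, z')) (by fun_prop)
          fun b _ => ⟨mem_univ _, hrs (ball_subset_closedBall hz')⟩
      exact (continuousOn_univ.1 h).aestronglyMeasurable)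
    (ae_of_all _ fun b => by
      unfold logDiff
      exact (((differentiableOn_const _).sub differentiableOn_id).clog (fun z' hz' =>
        (hslit b z' (hrs (ball_subset_closedBall hz'))).1)).sub
        (((differentiableOn_const _).sub differentiableOn_id).clog (fun z' hz' =>
        (hslit b z' (hrs (ball_subset_closedBall hz'))).2)) |>.const_mul _)
    (by
      filter_upwards [ae_restrict_mem measurableSet_Ioo] with b hb z' hz'
      exact hM (b, z') ⟨Ioo_subset_Icc_self hb, ball_subset_closedBall hz'⟩)
  exact (key.differentiableAt (isOpen_ball.mem_nhds (mem_ball_self hr))).differentiableWithinAt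

end LogIntegral

section Split

variable {W F : Type} [NormedAddCommGroup W] [NormedSpace ℂ W] [FiniteDimensional ℂ W]
  [NormedAddCommGroup F] [NormedSpace ℂ F] [CompleteSpace F]

theorem dslope_line_eq_integral {ξ : W → F} {E : Set W} (hE : IsOpen E)
    (hξ : DifferentiableOn ℂ ξ E) {w e : W} {c : ℂ}
    (h : ∀ s ∈ Icc (0 : ℝ) 1, w + ((s : ℂ) * c) • e ∈ E) :
    dslope (fun c => ξ (w + c • e)) 0 c =
      ∫ s in (0 : ℝ)..1, fderiv ℂ ξ (w + ((s : ℂ) * c) • e) e := by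
  have hline : ∀ c : ℂ, HasDerivAt (fun c : ℂ => w + c • e) e c := fun c => by
    simpa using ((hasDerivAt_id c).smul_const e).const_add w
  by_cases hc : c = 0
  · subst hc
    have hw : w ∈ E := by simpa using h 0 (by simp)
    have h1 : HasDerivAt (fun c : ℂ => ξ (w + c • e)) (fderiv ℂ ξ w e) 0 := by
      have h2 : HasFDerivAt ξ (fderiv ℂ ξ w) (w + (0 : ℂ) • e) := by
        simpa using (hξ.differentiableAt (hE.mem_nhds hw)).hasFDerivAt
      exact h2.comp_hasDerivAt (0 : ℂ) (hline 0)
    simp [dslope_same, h1.deriv]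
  · have hd : ∀ s ∈ uIcc (0 : ℝ) 1, HasDerivAt (fun s : ℝ => ξ (w + ((s : ℂ) * c) • e))
        (c • fderiv ℂ ξ (w + ((s : ℂ) * c) • e) e) s := by
      intro s hs
      rw [uIcc_of_le zero_le_one] at hs
      have h1 : HasDerivAt (fun s : ℝ => w + ((s : ℂ) * c) • e) (c • e) s := by
        have h2 : HasDerivAt (fun s : ℝ => (s : ℂ) * c) c s := by
          simpa using (Complex.ofRealCLM.hasDerivAt (x := s)).mul_const c
        exact (h2.smul_const e).const_add w
      have h2 := ((hξ.differentiableAt (hE.mem_nhds (h s hs))).hasFDerivAt).restrictScalars ℝ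
      exact (h2.comp_hasDerivAt s h1).congr_deriv (by simp)
    have hcont : ContinuousOn (fun s : ℝ => fderiv ℂ ξ (w + ((s : ℂ) * c) • e) e) (uIcc 0 1) := by
      rw [uIcc_of_le zero_le_one]
      exact (differentiableOn_fderiv_apply hE hξ e).continuousOn.comp
        (f := fun s : ℝ => w + ((s : ℂ) * c) • e) (by fun_prop) h
    have h3 := intervalIntegral.integral_eq_sub_of_hasDerivAt hd
      ((hcont.const_smul c).intervalIntegrable)
    rw [intervalIntegral.integral_smul] at h3
    rw [dslope_of_ne _ hc, slope_def_module]
    simp only [Complex.ofReal_one, one_mul, Complex.ofReal_zero, zero_mul, zero_smul,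
      add_zero] at h3
    simp only [sub_zero, zero_smul, add_zero]
    rw [← h3, inv_smul_smul₀ hc]

theorem differentiableAt_dslope_line {ξ : W → F} {E : Set W} (hE : IsOpen E)
    (hξ : DifferentiableOn ℂ ξ E) {B : ℝ} (hB : ∀ w ∈ E, ‖ξ w‖ ≤ B) (l : W →L[ℂ] ℂ) (e : W)
    {ζ : ℂ} {w₀ : W} (hw₀ : w₀ ∈ E) (hζ : w₀ + (ζ - l w₀) • e ∈ E) :
    DifferentiableAt ℂ (fun w => dslope (fun c => ξ (w + c • e)) 0 (ζ - l w)) w₀ := by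
  by_cases h0 : ζ - l w₀ = 0
  · obtain ⟨ρ, hρ, hρE⟩ := Metric.isOpen_iff.1 hE w₀ hw₀
    let U : Set W := ball w₀ (ρ / 4) ∩ {w | ‖(ζ - l w) • e‖ < ρ / 4}
    have hU : IsOpen U := isOpen_ball.inter (isOpen_lt (by fun_prop) continuous_const)
    have hw₀U : w₀ ∈ U := ⟨mem_ball_self (by positivity), by simp [h0, hρ]⟩
    have hseg : ∀ w ∈ U, ∀ s ∈ Icc (0 : ℝ) 1, ball (w + ((s : ℂ) * (ζ - l w)) • e) (ρ / 2) ⊆ E := by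
      intro w hw s hs x hx
      apply hρE
      have h1 : ‖((s : ℂ) * (ζ - l w)) • e‖ ≤ ‖(ζ - l w) • e‖ := by
        rw [mul_smul, norm_smul (s : ℂ), Complex.norm_real, Real.norm_of_nonneg hs.1]
        exact mul_le_of_le_one_left (norm_nonneg _) hs.2
      have h2 := hw.2
      have h3 := hw.1
      rw [mem_ofPred_eq] at h2
      rw [mem_ball, dist_eq_norm] at hx h3 ⊢
      have h4 : x - w₀ = (x - (w + ((s : ℂ) * (ζ - l w)) • e)) + ((w - w₀) +
        ((s : ℂ) * (ζ - l w)) • e) := by abel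
      rw [h4]
      have h5 := norm_add_le (x - (w + ((s : ℂ) * (ζ - l w)) • e)) ((w - w₀) +
        ((s : ℂ) * (ζ - l w)) • e)
      have h6 := norm_add_le (w - w₀) (((s : ℂ) * (ζ - l w)) • e)
      linarith
    have hmem : ∀ w ∈ U, ∀ s ∈ Icc (0 : ℝ) 1, w + ((s : ℂ) * (ζ - l w)) • e ∈ E :=
      fun w hw s hs => hseg w hw s hs (mem_ball_self (by positivity))
    have key : DifferentiableOn ℂ (fun w => ∫ s in Ioc (0 : ℝ) 1,
        fderiv ℂ ξ (w + ((s : ℂ) * (ζ - l w)) • e) e) U := by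
      refine differentiableOn_integral_of_dominated hU (bound := fun _ => 2 * B / (ρ / 2) * ‖e‖)
        (integrableOn_const (by simp)) ?_ ?_ ?_
      · intro w hw
        refine ContinuousOn.aestronglyMeasurable ?_ measurableSet_Ioc
        exact (differentiableOn_fderiv_apply hE hξ e).continuousOn.comp
          (f := fun s : ℝ => w + ((s : ℂ) * (ζ - l w)) • e) (by fun_prop)
          fun s hs => hmem w hw s (Ioc_subset_Icc_self hs)
      · filter_upwards [ae_restrict_mem measurableSet_Ioc] with s hs
        exact (differentiableOn_fderiv_apply hE hξ e).comp
          (f := fun w : W => w + ((s : ℂ) * (ζ - l w)) • e) (by fun_prop)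
          fun w hw => hmem w hw s (Ioc_subset_Icc_self hs)
      · filter_upwards [ae_restrict_mem measurableSet_Ioc] with s hs w hw
        refine (ContinuousLinearMap.le_opNorm _ _).trans ?_
        gcongr
        have hs' := hseg w hw s (Ioc_subset_Icc_self hs)
        exact norm_fderiv_le_of_norm_le_on_ball (by positivity) (hξ.mono hs')
          fun x hx => hB x (hs' hx)
    refine (key.differentiableAt (hU.mem_nhds hw₀U)).congr_of_eventuallyEq ?_
    filter_upwards [hU.mem_nhds hw₀U] with w hw
    rw [dslope_line_eq_integral hE hξ (hmem w hw), intervalIntegral.integral_of_le zero_le_one]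
  · have hne : ∀ᶠ w in 𝓝 w₀, ζ - l w ≠ 0 :=
      (isOpen_ne_fun (by fun_prop) continuous_const).mem_nhds h0
    have h1 : DifferentiableAt ℂ (fun w => (ζ - l w)⁻¹ • (ξ (w + (ζ - l w) • e) - ξ w)) w₀ := by
      have h2 : DifferentiableAt ℂ (fun w => (ζ - l w)⁻¹) w₀ :=
        DifferentiableAt.inv (by fun_prop) h0
      refine h2.smul (DifferentiableAt.sub ?_ (hξ.differentiableAt (hE.mem_nhds hw₀)))
      exact (hξ.differentiableAt (hE.mem_nhds hζ)).comp w₀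
        (f := fun w => w + (ζ - l w) • e) (by fun_prop)
    refine h1.congr_of_eventuallyEq ?_
    filter_upwards [hne] with w hw
    rw [dslope_of_ne _ hw, slope_def_module]
    simp

theorem exists_dslope_line_bound {ξ : W → F} {E : Set W} (hE : IsOpen E)
    (hξ : DifferentiableOn ℂ ξ E) {B : ℝ} (hB : ∀ w ∈ E, ‖ξ w‖ ≤ B) {e : W} (he : e ≠ 0)
    {w₀ : W} (hw₀ : w₀ ∈ E) : ∃ r > 0, ∃ M, ball w₀ r ⊆ E ∧ ∀ w ∈ ball w₀ r, ∀ c : ℂ,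
      w + c • e ∈ E → ‖dslope (fun c => ξ (w + c • e)) 0 c‖ ≤ M := by
  obtain ⟨ρ, hρ, hρE⟩ := Metric.isOpen_iff.1 hE w₀ hw₀
  have he' : 0 < ‖e‖ := norm_pos_iff.2 he
  have hball : ball w₀ (ρ / 2) ⊆ E := (ball_subset_ball (by linarith)).trans hρE
  refine ⟨ρ / 2, by positivity, (2 * B) / (ρ / 2 / ‖e‖), hball, fun w hw c hc => ?_⟩
  have hB0 : 0 ≤ B := (norm_nonneg _).trans (hB w₀ hw₀)
  by_cases hlt : ‖c‖ < ρ / 2 / ‖e‖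
  · have hsub : ∀ c' ∈ ball (0 : ℂ) (ρ / 2 / ‖e‖), w + c' • e ∈ E := by
      intro c' hc'
      apply hρE
      rw [mem_ball_zero_iff, lt_div_iff₀ he'] at hc'
      rw [mem_ball, dist_eq_norm] at hw ⊢
      have := norm_add_le (w - w₀) (c' • e)
      rw [norm_smul] at this
      rw [add_sub_right_comm]
      linarith
    refine Complex.norm_dslope_le_div_of_mapsTo_ball (R₁ := ρ / 2 / ‖e‖) (R₂ := 2 * B) ?_ ?_ ?_
    · exact hξ.comp (f := fun c : ℂ => w + c • e) (by fun_prop) hsub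
    · intro c' hc'
      rw [mem_closedBall, dist_eq_norm]
      have h1 := hB _ (hsub c' hc')
      have h2 := hB _ (hball hw)
      have h3 := norm_sub_le (ξ (w + c' • e)) (ξ w)
      simp only [zero_smul, add_zero]
      linarith
    · simpa using hlt
  · have hpos : 0 < ρ / 2 / ‖e‖ := by positivity
    have hc0 : c ≠ 0 := fun h => hlt (by simpa [h] using hpos)
    rw [dslope_of_ne _ hc0, slope_def_module, norm_smul, norm_inv, sub_zero, div_eq_mul_inv,
      mul_comm]
    refine mul_le_mul ?_ (inv_anti₀ hpos (not_lt.1 hlt)) (by positivity) (by positivity)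
    have h1 := hB _ hc
    have h2 := hB _ (hball hw)
    have h3 := norm_sub_le (ξ (w + c • e)) (ξ w)
    simp only [zero_smul, add_zero]
    linarith

/-- Splitting of bounded holomorphic functions on a box with respect to a coordinate `l`. -/
theorem exists_splits (l : W →L[ℂ] ℂ) {e : W} (he : l e = 1) {Ω : Set W} (hΩ : IsOpen Ω)
    (hinv : ∀ w ∈ Ω, ∀ c : ℂ, w + c • e ∈ Ω) {α β : ℝ} (hαβ : α < β) (y₁ y₂ : ℝ) :
    ∃ K > 0, Splits F (Ω ∩ {w | (l w).re < β ∧ y₁ < (l w).im ∧ (l w).im < y₂})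
      (Ω ∩ {w | α < (l w).re ∧ y₁ < (l w).im ∧ (l w).im < y₂}) K := by
  obtain ⟨p, hαp, hpβ⟩ := exists_between hαβ
  obtain ⟨q, hpq, hqβ⟩ := exists_between hpβ
  obtain ⟨C, hC0, hC⟩ := exists_integral_cauchy_le p q y₁ y₂
  set μ := rectMeasure p q y₁ y₂ with hμ
  have he0 : e ≠ 0 := fun h => by simp [h] at he
  set c₀ : ℝ := 1 / (2 * Real.pi * (q - p)) with hc₀
  have hden : 0 < 2 * Real.pi * (q - p) := mul_pos Real.two_pi_pos (sub_pos.2 hpq)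
  have hc₀pos : 0 < c₀ := by positivity
  refine ⟨1 + c₀ * C, by positivity, ?_⟩
  set X := Ω ∩ {w | (l w).re < β ∧ y₁ < (l w).im ∧ (l w).im < y₂} with hX
  set X' := Ω ∩ {w | α < (l w).re ∧ y₁ < (l w).im ∧ (l w).im < y₂} with hX'
  intro ξ B hξ hB
  have hre : Continuous fun w => (l w).re := by fun_prop
  have him : Continuous fun w => (l w).im := by fun_prop
  have hXo : IsOpen X := hΩ.inter ((isOpen_lt hre continuous_const).inter
    ((isOpen_lt continuous_const him).inter (isOpen_lt him continuous_const)))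
  have hXo' : IsOpen X' := hΩ.inter ((isOpen_lt continuous_const hre).inter
    ((isOpen_lt continuous_const him).inter (isOpen_lt him continuous_const)))
  have hEo : IsOpen (X ∩ X') := hXo.inter hXo'
  have hmem : ∀ w ∈ Ω, ∀ x : ℝ × ℝ, x.1 ∈ Ioo p q ∧ x.2 ∈ Ioo y₁ y₂ →
      w + (cplxPt x - l w) • e ∈ X ∩ X' := by
    intro w hw x hx
    have h1 : l (w + (cplxPt x - l w) • e) = cplxPt x := by simp [he]
    refine ⟨⟨hinv w hw _, ?_⟩, ⟨hinv w hw _, ?_⟩⟩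
    · rw [mem_ofPred_eq, h1]; exact ⟨hx.1.2.trans hqβ, hx.2⟩
    · rw [mem_ofPred_eq, h1]; exact ⟨hαp.trans hx.1.1, hx.2⟩
  have hmeas : ∀ w ∈ Ω, AEStronglyMeasurable (fun x => ξ (w + (cplxPt x - l w) • e)) μ := by
    intro w hw
    rw [hμ, rectMeasure_eq]
    refine ContinuousOn.aestronglyMeasurable ?_ (measurableSet_Ioo.prod measurableSet_Ioo)
    exact hξ.continuousOn.comp (f := fun x => w + (cplxPt x - l w) • e)
      (by have := continuous_cplxPt; fun_prop) fun x hx => hmem w hw x hx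
  have hinvmeas : ∀ z : ℂ, AEStronglyMeasurable (fun x => (cplxPt x - z)⁻¹) μ := fun z =>
    (continuous_cplxPt.measurable.sub_const z).inv.aestronglyMeasurable
  have hle : ∀ w ∈ Ω, ∀ᵐ x ∂μ, ‖(cplxPt x - l w)⁻¹ • ξ (w + (cplxPt x - l w) • e)‖ ≤
      ‖(cplxPt x - l w)⁻¹‖ * B := by
    intro w hw
    filter_upwards [ae_rect_mem p q y₁ y₂] with x hx
    rw [norm_smul]
    gcongr
    exact hB _ (hmem w hw x hx)
  have hTint : ∀ w ∈ Ω, Integrable (fun x => (cplxPt x - l w)⁻¹ • ξ (w + (cplxPt x - l w) • e)) μ :=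
    fun w hw => ((hC (l w)).1.mul_const B).mono' ((hinvmeas _).smul (hmeas w hw)) (hle w hw)
  set T : W → F := fun w => ∫ x, (cplxPt x - l w)⁻¹ • ξ (w + (cplxPt x - l w) • e) ∂μ with hT
  have hTle : ∀ w ∈ Ω, 0 ≤ B → ‖T w‖ ≤ C * B := by
    intro w hw hB0
    refine (norm_integral_le_of_norm_le ((hC (l w)).1.mul_const B) (hle w hw)).trans ?_
    rw [integral_mul_const]
    exact mul_le_mul_of_nonneg_right (hC (l w)).2 hB0
  -- away from the rectangle
  have hTfar : ∀ w₀ ∈ Ω, (∃ ρ > 0, ∀ᶠ w in 𝓝 w₀, ∀ x : ℝ × ℝ, x.1 ∈ Ioo p q ∧ x.2 ∈ Ioo y₁ y₂ →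
      ρ ≤ ‖cplxPt x - l w‖) → DifferentiableAt ℂ T w₀ := by
    rintro w₀ hw₀ ⟨ρ, hρ, hev⟩
    obtain ⟨r, hr, hrs⟩ := Metric.eventually_nhds_iff_ball.1 (hev.and (hΩ.mem_nhds hw₀))
    have hne : ∀ w ∈ ball w₀ r, ∀ x : ℝ × ℝ, x.1 ∈ Ioo p q ∧ x.2 ∈ Ioo y₁ y₂ →
        cplxPt x - l w ≠ 0 := fun w hw x hx h => by
      have := (hrs w hw).1 x hx
      rw [h, norm_zero] at this; linarith
    refine (differentiableOn_integral_of_dominated (isOpen_ball (x := w₀) (ε := r))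
      (bound := fun _ => ρ⁻¹ * B) (integrable_const _) ?_ ?_ ?_).differentiableAt
      (isOpen_ball.mem_nhds (mem_ball_self hr))
    · exact fun w hw => (hinvmeas _).smul (hmeas w (hrs w hw).2)
    · filter_upwards [ae_rect_mem p q y₁ y₂] with x hx
      have h2 : DifferentiableOn ℂ (fun w => (cplxPt x - l w)⁻¹) (ball w₀ r) :=
        DifferentiableOn.inv (by fun_prop) fun w hw => hne w hw x hx
      exact h2.smul (hξ.comp (f := fun w => w + (cplxPt x - l w) • e) (by fun_prop)
        fun w hw => hmem w (hrs w hw).2 x hx)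
    · filter_upwards [ae_rect_mem p q y₁ y₂] with x hx w hw
      rw [norm_smul, norm_inv]
      have h1 := hB _ (hmem w (hrs w hw).2 x hx)
      have h2 := (norm_nonneg _).trans h1
      have h3 := (hrs w hw).1 x hx
      gcongr
  -- the cut-off
  set χ : W → ℝ := fun w => c₀ * leftLength p q (l w).re with hχ
  have hχ0 : ∀ w, 0 ≤ χ w := fun w => mul_nonneg hc₀pos.le (leftLength_nonneg _ _ _)
  have hχ1 : ∀ w, χ w ≤ 1 := fun w => by
    rw [hχ]
    dsimp only
    rw [hc₀, one_div, inv_mul_le_iff₀ hden, mul_one]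
    exact leftLength_le hpq _
  -- on the box
  have hmid : DifferentiableOn ℂ (fun w => (χ w : ℂ) • ξ w + (c₀ : ℂ) • T w) (X ∩ X') := by
    let D : W → F := fun w => ∫ x, dslope (fun c => ξ (w + c • e)) 0 (cplxPt x - l w) ∂μ
    let m : W → ℂ := fun w => ∫ b in Ioo p q, logDiff y₁ y₂ b (l w)
    have hm : DifferentiableOn ℂ m (X ∩ X') :=
      (differentiableOn_integral_logDiff p q y₁ y₂).comp (f := fun w => l w) (by fun_prop)
        fun w hw => hw.1.2.2
    have hds : ∀ w, (fun x => dslope (fun c => ξ (w + c • e)) 0 (cplxPt x - l w)) =ᵐ[μ]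
        fun x => (cplxPt x - l w)⁻¹ • ξ (w + (cplxPt x - l w) • e) - (cplxPt x - l w)⁻¹ • ξ w := by
      intro w
      filter_upwards [ae_rect_ne p q y₁ y₂ (l w)] with x hx
      have hx0 : cplxPt x - l w ≠ 0 := fun h => hx.1 (by
        have := congrArg Complex.re h
        simp [cplxPt] at this; linarith)
      rw [dslope_of_ne _ hx0, slope_def_module]
      simp [smul_sub]
    have hiint : ∀ w, Integrable (fun x => (cplxPt x - l w)⁻¹ • ξ w) μ := fun w =>
      ((integrable_norm_iff (hinvmeas _)).1 (hC (l w)).1).smul_const _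
    have hD : DifferentiableOn ℂ D (X ∩ X') := by
      intro w₀ hw₀
      obtain ⟨r, hr, M, hrE, hM⟩ := exists_dslope_line_bound hEo hξ hB he0 hw₀
      refine ((differentiableOn_integral_of_dominated (isOpen_ball (x := w₀) (ε := r))
        (bound := fun _ => M) (integrable_const _) ?_ ?_ ?_).differentiableAt
        (isOpen_ball.mem_nhds (mem_ball_self hr))).differentiableWithinAt
      · intro w hw
        refine AEStronglyMeasurable.congr ?_ (hds w).symm
        exact ((hinvmeas _).smul (hmeas w (hrE hw).1.1)).sub (hiint w).1
      · filter_upwards [ae_rect_mem p q y₁ y₂] with x hx w hw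
        exact (differentiableAt_dslope_line hEo hξ hB l e (hrE hw)
          (hmem w (hrE hw).1.1 x hx)).differentiableWithinAt
      · filter_upwards [ae_rect_mem p q y₁ y₂] with x hx w hw
        exact hM w hw _ (hmem w (hrE hw).1.1 x hx)
    refine ((hD.const_smul (c₀ : ℂ)).add ((hm.const_mul (c₀ : ℂ)).smul hξ)).congr fun w hw => ?_
    have h1 : D w = T w - (∫ x, (cplxPt x - l w)⁻¹ ∂μ) • ξ w := by
      change ∫ x, _ ∂μ = _
      rw [integral_congr_ae (hds w), integral_sub (hTint w hw.1.1) (hiint w), integral_smul_const]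
    have h2 : m w = ∫ x, (cplxPt x - l w)⁻¹ ∂μ + (leftLength p q (l w).re : ℂ) :=
      (integral_cauchy_rect hw.1.2.2.1 hw.1.2.2.2).2.symm
    simp only [Pi.add_apply, Pi.smul_apply, Pi.smul_apply']
    rw [h1, h2, hχ]
    push_cast
    module
  have hbound : ∀ w ∈ Ω, ∀ t : ℝ, |t| ≤ 1 → (t ≠ 0 → w ∈ X ∩ X') → 0 ≤ B →
      ‖(t : ℂ) • ξ w + (c₀ : ℂ) • T w‖ ≤ (1 + c₀ * C) * B := by
    intro w hw t ht htE hB0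
    refine (norm_add_le _ _).trans ?_
    have h1 : ‖(t : ℂ) • ξ w‖ ≤ B := by
      by_cases h0 : t = 0
      · simpa [h0] using hB0
      · rw [norm_smul, Complex.norm_real, Real.norm_eq_abs]
        exact (mul_le_of_le_one_left (norm_nonneg _) ht).trans (hB w (htE h0))
    have h2 : ‖(c₀ : ℂ) • T w‖ ≤ c₀ * (C * B) := by
      rw [norm_smul, Complex.norm_real, Real.norm_of_nonneg hc₀pos.le]
      exact mul_le_mul_of_nonneg_left (hTle w hw hB0) hc₀pos.le
    linarith
  have hB0 : ∀ w ∈ Ω, y₁ < (l w).im ∧ (l w).im < y₂ → 0 ≤ B := fun w hw hi =>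
    (norm_nonneg _).trans (hB _ (hmem w hw ((p + q) / 2, (l w).im)
      ⟨⟨by simp; linarith, by simp; linarith⟩, hi⟩))
  have hχL : ∀ w, (l w).re ≤ p → χ w = 0 := fun w h => by
    simp [hχ, leftLength_of_le h]
  have hχR : ∀ w, q ≤ (l w).re → χ w = 1 := fun w h => by
    rw [hχ]; dsimp only
    rw [leftLength_of_ge hpq h, hc₀, one_div, inv_mul_cancel₀ hden.ne']
  have habs : ∀ (ζ : ℂ) (w : W), |ζ.re - (l w).re| ≤ ‖ζ - l w‖ := fun ζ w => by
    simpa using Complex.abs_re_le_norm (ζ - l w)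
  refine ⟨fun w => (χ w : ℂ) • ξ w + (c₀ : ℂ) • T w,
    fun w => ((χ w - 1 : ℝ) : ℂ) • ξ w + (c₀ : ℂ) • T w, ?_, ?_, ?_, ?_, ?_⟩
  · intro w₀ hw₀
    by_cases h : (l w₀).re < p
    · have hev : ∀ᶠ w in 𝓝 w₀, (l w).re < ((l w₀).re + p) / 2 :=
        (isOpen_lt hre continuous_const).mem_nhds (by rw [mem_ofPred_eq]; linarith)
      have h1 := hTfar w₀ hw₀.1 ⟨(p - (l w₀).re) / 2, by linarith, hev.mono fun w hw x hx => by
        refine le_trans ?_ (habs _ w)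
        refine le_trans ?_ (le_abs_self _)
        have := hx.1.1
        simp only [cplxPt]; linarith⟩
      refine DifferentiableAt.differentiableWithinAt ?_
      refine (h1.const_smul (c₀ : ℂ)).congr_of_eventuallyEq ?_
      filter_upwards [hev] with w hw
      rw [hχL w (by linarith)]; simp
    · have hE : w₀ ∈ X ∩ X' := ⟨hw₀, hw₀.1, by linarith, hw₀.2.2⟩
      exact (hmid.differentiableAt (hEo.mem_nhds hE)).differentiableWithinAt
  · intro w₀ hw₀
    by_cases h : q < (l w₀).re
    · have hev : ∀ᶠ w in 𝓝 w₀, ((l w₀).re + q) / 2 < (l w).re :=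
        (isOpen_lt continuous_const hre).mem_nhds (by rw [mem_ofPred_eq]; linarith)
      have h1 := hTfar w₀ hw₀.1 ⟨((l w₀).re - q) / 2, by linarith, hev.mono fun w hw x hx => by
        refine le_trans ?_ (habs _ w)
        refine le_trans ?_ (neg_le_abs _)
        have := hx.1.2
        simp only [cplxPt]; linarith⟩
      refine DifferentiableAt.differentiableWithinAt ?_
      refine (h1.const_smul (c₀ : ℂ)).congr_of_eventuallyEq ?_
      filter_upwards [hev] with w hw
      rw [hχR w (by linarith)]; simp
    · have hE : w₀ ∈ X ∩ X' := ⟨⟨hw₀.1, by linarith, hw₀.2.2⟩, hw₀⟩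
      have h1 := hmid.sub hξ
      refine ((h1.congr fun w _ => ?_).differentiableAt (hEo.mem_nhds hE)).differentiableWithinAt
      simp only [Pi.sub_apply]
      push_cast
      module
  · intro w hw
    refine hbound w hw.1 _ (abs_le.2 ⟨by linarith [hχ0 w], hχ1 w⟩) (fun h => ?_)
      (hB0 w hw.1 hw.2.2)
    refine ⟨hw, hw.1, ?_, hw.2.2⟩
    by_contra h'
    exact h (hχL w (by linarith))
  · intro w hw
    refine hbound w hw.1 _ (abs_le.2 ⟨by linarith [hχ0 w], by linarith [hχ1 w]⟩) (fun h => ?_)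
      (hB0 w hw.1 hw.2.2)
    refine ⟨⟨hw.1, ?_, hw.2.2⟩, hw⟩
    by_contra h'
    exact h (by rw [hχR w (by linarith), sub_self])
  · intro w _
    push_cast
    module

end Split

theorem Splits.mono {W F : Type} [NormedAddCommGroup W] [NormedSpace ℂ W] [NormedAddCommGroup F]
    [NormedSpace ℂ F] {X X' Y Y' : Set W} {K : ℝ} (h : Splits F X X' K) (hY : Y ⊆ X)
    (hY' : Y' ⊆ X') (hXY : X ∩ X' = Y ∩ Y') : Splits F Y Y' K := by
  intro f B hf hB
  obtain ⟨g, g', hg, hg', hb, hb', he⟩ := h f B (hXY ▸ hf) (hXY ▸ hB)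
  exact ⟨g, g', hg.mono hY, hg'.mono hY', fun w hw => hb w (hY hw), fun w hw => hb' w (hY' hw),
    fun w hw => he w (hXY ▸ hw)⟩

/-- Uniform continuity near a compact set. -/
theorem IsCompact.exists_norm_sub_le {X Y : Type*} [NormedAddCommGroup X] [NormedAddCommGroup Y]
    {C : Set X} (hC : IsCompact C) {f : X → Y} (hf : Continuous f) {η : ℝ} (hη : 0 < η) :
    ∃ δ > 0, ∀ x ∈ C, ∀ x', ‖x' - x‖ ≤ δ → ‖f x' - f x‖ ≤ η := by
  have h := hC.uniformContinuousAt_of_continuousAt f (fun a _ => hf.continuousAt)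
    (Metric.dist_mem_uniformity hη)
  obtain ⟨δ, hδ, hsub⟩ := Metric.mem_uniformity_dist.1 h
  refine ⟨δ / 2, by positivity, fun x hx x' hx' => ?_⟩
  have := hsub (a := x) (b := x') (by rw [dist_comm, dist_eq_norm]; linarith) hx
  rw [← dist_eq_norm, dist_comm]
  exact le_of_lt this

section Slab

variable {W F : Type} [NormedAddCommGroup W] [NormedSpace ℂ W] [FiniteDimensional ℂ W]
  [NormedAddCommGroup F] [NormedSpace ℂ F] [CompleteSpace F]

/-- The part of `Ω` where `l` takes values in a rectangle. -/
def slab (Ω : Set W) (l : W →L[ℂ] ℂ) (y₁ y₂ s t : ℝ) : Set W :=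
  Ω ∩ {w | (s < (l w).re ∧ (l w).re < t) ∧ y₁ < (l w).im ∧ (l w).im < y₂}

variable {Ω : Set W} {l : W →L[ℂ] ℂ} {y₁ y₂ s t : ℝ}

theorem isOpen_slab (hΩ : IsOpen Ω) : IsOpen (slab Ω l y₁ y₂ s t) := by
  have hre : Continuous fun w => (l w).re := by fun_prop
  have him : Continuous fun w => (l w).im := by fun_prop
  exact hΩ.inter (((isOpen_lt continuous_const hre).inter (isOpen_lt hre continuous_const)).inter
    ((isOpen_lt continuous_const him).inter (isOpen_lt him continuous_const)))

theorem slab_subset {s' t' : ℝ} (hs : s' ≤ s) (ht : t ≤ t') :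
    slab Ω l y₁ y₂ s t ⊆ slab Ω l y₁ y₂ s' t' :=
  fun _ hw => ⟨hw.1, ⟨hs.trans_lt hw.2.1.1, hw.2.1.2.trans_le ht⟩, hw.2.2⟩

theorem slab_inter {s' t' : ℝ} (hs : s ≤ s') (ht : t ≤ t') :
    slab Ω l y₁ y₂ s t ∩ slab Ω l y₁ y₂ s' t' = slab Ω l y₁ y₂ s' t := by
  ext w
  exact ⟨fun h => ⟨h.1.1, ⟨h.2.2.1.1, h.1.2.1.2⟩, h.1.2.2⟩, fun h =>
    ⟨⟨h.1, ⟨hs.trans_lt h.2.1.1, h.2.1.2⟩, h.2.2⟩, ⟨h.1, ⟨h.2.1.1, h.2.1.2.trans_le ht⟩, h.2.2⟩⟩⟩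

theorem slab_union {s' t' : ℝ} (hs : s ≤ s') (ht : t ≤ t') (hst : s' < t) :
    slab Ω l y₁ y₂ s t ∪ slab Ω l y₁ y₂ s' t' = slab Ω l y₁ y₂ s t' := by
  ext w
  constructor
  · rintro (h | h)
    · exact ⟨h.1, ⟨h.2.1.1, h.2.1.2.trans_le ht⟩, h.2.2⟩
    · exact ⟨h.1, ⟨hs.trans_lt h.2.1.1, h.2.1.2⟩, h.2.2⟩
  · intro h
    rcases lt_or_ge (l w).re t with h' | h'
    · exact Or.inl ⟨h.1, ⟨h.2.1.1, h'⟩, h.2.2⟩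
    · exact Or.inr ⟨h.1, ⟨hst.trans_le h', h.2.1.2⟩, h.2.2⟩

theorem exists_splits_slab (he : ∃ e : W, l e = 1 ∧ ∀ w ∈ Ω, ∀ c : ℂ, w + c • e ∈ Ω)
    (hΩ : IsOpen Ω) {s' t' : ℝ} (hs : s ≤ s') (ht : t ≤ t') (hst : s' < t) :
    ∃ K > 0, Splits F (slab Ω l y₁ y₂ s t) (slab Ω l y₁ y₂ s' t') K := by
  obtain ⟨e, he, hinv⟩ := he
  obtain ⟨K, hK, h⟩ := exists_splits (F := F) l he hΩ hinv hst y₁ y₂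
  refine ⟨K, hK, h.mono (fun w hw => ⟨hw.1, hw.2.1.2, hw.2.2⟩) (fun w hw => ⟨hw.1, hw.2.1.1, hw.2.2⟩) ?_⟩
  rw [slab_inter hs ht]
  ext w
  exact ⟨fun h => ⟨h.1.1, ⟨h.2.2.1, h.1.2.1⟩, h.1.2.2⟩,
    fun h => ⟨⟨h.1, h.2.1.2, h.2.2⟩, ⟨h.1, h.2.1.1, h.2.2⟩⟩⟩

theorem re_cos_eq (z : ℂ) : (Complex.cos z).re = Real.cos z.re * Real.cosh z.im := by
  rw [Complex.cos_eq z]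
  simp [← Complex.ofReal_cos, ← Complex.ofReal_sin, ← Complex.ofReal_cosh, ← Complex.ofReal_sinh]

/-- A holomorphic function on the left part of a slab is approximated, at the left edge, by a
holomorphic function on the slab which is small at the right edge. -/
theorem exists_approx_slab (he : ∃ e : W, l e = 1 ∧ ∀ w ∈ Ω, ∀ c : ℂ, w + c • e ∈ Ω)
    (hΩ : IsOpen Ω) {c τ : ℝ} (hτ : 0 < τ) {ζ : W → F} {B : ℝ}
    (hζ : DifferentiableOn ℂ ζ (slab Ω l y₁ y₂ (c - 4 * τ) (c + τ)))
    (hB : ∀ w ∈ slab Ω l y₁ y₂ (c - 4 * τ) (c + τ), ‖ζ w‖ ≤ B) {η : ℝ} (hη : 0 < η) :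
    ∃ f : W → F, DifferentiableOn ℂ f (slab Ω l y₁ y₂ (c - 4 * τ) (c + 4 * τ)) ∧
      (∀ w ∈ slab Ω l y₁ y₂ (c - 4 * τ) (c - 2 * τ), ‖f w - ζ w‖ ≤ η) ∧
      ∀ w ∈ slab Ω l y₁ y₂ (c + 2 * τ) (c + 4 * τ), ‖f w‖ ≤ η := by
  obtain ⟨K, hK, hsplit⟩ := exists_splits_slab (F := F) (y₁ := y₁) (y₂ := y₂) he hΩ
    (s := c - 4 * τ) (t := c + τ) (s' := c - τ) (t' := c + 4 * τ) (by linarith) (by linarith)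
    (by linarith)
  set k : ℝ := Real.pi / 3 / τ with hk
  let Q : W → ℂ := fun w => Complex.cos (k * (l w - c))
  have hQ : Differentiable ℂ Q := by
    have h1 : Differentiable ℂ fun w => (k : ℂ) * (l w - c) := by fun_prop
    exact Complex.differentiable_cos.comp h1
  have hQre : ∀ w, (Q w).re = Real.cos (k * ((l w).re - c)) * Real.cosh (k * (l w).im) := by
    intro w
    simp only [Q, re_cos_eq]
    simp
  have hkpos : 0 < k := by positivity
  have hkτ : k * τ = Real.pi / 3 := by rw [hk]; field_simp
  have hQmid : ∀ w, |(l w).re - c| ≤ τ → 0 ≤ (Q w).re := by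
    intro w hw
    rw [hQre]
    refine mul_nonneg (Real.cos_nonneg_of_neg_pi_div_two_le_of_le ?_ ?_) (Real.cosh_pos _).le
    · have := (abs_le.1 hw).1
      nlinarith [Real.pi_pos, mul_le_mul_of_nonneg_left this hkpos.le]
    · have := (abs_le.1 hw).2
      nlinarith [Real.pi_pos, mul_le_mul_of_nonneg_left this hkpos.le]
  have hQout : ∀ w, 2 * τ ≤ |(l w).re - c| → |(l w).re - c| ≤ 4 * τ → (Q w).re ≤ -(1 / 2) := by
    intro w h1 h2
    rw [hQre, ← Real.cos_abs, abs_mul, abs_of_pos hkpos]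
    have h3 : Real.cos (k * |(l w).re - c|) ≤ -(1 / 2) := by
      have h4 : Real.cos (k * |(l w).re - c|) = -Real.cos (k * |(l w).re - c| - Real.pi) := by
        rw [Real.cos_sub_pi, neg_neg]
      rw [h4, ← Real.cos_pi_div_three, neg_le_neg_iff, ← Real.cos_abs (_ - _)]
      refine Real.cos_le_cos_of_nonneg_of_le_pi (abs_nonneg _) (by linarith [Real.pi_pos]) ?_
      have h5 := mul_le_mul_of_nonneg_left h1 hkpos.le
      have h6 := mul_le_mul_of_nonneg_left h2 hkpos.le
      rw [abs_le]
      constructor <;> linarith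
    nlinarith [Real.one_le_cosh (k * (l w).im)]
  -- choice of the exponent
  obtain ⟨T, hT0, hT⟩ : ∃ T : ℝ, 0 ≤ T ∧ Real.exp (-(T / 2)) * (K * |B|) ≤ η := by
    have h1 : Tendsto (fun T : ℝ => Real.exp (-(T / 2)) * (K * |B|)) atTop (𝓝 (0 * (K * |B|))) := by
      refine Tendsto.mul_const _ (Real.tendsto_exp_neg_atTop_nhds_zero.comp ?_)
      exact tendsto_id.atTop_div_const (by norm_num)
    rw [zero_mul] at h1
    obtain ⟨T, hT⟩ := ((h1.eventually_le_const hη).and (eventually_ge_atTop 0)).exists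
    exact ⟨T, hT.2, hT.1⟩
  have hmidset : slab Ω l y₁ y₂ (c - 4 * τ) (c + τ) ∩ slab Ω l y₁ y₂ (c - τ) (c + 4 * τ) ⊆
      slab Ω l y₁ y₂ (c - 4 * τ) (c + τ) := inter_subset_left
  obtain ⟨g, g', hg, hg', hgb, hgb', hgg⟩ := hsplit (fun w => Complex.exp (-(T * Q w)) • ζ w) |B|
    (by
      have h1 : Differentiable ℂ fun w => Complex.exp (-(T * Q w)) := by fun_prop
      exact h1.differentiableOn.smul (hζ.mono hmidset))
    (fun w hw => by
      rw [norm_smul, Complex.norm_exp]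
      have h1 := hQmid w (abs_le.2 ⟨by linarith [hw.2.2.1.1], by linarith [hw.1.2.1.2]⟩)
      have h2 : (-(T * Q w) : ℂ).re ≤ 0 := by
        simp only [Complex.neg_re, Complex.re_ofReal_mul]; nlinarith
      refine (mul_le_of_le_one_left (norm_nonneg _) (Real.exp_le_one_iff.2 h2)).trans ?_
      exact (hB w hw.1).trans (le_abs_self B))
  have hexp : Differentiable ℂ fun w => Complex.exp (T * Q w) := by fun_prop
  have hsmall : ∀ w, (Q w).re ≤ -(1 / 2) → ∀ v : F, ‖v‖ ≤ K * |B| →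
      ‖Complex.exp (T * Q w) • v‖ ≤ η := by
    intro w hw v hv
    rw [norm_smul, Complex.norm_exp]
    refine le_trans ?_ hT
    gcongr
    simp only [Complex.re_ofReal_mul]; nlinarith
  classical
  let f : W → F := fun w => if (l w).re < c + τ then ζ w - Complex.exp (T * Q w) • g w
    else -(Complex.exp (T * Q w) • g' w)
  have hf1 : ∀ w ∈ slab Ω l y₁ y₂ (c - 4 * τ) (c + τ),
      f w = ζ w - Complex.exp (T * Q w) • g w := fun w hw => if_pos hw.2.1.2
  have hf2 : ∀ w ∈ slab Ω l y₁ y₂ (c - τ) (c + 4 * τ), f w = -(Complex.exp (T * Q w) • g' w) := by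
    intro w hw
    by_cases h : (l w).re < c + τ
    · have hw' : w ∈ slab Ω l y₁ y₂ (c - 4 * τ) (c + τ) :=
        ⟨hw.1, ⟨by linarith [hw.2.1.1], h⟩, hw.2.2⟩
      have h1 : g w = Complex.exp (-(T * Q w)) • ζ w + g' w := by
        rw [hgg w ⟨hw', hw⟩]; abel
      rw [hf1 w hw', h1, smul_add, smul_smul, ← Complex.exp_add]
      simp
    · exact if_neg h
  refine ⟨f, ?_, ?_, ?_⟩
  · rw [← slab_union (s := c - 4 * τ) (t := c + τ) (s' := c - τ) (by linarith) (by linarith)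
      (by linarith)]
    refine DifferentiableOn.union_of_isOpen ?_ ?_ (isOpen_slab hΩ) (isOpen_slab hΩ)
    · exact (hζ.sub (hexp.differentiableOn.smul hg)).congr hf1
    · exact (hexp.differentiableOn.smul hg').neg.congr hf2
  · intro w hw
    have hw' : w ∈ slab Ω l y₁ y₂ (c - 4 * τ) (c + τ) := slab_subset le_rfl (by linarith) hw
    rw [hf1 w hw', sub_sub_cancel_left, norm_neg]
    refine hsmall w (hQout w ?_ ?_) _ (hgb w hw')
    · rw [abs_of_neg] <;> linarith [hw.2.1.2]
    · rw [abs_of_neg] <;> linarith [hw.2.1.2, hw.2.1.1]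
  · intro w hw
    have hw' : w ∈ slab Ω l y₁ y₂ (c - τ) (c + 4 * τ) := slab_subset (by linarith) le_rfl hw
    rw [hf2 w hw', norm_neg]
    refine hsmall w (hQout w ?_ ?_) _ (hgb' w hw')
    · rw [abs_of_pos] <;> linarith [hw.2.1.1]
    · rw [abs_of_pos] <;> linarith [hw.2.1.2, hw.2.1.1]

end Slab

namespace AffineData

variable {J A : Type} [Fintype J] [DecidableEq J] [NormedAddCommGroup A] [NormedSpace ℂ A]
variable {S : AffineData J A}
variable {W : Type} [NormedAddCommGroup W] [NormedSpace ℂ W] [FiniteDimensional ℂ W]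

/-- Extending a solution of `q = 1` across a slab on which a second reference solution is
connected to the first one by a spray. -/
theorem exists_extend_slab {Ω : Set W} {l : W →L[ℂ] ℂ} {y₁ y₂ lo c τ : ℝ}
    (he : ∃ e : W, l e = 1 ∧ ∀ w ∈ Ω, ∀ c : ℂ, w + c • e ∈ Ω) (hΩ : IsOpen Ω) (hτ : 0 < τ)
    (hlo : lo ≤ c - 4 * τ) {a : W → A} (ha : DifferentiableOn ℂ a (slab Ω l y₁ y₂ lo (c + 4 * τ)))
    {c₀ c₁ : W → J → ℂ} (M : S.Spray) {p : W → M.P} {B : ℝ}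
    (hp : DifferentiableOn ℂ p (slab Ω l y₁ y₂ (c - 4 * τ) (c + τ)))
    (hB : ∀ w ∈ slab Ω l y₁ y₂ (c - 4 * τ) (c + τ), ‖p w‖ ≤ B)
    (hM : ∀ w ∈ slab Ω l y₁ y₂ (c - 4 * τ) (c - 2 * τ), c₀ w = M.map (p w) (c₁ w) (a w))
    {C C₁ : Set ((J → ℂ) × A)} (hC : IsCompact C) (hC₁ : IsCompact C₁)
    (hcC : ∀ w ∈ slab Ω l y₁ y₂ (c - 4 * τ) (c - 2 * τ), (c₀ w, a w) ∈ C)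
    (hcC₁ : ∀ w ∈ slab Ω l y₁ y₂ (c - 4 * τ) (c + 4 * τ), (c₁ w, a w) ∈ C₁)
    (hu : ∀ x ∈ C, S.u x.1 x.2 = 1)
    (hc₁ : DifferentiableOn ℂ c₁ (slab Ω l y₁ y₂ (c - 4 * τ) (c + 4 * τ)))
    (hq : ∀ w ∈ slab Ω l y₁ y₂ (c - 4 * τ) (c + 4 * τ), S.q (c₁ w) (a w) = 1)
    (hV : ∀ η > 0, ∃ V : W → J → ℂ, DifferentiableOn ℂ V (slab Ω l y₁ y₂ lo (c - 2 * τ)) ∧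
      (∀ w ∈ slab Ω l y₁ y₂ lo (c - 2 * τ), S.q (V w) (a w) = 1) ∧
      ∀ w ∈ slab Ω l y₁ y₂ (c - 4 * τ) (c - 2 * τ), ‖V w - c₀ w‖ ≤ η)
    {η : ℝ} (hη : 0 < η) :
    ∃ V : W → J → ℂ, DifferentiableOn ℂ V (slab Ω l y₁ y₂ lo (c + 4 * τ)) ∧
      (∀ w ∈ slab Ω l y₁ y₂ lo (c + 4 * τ), S.q (V w) (a w) = 1) ∧
      ∀ w ∈ slab Ω l y₁ y₂ (c + 2 * τ) (c + 4 * τ), ‖V w - c₁ w‖ ≤ η := by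
  set X := slab Ω l y₁ y₂ lo (c - 2 * τ) with hX
  set X' := slab Ω l y₁ y₂ (c - 4 * τ) (c + 4 * τ) with hX'
  have hXX : X ∩ X' = slab Ω l y₁ y₂ (c - 4 * τ) (c - 2 * τ) := slab_inter hlo (by linarith)
  have hUn : X ∪ X' = slab Ω l y₁ y₂ lo (c + 4 * τ) := slab_union hlo (by linarith) (by linarith)
  have hflow : Continuous fun z : (J → ℂ) × ((J → ℂ) × A) => S.fullFlow z.1 z.2.1 z.2.2 := by
    have : ContDiff ℂ ∞ fun z : (J → ℂ) × ((J → ℂ) × A) => S.fullFlow z.1 z.2.1 z.2.2 := by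
      fun_prop
    exact this.continuous
  obtain ⟨δ₁, hδ₁, hfl⟩ := ((isCompact_singleton (x := (0 : J → ℂ))).prod hC₁).exists_norm_sub_le
    hflow hη
  obtain ⟨K, hK, hsplit⟩ := exists_splits_slab (F := J → ℂ) (y₁ := y₁) (y₂ := y₂) he hΩ
    (s := lo) (t := c - 2 * τ) (s' := c - 4 * τ) (t' := c + 4 * τ) hlo (by linarith)
    (by linarith)
  obtain ⟨ε, hε, hglue⟩ := S.exists_glue hK hsplit (isOpen_slab hΩ) (isOpen_slab hΩ) hC hu hδ₁
  obtain ⟨δ₂, hδ₂, hmap⟩ := ((isCompact_closedBall (0 : M.P) |B|).prod hC₁).exists_norm_sub_le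
    M.smooth.continuous (lt_min hε hδ₁)
  obtain ⟨f, hf, hfp, hf0⟩ := exists_approx_slab he hΩ hτ hp hB hδ₂
  obtain ⟨V, hVd, hVq, hVc⟩ := hV ε hε
  let v : W → J → ℂ := fun w => M.map (f w) (c₁ w) (a w)
  have haX' : DifferentiableOn ℂ a X' := ha.mono (slab_subset hlo le_rfl)
  have haX : DifferentiableOn ℂ a X := ha.mono (slab_subset le_rfl (by linarith))
  have hv : DifferentiableOn ℂ v X' :=
    (M.smooth.differentiable (by simp)).comp_differentiableOn (hf.prodMk (hc₁.prodMk haX'))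
  have hvq : ∀ w ∈ X', S.q (v w) (a w) = 1 := fun w hw => by rw [M.q_map, hq w hw]
  obtain ⟨ξ, ξ', hξ, hξ', -, hξb, hag⟩ := hglue a c₀ V v (fun w hw => hcC w (hXX ▸ hw)) (hUn ▸ ha)
    hVd hv (fun w hw => by rw [hVq w hw.1, hvq w hw.2]) (fun w hw => hVc w (hXX ▸ hw))
    (fun w hw => by
      rw [hXX] at hw
      have h1 := hmap (p w, c₁ w, a w)
        ⟨by simpa using (hB w (slab_subset le_rfl (by linarith) hw)).trans (le_abs_self B),
          hcC₁ w (slab_subset le_rfl (by linarith) hw)⟩ (f w, c₁ w, a w)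
        (by simpa [Prod.norm_def, hδ₂.le] using hfp w hw)
      rw [hM w hw]
      exact h1.trans (min_le_left _ _))
  classical
  let V' : W → J → ℂ := fun w => if (l w).re < c - 2 * τ then S.fullFlow (ξ w) (V w) (a w)
    else S.fullFlow (ξ' w) (v w) (a w)
  have hV1 : ∀ w ∈ X, V' w = S.fullFlow (ξ w) (V w) (a w) := fun w hw => if_pos hw.2.1.2
  have hV2 : ∀ w ∈ X', V' w = S.fullFlow (ξ' w) (v w) (a w) := by
    intro w hw
    by_cases h : (l w).re < c - 2 * τ
    · have : w ∈ X := ⟨hw.1, ⟨hlo.trans_lt hw.2.1.1, h⟩, hw.2.2⟩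
      rw [hV1 w this, hag w ⟨this, hw⟩]
    · exact if_neg h
  have hfd : Differentiable ℂ fun z : (J → ℂ) × ((J → ℂ) × A) => S.fullFlow z.1 z.2.1 z.2.2 := by
    have : ContDiff ℂ ∞ fun z : (J → ℂ) × ((J → ℂ) × A) => S.fullFlow z.1 z.2.1 z.2.2 := by
      fun_prop
    exact this.differentiable (by simp)
  refine ⟨V', ?_, ?_, ?_⟩
  · rw [← hUn]
    refine DifferentiableOn.union_of_isOpen ?_ ?_ (isOpen_slab hΩ) (isOpen_slab hΩ)
    · exact (hfd.comp_differentiableOn (hξ.prodMk (hVd.prodMk haX))).congr hV1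
    · exact (hfd.comp_differentiableOn (hξ'.prodMk (hv.prodMk haX'))).congr hV2
  · intro w hw
    rw [← hUn] at hw
    rcases hw with hw | hw
    · rw [hV1 w hw, q_fullFlow, hVq w hw]
    · rw [hV2 w hw, q_fullFlow, hvq w hw]
  · intro w hw
    have hwX' : w ∈ X' := slab_subset (by linarith) le_rfl hw
    have h1 := hmap (0, c₁ w, a w) ⟨by simp, hcC₁ w hwX'⟩ (f w, c₁ w, a w)
      (by simpa [Prod.norm_def, hδ₂.le] using hf0 w hw)
    simp only [M.map_zero] at h1
    have h2 := hfl (0, c₁ w, a w) ⟨rfl, hcC₁ w hwX'⟩ (ξ' w, v w, a w) (by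
      simp only [Prod.norm_def, Prod.fst_sub, Prod.snd_sub, sub_zero, sub_self, norm_zero]
      exact max_le (hξb w hwX') (max_le (h1.trans (min_le_right _ _)) hδ₁.le))
    simp only [fullFlow_zero] at h2
    rwa [hV2 w hwX']

end AffineData

section Row

variable {r : ℕ}

theorem contDiff_slotStep (k : ℕ) :
    ContDiff ℂ ∞ (fun x : Vec r × Row r => slotStep k x.1 x.2) := by
  unfold slotStep dotProduct
  split_ifs
  · fun_prop
  · fun_prop

theorem contDiff_runWord {E : Type*} [NormedAddCommGroup E] [NormedSpace ℂ E] {z : E → ℕ → Vec r}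
    {a : E → Row r} (hz : ∀ i, ContDiff ℂ ∞ (fun x => z x i)) (ha : ContDiff ℂ ∞ a) (n : ℕ) :
    ContDiff ℂ ∞ (fun x => runWord (z x) n (a x)) := by
  induction n with
  | zero => exact ha
  | succ n ih => exact (contDiff_slotStep n).comp ((hz n).prodMk ih)

theorem DifferentiableOn.runWord {E : Type*} [NormedAddCommGroup E] [NormedSpace ℂ E]
    {z : E → ℕ → Vec r} {a : E → Row r} {s : Set E}
    (hz : ∀ i, DifferentiableOn ℂ (fun x => z x i) s) (ha : DifferentiableOn ℂ a s) (n : ℕ) :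
    DifferentiableOn ℂ (fun x => runWord (z x) n (a x)) s := by
  induction n with
  | zero => exact ha
  | succ n ih =>
    exact ((contDiff_slotStep n).differentiable (by simp)).comp_differentiableOn ((hz n).prodMk ih)

theorem slotStep_add_smul_sub (k : ℕ) (v : Vec r) (c : ℂ) (s s' : Row r) :
    slotStep k v (s + c • (s' - s)) =
      slotStep k v s + c • (slotStep k v s' - slotStep k v s) := by
  unfold slotStep
  split_ifs
  · ext i <;> simp; ring
  · ext i <;> simp [add_dotProduct, sub_dotProduct]; ring

theorem slotStep_letter_add_smul (k : ℕ) (v v' : Vec r) (c : ℂ) (s : Row r) :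
    slotStep k (v + c • v') s =
      slotStep k v s + c • (slotStep k (v + v') s - slotStep k v s) := by
  unfold slotStep
  split_ifs
  · ext i <;> simp; ring
  · ext i <;> simp [dotProduct_add]; ring

/-- The run of a word depends affinely on each letter. -/
theorem runWord_add_single (z : ℕ → Vec r) (i : ℕ) (v : Vec r) (c : ℂ) (n : ℕ) (s : Row r) :
    runWord (z + Pi.single i (c • v)) n s =
      runWord z n s + c • (runWord (z + Pi.single i v) n s - runWord z n s) := by
  induction n with
  | zero => simp
  | succ n ih =>
    simp only [runWord_succ]
    by_cases h : n = i
    · subst h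
      have h1 : ∀ v, runWord (z + Pi.single n v) n s = runWord z n s := fun v =>
        runWord_congr _ fun j hj => by simp [hj.ne]
      simp only [h1, Pi.add_apply, Pi.single_eq_same, slotStep_letter_add_smul]
    · simp only [Pi.add_apply, Pi.single_eq_of_ne h, add_zero, ih, slotStep_add_smul_sub]

/-- The letters of a word of length `L` given by its coordinates. -/
def letters {L : ℕ} (y : Fin L × Fin (r + 1) → ℂ) (i : ℕ) : Vec r :=
  fun j => if h : i < L then y (⟨i, h⟩, j) else 0

/-- The coordinates of the first `L` letters of a word. -/
def coords (L : ℕ) (z : ℕ → Vec r) (x : Fin L × Fin (r + 1)) : ℂ := z x.1 x.2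

theorem letters_coords {L : ℕ} (z : ℕ → Vec r) {i : ℕ} (h : i < L) : letters (coords L z) i = z i := by
  funext j; simp [letters, coords, h]

theorem runWord_letters_coords {L : ℕ} (z : ℕ → Vec r) (a : Row r) :
    runWord (letters (coords L z)) L a = runWord z L a :=
  runWord_congr _ fun _ h => letters_coords z h

theorem contDiff_letters {L : ℕ} (i : ℕ) :
    ContDiff ℂ ∞ (fun y : Fin L × Fin (r + 1) → ℂ => letters y i) := by
  unfold letters
  split_ifs
  · fun_prop
  · fun_prop

theorem contDiff_run_letters (L n : ℕ) :
    ContDiff ℂ ∞ (fun x : (Fin L × Fin (r + 1) → ℂ) × Row r => runWord (letters x.1) n x.2) :=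
  contDiff_runWord (fun i => (contDiff_letters i).comp contDiff_fst) contDiff_snd n

theorem letters_add_single {L : ℕ} (y : Fin L × Fin (r + 1) → ℂ) (x : Fin L × Fin (r + 1)) (c : ℂ) :
    letters (y + Pi.single x c) = letters y + Pi.single x.1.1 (c • Pi.single x.2 1) := by
  obtain ⟨k, j⟩ := x
  funext i j'
  by_cases h : i < L
  · by_cases hi : i = k
    · subst hi
      simp [letters, Pi.single_apply]
    · have h2 : (⟨i, h⟩ : Fin L) ≠ k := fun h => hi (by simp [← h])
      simp [letters, h, hi, h2]
  · have hi : i ≠ k := by have := k.2; omega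
    simp [letters, h, hi]

theorem runWord_letters_add_single {L : ℕ} (x : Fin L × Fin (r + 1)) (y : Fin L × Fin (r + 1) → ℂ)
    (a : Row r) (c : ℂ) (n : ℕ) :
    runWord (letters (y + Pi.single x c)) n a = runWord (letters y) n a +
      c • (runWord (letters (y + Pi.single x 1)) n a - runWord (letters y) n a) := by
  rw [letters_add_single, letters_add_single, one_smul, runWord_add_single]

/-- The first entry of the row obtained from a word of length `2 * h + 2`. -/
def rowData (r h : ℕ) : AffineData (Fin (2 * h + 2) × Fin (r + 1)) (Row r) where
  q y a := (runWord (letters y) (2 * h + 2) a).1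
  u y a := (runWord (letters y) (2 * h + 2) a).2 0
  o := (⟨2 * h + 1, by omega⟩, 0)
  q_smooth := contDiff_fst.comp (contDiff_run_letters _ _)
  u_smooth := (contDiff_apply ℂ ℂ (0 : Fin (r + 1))).comp
    (contDiff_snd.comp (contDiff_run_letters _ _))
  q_add_o y a c := by
    have hodd : ¬ Even (2 * h + 1) := by simp
    simp only [letters_add_single, runWord_succ _ (2 * h + 1), slotStep_odd hodd]
    rw [runWord_congr (z := _ + _) (z' := letters y) a (n := 2 * h + 1)
      fun i hi => by simp [hi.ne]]
    simp; ring
  u_add_o y a c := by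
    have hodd : ¬ Even (2 * h + 1) := by simp
    simp only [letters_add_single, runWord_succ _ (2 * h + 1), slotStep_odd hodd]
    rw [runWord_congr (z := _ + _) (z' := letters y) a (n := 2 * h + 1)
      fun i hi => by simp [hi.ne]]
  q_add j y a c := by rw [runWord_letters_add_single]; simp
  u_add j y a c := by rw [runWord_letters_add_single]; simp

theorem rowData_q (h : ℕ) (z : ℕ → Vec r) (a : Row r) :
    (rowData r h).q (coords _ z) a = (runWord z (2 * h + 2) a).1 := by
  simp [rowData, runWord_letters_coords]

theorem rowData_u (h : ℕ) (z : ℕ → Vec r) (a : Row r) :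
    (rowData r h).u (coords _ z) a = (runWord z (2 * h + 2) a).2 0 := by
  simp [rowData, runWord_letters_coords]

end Row

/-- Two points outside the zeros of an entire function are joined by a path avoiding the zeros. -/
theorem exists_path_ne_zero {f : ℂ → ℂ} (hf : Differentiable ℂ f) {z₀ z₁ : ℂ} (h₀ : f z₀ ≠ 0)
    (h₁ : f z₁ ≠ 0) : ∃ γ : ℝ → ℂ, Continuous γ ∧ γ 0 = z₀ ∧ γ 1 = z₁ ∧ ∀ t, f (γ t) ≠ 0 := by
  have hcod := (hf.differentiableOn.analyticOnNhd isOpen_univ).preimage_zero_mem_codiscrete h₀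
  have hc : (f ⁻¹' {0}).Countable := by
    have h2 := (mem_codiscrete'.1 hcod).2
    rw [preimage_compl, compl_compl] at h2
    have := h2.to_subtype
    exact countable_coe_iff.1 (TopologicalSpace.separableSpace_iff_countable.1 inferInstance)
  obtain ⟨γ, hγ⟩ := (hc.isPathConnected_compl_of_one_lt_rank (by simp)).joinedIn z₀ h₀ z₁ h₁
  refine ⟨γ.extend, γ.continuous_extend, by simp, by simp, fun t => ?_⟩
  exact hγ (projIcc 0 1 zero_le_one t)

section Conn

variable {r : ℕ}

/-- The word `z'` after the first `k` letters of `z`. -/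
def catWord (k : ℕ) (z z' : ℕ → Vec r) (i : ℕ) : Vec r := if i < k then z i else z' (i - k)

theorem runWord_catWord {k : ℕ} (hk : Even k) (z z' : ℕ → Vec r) (n : ℕ) (s : Row r) :
    runWord (catWord k z z') (k + n) s = runWord z' n (runWord z k s) := by
  rw [runWord_add hk]
  rw [runWord_congr (z := catWord k z z') (z' := z) s fun i hi => by simp [catWord, hi]]
  exact runWord_congr _ fun i _ => by simp [catWord]

/-- The inverse of the word formed by the first `N` letters of `z`. -/
def invWord (N : ℕ) (z : ℕ → Vec r) (i : ℕ) : Vec r := if 1 ≤ i ∧ i ≤ N then -z (N - i) else 0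

theorem runWord_invWord {N : ℕ} (hN : Even N) (z : ℕ → Vec r) (s : Row r) :
    runWord (invWord N z) (N + 2) (runWord z N s) = s := by
  have key : ∀ k ≤ N, runWord (invWord N z) (k + 1) (runWord z N s) = runWord z (N - k) s := by
    intro k hk
    induction k with
    | zero => simp [runWord_succ, invWord]
    | succ k ih =>
      have h2 : invWord N z (k + 1) = -z (N - (k + 1)) := if_pos ⟨by omega, hk⟩
      have h1 : N - k = N - (k + 1) + 1 := by omega
      have h3 : ∀ v : Vec r, slotStep (k + 1) v = slotStep (N - (k + 1)) v := by
        intro v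
        have h4 : Even (k + 1) ↔ Even (N - (k + 1)) := by
          rw [Nat.even_sub hk]; simp [hN]
        unfold slotStep
        simp only [h4]
      rw [runWord_succ, ih (by omega), h2, h1, runWord_succ, h3, slotStep_neg]
  have h1 : invWord N z (N + 1) = 0 := if_neg (by omega)
  rw [runWord_succ, h1, slotStep_zero, key N le_rfl, Nat.sub_self, runWord_zero]

theorem letterwise_catWord {X : Type*} {P : (X → Vec r) → Prop} {z z' : X → ℕ → Vec r}
    (h : ∀ i, P fun x => z x i) (h' : ∀ i, P fun x => z' x i) (k i : ℕ) :
    P fun x => catWord k (z x) (z' x) i := by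
  unfold catWord
  split_ifs
  exacts [h i, h' _]

theorem letterwise_invWord {X : Type*} {P : (X → Vec r) → Prop} {z : X → ℕ → Vec r}
    (h : ∀ i, P fun x => -z x i) (h0 : P fun _ => 0) (N i : ℕ) :
    P fun x => invWord N (z x) i := by
  unfold invWord
  split_ifs
  exacts [h _, h0]

/-- The first coordinate vector. -/
def vecOne (r : ℕ) : Vec r := Pi.single 0 1

/-- The word taking the row `(x, v)` with `x ≠ 0` to `(1, 0)`. -/
noncomputable def fixWord (s : Row r) : ℕ → Vec r
  | 0 => -(s.1⁻¹ • s.2) + vecOne r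
  | 1 => (s.1⁻¹ - 1) • vecOne r
  | 2 => -(s.1 • vecOne r)
  | _ => 0

theorem runWord_fixWord {s : Row r} (hs : s.1 ≠ 0) : runWord (fixWord s) 4 s = baseRow r := by
  have h1 : vecOne r ⬝ᵥ vecOne r = 1 := by simp [vecOne]
  obtain ⟨x, v⟩ := s
  simp only [] at hs
  have h3 : x + (x⁻¹ - 1) * x = 1 := by field_simp; ring
  simp [runWord_succ, fixWord, slotStep, h1, h3, baseRow, Nat.even_iff, hs]

/-- The word taking `(1, 0)` to `(1, e₀)`. -/
def endWord (r : ℕ) (i : ℕ) : Vec r := if i = 0 then vecOne r else 0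

theorem runWord_endWord : runWord (endWord r) 2 (baseRow r) = (1, vecOne r) := by
  simp [runWord_succ, endWord, slotStep, baseRow]

/-- Five words, one after the other. -/
def blockWord (N : ℕ) (z₁ z₂ z₃ g : ℕ → Vec r) : ℕ → Vec r :=
  catWord N z₁ (catWord (N + 2) z₂ (catWord N z₃ (catWord 4 g (endWord r))))

theorem runWord_blockWord {n : ℕ} {z₁ z₂ z₃ g : ℕ → Vec r} {a : Row r}
    (h : runWord g 4 (runWord z₃ (2 * n) (runWord z₂ (2 * n + 2) (runWord z₁ (2 * n) a))) =
      baseRow r) :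
    runWord (blockWord (2 * n) z₁ z₂ z₃ g) (2 * (3 * n + 3) + 2) a = (1, vecOne r) := by
  have hN : Even (2 * n) := even_two_mul n
  rw [show 2 * (3 * n + 3) + 2 = 2 * n + ((2 * n + 2) + (2 * n + (4 + 2))) by ring, blockWord,
    runWord_catWord hN, runWord_catWord (hN.add even_two), runWord_catWord hN,
    runWord_catWord (by decide), h, runWord_endWord]

theorem letterwise_blockWord {X : Type*} {P : (X → Vec r) → Prop} {z₁ z₂ z₃ g : X → ℕ → Vec r}
    (hc : ∀ c, P fun _ => c) (h₁ : ∀ i, P fun x => z₁ x i)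
    (h₂ : ∀ i, P fun x => z₂ x i) (h₃ : ∀ i, P fun x => z₃ x i) (hg : ∀ i, P fun x => g x i)
    (N i : ℕ) : P fun x => blockWord N (z₁ x) (z₂ x) (z₃ x) (g x) i :=
  letterwise_catWord h₁ (letterwise_catWord h₂ (letterwise_catWord h₃
    (letterwise_catWord hg (fun _ => hc _) _) _) _) _ _

/-- The reference word attached to a word. -/
def refWord (N : ℕ) (z : ℕ → Vec r) : ℕ → Vec r := blockWord N z 0 0 0

variable {W : Type} [NormedAddCommGroup W] [NormedSpace ℂ W]

/-- Two maps connected by sprays in both directions. -/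
def Connected (h : ℕ) (E : Set W) (a : W → Row r) (z z' : W → ℕ → Vec r) : Prop :=
  (rowData r h).Reach E a (fun w => coords _ (z w)) (fun w => coords _ (z' w)) ∧
  (rowData r h).Reach E a (fun w => coords _ (z' w)) (fun w => coords _ (z w))

theorem Connected.trans {h : ℕ} {E : Set W} {a : W → Row r} {z z' z'' : W → ℕ → Vec r}
    (h₁ : Connected h E a z z') (h₂ : Connected h E a z' z'') : Connected h E a z z'' :=
  ⟨h₁.1.trans h₂.1, h₂.2.trans h₁.2⟩

theorem Connected.symm {h : ℕ} {E : Set W} {a : W → Row r} {z z' : W → ℕ → Vec r}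
    (h₁ : Connected h E a z z') : Connected h E a z' z := ⟨h₁.2, h₁.1⟩

theorem differentiableOn_coords {L : ℕ} {E : Set W} {z : W → ℕ → Vec r}
    (hz : ∀ i, DifferentiableOn ℂ (fun w => z w i) E) :
    DifferentiableOn ℂ (fun w => coords L (z w)) E :=
  differentiableOn_pi.2 fun x => differentiableOn_pi.1 (hz x.1) x.2

theorem continuousOn_coords {X : Type*} [TopologicalSpace X] {L : ℕ} {E : Set X}
    {z : X → ℕ → Vec r} (hz : ∀ i, ContinuousOn (fun w => z w i) E) :
    ContinuousOn (fun w => coords L (z w)) E :=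
  continuousOn_pi.2 fun x => continuousOn_pi.1 (hz x.1) x.2

theorem Connected.of_path {h : ℕ} {E K : Set W} (hK : IsCompact K) (hEK : E ⊆ K) {a : W → Row r}
    (ha : DifferentiableOn ℂ a E) (hac : ContinuousOn a K) {Z : ℝ → W → ℕ → Vec r}
    (hZ : ∀ i, ContinuousOn (fun x : ℝ × W => Z x.1 x.2 i) (Icc 0 1 ×ˢ K))
    (hd : ∀ s ∈ Icc (0 : ℝ) 1, ∀ i, DifferentiableOn ℂ (fun w => Z s w i) E)
    (hr : ∀ s ∈ Icc (0 : ℝ) 1, ∀ w ∈ K, runWord (Z s w) (2 * h + 2) (a w) = (1, vecOne r)) :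
    Connected h E a (Z 0) (Z 1) := by
  have hu : ∀ s ∈ Icc (0 : ℝ) 1, ∀ w ∈ K, (rowData r h).u (coords _ (Z s w)) (a w) = 1 := by
    intro s hs w hw
    rw [rowData_u, hr s hs w hw]; simp [vecOne]
  have hq : ∀ s ∈ Icc (0 : ℝ) 1, ∀ w ∈ K, (rowData r h).q (coords _ (Z s w)) (a w) = 1 := by
    intro s hs w hw
    rw [rowData_q, hr s hs w hw]
  have h0 : (0 : ℝ) ∈ Icc (0 : ℝ) 1 := by simp
  have h1 : (1 : ℝ) ∈ Icc (0 : ℝ) 1 := by simp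
  constructor
  · refine AffineData.Reach.of_path hK hEK (Y := fun s w => coords _ (Z s w))
      (continuousOn_coords hZ) ha hac (fun s hs => differentiableOn_coords (hd s hs)) ?_ hu
    intro s hs w hw
    rw [hq s hs w (hEK hw), hq 0 h0 w (hEK hw)]
  · have hf : ∀ s ∈ Icc (0 : ℝ) 1, 1 - s ∈ Icc (0 : ℝ) 1 := fun s hs =>
      ⟨by linarith [hs.2], by linarith [hs.1]⟩
    have := AffineData.Reach.of_path (S := rowData r h) hK hEK
      (Y := fun s w => coords _ (Z (1 - s) w)) ((continuousOn_coords hZ).comp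
        (f := fun x : ℝ × W => (1 - x.1, x.2)) (by fun_prop) fun x hx => ⟨hf _ hx.1, hx.2⟩)
      ha hac (fun s hs => differentiableOn_coords (hd _ (hf s hs)))
      (fun s hs w hw => by
        rw [hq _ (hf s hs) w (hEK hw), hq _ (hf 0 h0) w (hEK hw)])
      fun s hs => hu _ (hf s hs)
    simpa using this

/-- The reference word of a lift can be moved to a word not depending on the lift. -/
theorem connected_blockWord {n : ℕ} {E K : Set W} (hK : IsCompact K) (hEK : E ⊆ K)
    (hE : Convex ℝ E) (hKc : Convex ℝ K) {p : W} (hp : p ∈ E) {a : W → Row r}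
    (ha : DifferentiableOn ℂ a E) (hac : ContinuousOn a K) {y y' : W → ℕ → Vec r}
    (hy : ∀ i, DifferentiableOn ℂ (fun w => y w i) E) (hyc : ∀ i, ContinuousOn (fun w => y w i) K)
    (hyr : ∀ w ∈ K, runWord (y w) (2 * n) (a w) = baseRow r)
    (hy' : ∀ i, DifferentiableOn ℂ (fun w => y' w i) E)
    (hyc' : ∀ i, ContinuousOn (fun w => y' w i) K)
    (hyr' : ∀ w ∈ K, runWord (y' w) (2 * n) (a w) = baseRow r) :
    Connected (3 * n + 3) E a (fun w => refWord (2 * n) (y w))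
      (fun w => blockWord (2 * n) 0 0 (y' w) 0) := by
  have hN : Even (2 * n) := even_two_mul n
  have hrun0 : ∀ (m : ℕ) (s : Row r), runWord 0 m s = s := fun m s =>
    runWord_zero_word s fun _ _ => rfl
  have hinv : ∀ w ∈ K, runWord (invWord (2 * n) (y w)) (2 * n + 2) (baseRow r) = a w := by
    intro w hw
    rw [← hyr w hw, runWord_invWord hN]
  have hyc2 : ∀ i, ContinuousOn (fun x : ℝ × W => y x.2 i) (Icc 0 1 ×ˢ K) := fun i =>
    (hyc i).comp continuousOn_snd fun x hx => hx.2
  have hyc2' : ∀ i, ContinuousOn (fun x : ℝ × W => y' x.2 i) (Icc 0 1 ×ˢ K) := fun i =>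
    (hyc' i).comp continuousOn_snd fun x hx => hx.2
  have hpK := hEK hp
  -- turning on the correcting block
  have step1 : ∀ z₂ z₃ : ℕ → Vec r,
      runWord z₃ (2 * n) (runWord z₂ (2 * n + 2) (baseRow r)) = baseRow r →
      Connected (3 * n + 3) E a (fun w => blockWord (2 * n) (y w) z₂ z₃ 0)
        (fun w => blockWord (2 * n) (y w) z₂ z₃ (fixWord (baseRow r))) := by
    intro z₂ z₃ h
    have := Connected.of_path (h := 3 * n + 3) hK hEK ha hac
      (Z := fun s w => blockWord (2 * n) (y w) z₂ z₃ fun i => (s : ℂ) • fixWord (baseRow r) i)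
      (letterwise_blockWord (P := fun f => ContinuousOn f (Icc 0 1 ×ˢ K))
        (z₁ := fun x : ℝ × W => y x.2) (z₂ := fun _ => z₂) (z₃ := fun _ => z₃)
        (g := fun x : ℝ × W => fun i => (x.1 : ℂ) • fixWord (baseRow r) i)
        (fun _ => continuousOn_const) hyc2 (fun _ => continuousOn_const)
        (fun _ => continuousOn_const) (fun _ => by fun_prop) _)
      (fun s _ => letterwise_blockWord (P := fun f => DifferentiableOn ℂ f E)
        (z₁ := fun w : W => y w) (z₂ := fun _ => z₂) (z₃ := fun _ => z₃)
        (g := fun _ i => (s : ℂ) • fixWord (baseRow r) i)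
        (fun _ => differentiableOn_const _) hy (fun _ => differentiableOn_const _)
        (fun _ => differentiableOn_const _) (fun _ => differentiableOn_const _) _)
      (fun s _ w hw => runWord_blockWord (by
        rw [hyr w hw, h]
        simp [runWord_succ, fixWord, slotStep, baseRow, Nat.even_iff]))
    simpa [Pi.zero_def] using this
  -- turning on the constant words
  have step2 : Connected (3 * n + 3) E a
      (fun w => blockWord (2 * n) (y w) 0 0 (fixWord (baseRow r)))
      (fun w => blockWord (2 * n) (y w) (invWord (2 * n) (y p)) (y' p) (fixWord (baseRow r))) := by
    let R : ℂ → Row r := fun c => runWord (fun i => c • y' p i) (2 * n)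
      (runWord (fun i => c • invWord (2 * n) (y p) i) (2 * n + 2) (baseRow r))
    have hR : Differentiable ℂ R := by
      have h1 : ContDiff ℂ ∞ R := contDiff_runWord (fun i => by fun_prop)
        (contDiff_runWord (fun i => by fun_prop) contDiff_const _) _
      exact h1.differentiable (by simp)
    have hR0 : R 0 = baseRow r := by
      simp only [R, zero_smul]
      exact (hrun0 _ _).trans (hrun0 _ _)
    have hR1 : R 1 = baseRow r := by
      simp only [R, one_smul]
      rw [hinv p hpK, hyr' p hpK]
    obtain ⟨γ, hγ, hγ0, hγ1, hne⟩ := exists_path_ne_zero (f := fun c => (R c).1)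
      (by fun_prop) (z₀ := 0) (z₁ := 1) (by simp [hR0, baseRow]) (by simp [hR1, baseRow])
    have hRγ : Continuous fun t => R (γ t) := hR.continuous.comp hγ
    have hfix : ∀ i, Continuous fun t => fixWord (R (γ t)) i := by
      intro i
      have h1 : Continuous fun t => (R (γ t)).1⁻¹ := (continuous_fst.comp hRγ).inv₀ hne
      match i with
      | 0 => exact ((h1.smul (continuous_snd.comp hRγ)).neg).add continuous_const
      | 1 => simp only [fixWord]; fun_prop
      | 2 => exact ((continuous_fst.comp hRγ).smul continuous_const).neg
      | i + 3 => exact continuous_const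
    have := Connected.of_path (h := 3 * n + 3) hK hEK ha hac
      (Z := fun s w => blockWord (2 * n) (y w) (fun i => γ s • invWord (2 * n) (y p) i)
        (fun i => γ s • y' p i) (fixWord (R (γ s))))
      (letterwise_blockWord (P := fun f => ContinuousOn f (Icc 0 1 ×ˢ K))
        (z₁ := fun x : ℝ × W => y x.2)
        (z₂ := fun x : ℝ × W => fun i => γ x.1 • invWord (2 * n) (y p) i)
        (z₃ := fun x : ℝ × W => fun i => γ x.1 • y' p i)
        (g := fun x : ℝ × W => fixWord (R (γ x.1)))
        (fun _ => continuousOn_const) hyc2 (fun _ => by fun_prop) (fun _ => by fun_prop)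
        (fun i => ((hfix i).comp continuous_fst).continuousOn) _)
      (fun s _ => letterwise_blockWord (P := fun f => DifferentiableOn ℂ f E)
        (z₁ := fun w : W => y w) (z₂ := fun _ => fun i => γ s • invWord (2 * n) (y p) i)
        (z₃ := fun _ => fun i => γ s • y' p i) (g := fun _ => fixWord (R (γ s)))
        (fun _ => differentiableOn_const _) hy (fun _ => differentiableOn_const _)
        (fun _ => differentiableOn_const _) (fun _ => differentiableOn_const _) _)
      (fun s _ w hw => runWord_blockWord (by
        rw [hyr w hw]
        exact runWord_fixWord (hne s)))
    simpa [hγ0, hγ1, hR0, hR1, Pi.zero_def] using this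
  -- moving the base point of the inserted words
  have hmem : ∀ {S : Set W}, Convex ℝ S → p ∈ S → ∀ t ∈ Icc (0 : ℝ) 1, ∀ w ∈ S,
      p + (t : ℂ) • (w - p) ∈ S := by
    intro S hS hpS t ht w hw
    rw [Complex.coe_smul]
    exact hS.add_smul_sub_mem hpS hw ht
  have step3 : Connected (3 * n + 3) E a
      (fun w => blockWord (2 * n) (y w) (invWord (2 * n) (y p)) (y' p) 0)
      (fun w => blockWord (2 * n) (y w) (invWord (2 * n) (y w)) (y' w) 0) := by
    have hcont : Continuous fun x : ℝ × W => p + (x.1 : ℂ) • (x.2 - p) := by fun_prop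
    have h1 : ∀ i, ContinuousOn (fun x : ℝ × W => y (p + (x.1 : ℂ) • (x.2 - p)) i)
        (Icc 0 1 ×ˢ K) := fun i =>
      (hyc i).comp hcont.continuousOn fun x hx => hmem hKc hpK _ hx.1 _ hx.2
    have h2 : ∀ i, ContinuousOn (fun x : ℝ × W => y' (p + (x.1 : ℂ) • (x.2 - p)) i)
        (Icc 0 1 ×ˢ K) := fun i =>
      (hyc' i).comp hcont.continuousOn fun x hx => hmem hKc hpK _ hx.1 _ hx.2
    have h3 : ∀ s ∈ Icc (0 : ℝ) 1, ∀ i,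
        DifferentiableOn ℂ (fun w => y (p + (s : ℂ) • (w - p)) i) E := fun s hs i =>
      (hy i).comp (f := fun w => p + (s : ℂ) • (w - p)) (by fun_prop)
        fun w hw => hmem hE hp _ hs _ hw
    have h4 : ∀ s ∈ Icc (0 : ℝ) 1, ∀ i,
        DifferentiableOn ℂ (fun w => y' (p + (s : ℂ) • (w - p)) i) E := fun s hs i =>
      (hy' i).comp (f := fun w => p + (s : ℂ) • (w - p)) (by fun_prop)
        fun w hw => hmem hE hp _ hs _ hw
    have := Connected.of_path (h := 3 * n + 3) hK hEK ha hac
      (Z := fun s w => blockWord (2 * n) (y w) (invWord (2 * n) (y (p + (s : ℂ) • (w - p))))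
        (y' (p + (s : ℂ) • (w - p))) 0)
      (letterwise_blockWord (P := fun f => ContinuousOn f (Icc 0 1 ×ˢ K))
        (z₁ := fun x : ℝ × W => y x.2)
        (z₂ := fun x : ℝ × W => invWord (2 * n) (y (p + (x.1 : ℂ) • (x.2 - p))))
        (z₃ := fun x : ℝ × W => y' (p + (x.1 : ℂ) • (x.2 - p)))
        (g := fun _ => 0) (fun _ => continuousOn_const) hyc2
        (letterwise_invWord (P := fun f => ContinuousOn f (Icc 0 1 ×ˢ K)) (fun i => (h1 i).neg)
          continuousOn_const _) h2 (fun _ => continuousOn_const) _)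
      (fun s hs => letterwise_blockWord (P := fun f => DifferentiableOn ℂ f E)
        (z₁ := fun w : W => y w)
        (z₂ := fun w => invWord (2 * n) (y (p + (s : ℂ) • (w - p))))
        (z₃ := fun w => y' (p + (s : ℂ) • (w - p))) (g := fun _ => 0)
        (fun _ => differentiableOn_const _) hy
        (letterwise_invWord (P := fun f => DifferentiableOn ℂ f E) (fun i => (h3 s hs i).neg)
          (differentiableOn_const _) _) (h4 s hs) (fun _ => differentiableOn_const _) _)
      (fun s hs w hw => runWord_blockWord (by
        have hm := hmem hKc hpK s hs w hw
        rw [hyr w hw, hinv _ hm, hyr' _ hm, hrun0]))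
    simpa using this
  -- contracting the first two blocks
  have step4 : Connected (3 * n + 3) E a (fun w => blockWord (2 * n) 0 0 (y' w) 0)
      (fun w => blockWord (2 * n) (y w) (invWord (2 * n) (y w)) (y' w) 0) := by
    have hinv0 : invWord (2 * n) (0 : ℕ → Vec r) = 0 := by
      funext i; simp [invWord]
    have h1 : ∀ i, ContinuousOn (fun x : ℝ × W => (x.1 : ℂ) • y x.2 i) (Icc 0 1 ×ˢ K) := fun i =>
      ContinuousOn.smul (f := fun x : ℝ × W => (x.1 : ℂ)) (by fun_prop) (hyc2 i)
    have := Connected.of_path (h := 3 * n + 3) hK hEK ha hac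
      (Z := fun s w => blockWord (2 * n) (fun i => (s : ℂ) • y w i)
        (invWord (2 * n) (fun i => (s : ℂ) • y w i)) (y' w) 0)
      (letterwise_blockWord (P := fun f => ContinuousOn f (Icc 0 1 ×ˢ K))
        (z₁ := fun x : ℝ × W => fun i => (x.1 : ℂ) • y x.2 i)
        (z₂ := fun x : ℝ × W => invWord (2 * n) (fun i => (x.1 : ℂ) • y x.2 i))
        (z₃ := fun x : ℝ × W => y' x.2)
        (g := fun _ => 0) (fun _ => continuousOn_const) h1
        (letterwise_invWord (P := fun f => ContinuousOn f (Icc 0 1 ×ˢ K)) (fun i => (h1 i).neg)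
          continuousOn_const _) hyc2' (fun _ => continuousOn_const) _)
      (fun s hs => letterwise_blockWord (P := fun f => DifferentiableOn ℂ f E)
        (z₁ := fun w : W => fun i => (s : ℂ) • y w i)
        (z₂ := fun w => invWord (2 * n) (fun i => (s : ℂ) • y w i))
        (z₃ := y') (g := fun _ => 0)
        (fun _ => differentiableOn_const _) (fun i => (hy i).const_smul (s : ℂ))
        (letterwise_invWord (P := fun f => DifferentiableOn ℂ f E)
          (fun i => ((hy i).const_smul (s : ℂ)).neg)
          (differentiableOn_const _) _) hy' (fun _ => differentiableOn_const _) _)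
      (fun s hs w hw => runWord_blockWord (by
        rw [runWord_invWord hN, hyr' w hw, hrun0]))
    simpa [hinv0, ← Pi.zero_def] using this
  refine (step1 0 0 ((hrun0 _ _).trans (hrun0 _ _))).trans (step2.trans ?_)
  refine ((step1 _ _ ?_).symm.trans step3).trans step4.symm
  rw [hinv p hpK, hyr' p hpK]

/-- The reference words of two lifts are connected. -/
theorem connected_refWord {n : ℕ} {E K : Set W} (hK : IsCompact K) (hEK : E ⊆ K)
    (hE : Convex ℝ E) (hKc : Convex ℝ K) {p : W} (hp : p ∈ E) {a : W → Row r}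
    (ha : DifferentiableOn ℂ a E) (hac : ContinuousOn a K) {y y' : W → ℕ → Vec r}
    (hy : ∀ i, DifferentiableOn ℂ (fun w => y w i) E) (hyc : ∀ i, ContinuousOn (fun w => y w i) K)
    (hyr : ∀ w ∈ K, runWord (y w) (2 * n) (a w) = baseRow r)
    (hy' : ∀ i, DifferentiableOn ℂ (fun w => y' w i) E)
    (hyc' : ∀ i, ContinuousOn (fun w => y' w i) K)
    (hyr' : ∀ w ∈ K, runWord (y' w) (2 * n) (a w) = baseRow r) :
    Connected (3 * n + 3) E a (fun w => refWord (2 * n) (y w))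
      (fun w => refWord (2 * n) (y' w)) :=
  (connected_blockWord hK hEK hE hKc hp ha hac hy hyc hyr hy' hyc' hyr').trans
    (connected_blockWord hK hEK hE hKc hp ha hac hy' hyc' hyr' hy' hyc' hyr').symm

end Conn

section Lift

variable {r : ℕ} {W : Type} [NormedAddCommGroup W] [NormedSpace ℂ W]

/-- The row `a` is taken to `(1, 0)` by a holomorphic word of length `N`. -/
def Lifts (N : ℕ) (a : W → Row r) (E : Set W) : Prop :=
  ∃ z : W → ℕ → Vec r, (∀ i, DifferentiableOn ℂ (fun w => z w i) E) ∧
    ∀ w ∈ E, runWord (z w) N (a w) = baseRow r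

theorem Lifts.of_ne_zero {N : ℕ} (hN : Even N) {a : W → Row r} {E : Set W} {z : W → ℕ → Vec r}
    (hz : ∀ i, DifferentiableOn ℂ (fun w => z w i) E) (ha : DifferentiableOn ℂ a E)
    (hne : ∀ w ∈ E, (runWord (z w) N (a w)).1 ≠ 0) : Lifts (N + 4) a E := by
  have hR := DifferentiableOn.runWord hz ha N
  refine ⟨fun w => catWord N (z w) (fixWord (runWord (z w) N (a w))),
    letterwise_catWord (P := fun f => DifferentiableOn ℂ f E) hz (fun i => ?_) N, fun w hw => by
    rw [runWord_catWord hN, runWord_fixWord (hne w hw)]⟩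
  have h1 : DifferentiableOn ℂ (fun w => (runWord (z w) N (a w)).1) E :=
    differentiable_fst.comp_differentiableOn hR
  have h2 : DifferentiableOn ℂ (fun w => (runWord (z w) N (a w)).2) E :=
    differentiable_snd.comp_differentiableOn hR
  have h3 : DifferentiableOn ℂ (fun w => (runWord (z w) N (a w)).1⁻¹) E := h1.inv hne
  match i with
  | 0 => exact (h3.smul h2).neg.add (differentiableOn_const _)
  | 1 => exact (h3.sub (differentiableOn_const _)).smul (differentiableOn_const _)
  | 2 => exact (h1.smul (differentiableOn_const _)).neg
  | i + 3 => exact differentiableOn_const _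

theorem Lifts.of_fst_ne_zero {a : W → Row r} {E : Set W} (ha : DifferentiableOn ℂ a E)
    (hne : ∀ w ∈ E, (a w).1 ≠ 0) : Lifts 4 a E :=
  Lifts.of_ne_zero (N := 0) (by simp) (z := fun _ _ => 0) (fun _ => differentiableOn_const _) ha hne

theorem Lifts.of_snd_ne_zero {a : W → Row r} {E : Set W} (ha : DifferentiableOn ℂ a E)
    {k : Fin (r + 1)} (hne : ∀ w ∈ E, (a w).2 k ≠ 0) : Lifts 4 a E := by
  have h1 : DifferentiableOn ℂ (fun w => (a w).1) E := differentiable_fst.comp_differentiableOn ha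
  have h2 : DifferentiableOn ℂ (fun w => (a w).2) E := differentiable_snd.comp_differentiableOn ha
  have h3 : DifferentiableOn ℂ (fun w => (a w).2 k) E := differentiableOn_pi.1 h2 k
  have h4 : DifferentiableOn ℂ (fun w => ((a w).2 k)⁻¹) E := h3.inv hne
  refine ⟨fun w i => if i = 1 then ((1 - (a w).1) * ((a w).2 k)⁻¹) • Pi.single k 1 else
    if i = 2 then -(a w).2 else 0, fun i => ?_, fun w hw => ?_⟩
  · dsimp only
    split_ifs
    · exact (((differentiableOn_const _).sub h1).mul h4).smul (differentiableOn_const _)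
    · exact h2.neg
    · exact differentiableOn_const _
  · have := hne w hw
    simp [runWord_succ, slotStep, Nat.even_iff, baseRow, this]

/-- The product of a row and a column. -/
def rowDot (a b : Row r) : ℂ := a.1 * b.1 + a.2 ⬝ᵥ b.2

theorem contDiff_rowDot : ContDiff ℂ ∞ (fun x : Row r × Row r => rowDot x.1 x.2) := by
  unfold rowDot dotProduct; fun_prop

theorem DifferentiableOn.rowDot {a b : W → Row r} {E : Set W} (ha : DifferentiableOn ℂ a E)
    (hb : DifferentiableOn ℂ b E) : DifferentiableOn ℂ (fun w => rowDot (a w) (b w)) E :=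
  (contDiff_rowDot.differentiable (by simp)).comp_differentiableOn (ha.prodMk hb)

/-- A word for the transvection `1 + b δ`, where `δ b = 0`. -/
noncomputable def transvectionWord (b δ : Row r) : ℕ → Vec r
  | 1 => ((1 + δ.1) * (1 + b.1 * δ.1)⁻¹) • b.2
  | 2 => δ.2
  | 3 => -b.2
  | 4 => ((b.1 - 1) * (1 + b.1 * δ.1)⁻¹) • δ.2
  | _ => 0

theorem runWord_transvectionWord {b δ : Row r} (h : rowDot δ b = 0) (hα : 1 + b.1 * δ.1 ≠ 0)
    (s : Row r) : runWord (transvectionWord b δ) 6 s = s + rowDot s b • δ := by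
  obtain ⟨p, t⟩ := b
  obtain ⟨d, v⟩ := δ
  obtain ⟨x, w⟩ := s
  simp only [rowDot] at h hα ⊢
  have hv : v ⬝ᵥ t = -(d * p) := by linear_combination h
  simp only [runWord_succ, runWord_zero, slotStep, transvectionWord, Nat.even_iff]
  norm_num
  have hi : (1 + p * d) * (1 + p * d)⁻¹ = 1 := mul_inv_cancel₀ hα
  rw [hv]
  generalize (1 + p * d)⁻¹ = c at hi
  constructor
  · linear_combination (w ⬝ᵥ t) * (1 + d) * hi
  · ext i
    simp only [Pi.add_apply, Pi.smul_apply, smul_eq_mul]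
    linear_combination v i * ((p - 1) * c * (w ⬝ᵥ t) * (1 + d) + x * (p - 1) + w ⬝ᵥ t) * hi

/-- A row close to a row with a lift has a lift. -/
theorem Lifts.of_near {N : ℕ} (hN : Even N) {a a' b : W → Row r} {E : Set W}
    (ha : DifferentiableOn ℂ a E) (ha' : DifferentiableOn ℂ a' E) (hb : DifferentiableOn ℂ b E)
    (hab : ∀ w ∈ E, rowDot (a' w) (b w) = 1) (hμ : ∀ w ∈ E, rowDot (a w) (b w) ≠ 0)
    (hα : ∀ w ∈ E, rowDot (a w) (b w) -
      (b w).1 * ((a w).1 - rowDot (a w) (b w) * (a' w).1) ≠ 0)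
    (h : Lifts N a' E) : Lifts (N + 10) a E := by
  obtain ⟨z, hz, hr⟩ := h
  let μ : W → ℂ := fun w => rowDot (a w) (b w)
  let δ : W → Row r := fun w => a' w - (μ w)⁻¹ • a w
  have hμd : DifferentiableOn ℂ μ E := ha.rowDot hb
  have hμi : DifferentiableOn ℂ (fun w => (μ w)⁻¹) E := hμd.inv hμ
  have hδ : DifferentiableOn ℂ δ E := ha'.sub (hμi.smul ha)
  have hδb : ∀ w ∈ E, rowDot (δ w) (b w) = 0 := by
    intro w hw
    have h1 := hab w hw
    have h2 : (μ w)⁻¹ * rowDot (a w) (b w) = 1 := inv_mul_cancel₀ (hμ w hw)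
    simp only [rowDot] at h1 h2
    simp only [rowDot, δ, Prod.fst_sub, Prod.snd_sub, Prod.smul_fst, Prod.smul_snd, sub_dotProduct,
      smul_dotProduct, smul_eq_mul]
    linear_combination h1 - h2
  have hα' : ∀ w ∈ E, 1 + (b w).1 * (δ w).1 ≠ 0 := by
    intro w hw h0
    refine hα w hw ?_
    have h2 : μ w * (μ w)⁻¹ = 1 := mul_inv_cancel₀ (hμ w hw)
    have h3 : (δ w).1 = (a' w).1 - (μ w)⁻¹ * (a w).1 := rfl
    rw [h3] at h0
    change μ w - (b w).1 * ((a w).1 - μ w * (a' w).1) = 0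
    linear_combination μ w * h0 + (b w).1 * (a w).1 * h2
  have hb1 : DifferentiableOn ℂ (fun w => (b w).1) E := differentiable_fst.comp_differentiableOn hb
  have hb2 : DifferentiableOn ℂ (fun w => (b w).2) E := differentiable_snd.comp_differentiableOn hb
  have hd1 : DifferentiableOn ℂ (fun w => (δ w).1) E := differentiable_fst.comp_differentiableOn hδ
  have hd2 : DifferentiableOn ℂ (fun w => (δ w).2) E := differentiable_snd.comp_differentiableOn hδ
  have hαi : DifferentiableOn ℂ (fun w => (1 + (b w).1 * (δ w).1)⁻¹) E :=
    DifferentiableOn.inv ((differentiableOn_const _).add (hb1.mul hd1)) hα'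
  have ht : ∀ i, DifferentiableOn ℂ (fun w => transvectionWord (b w) (δ w) i) E := by
    intro i
    match i with
    | 0 => exact differentiableOn_const _
    | 1 => exact (((differentiableOn_const _).add hd1).mul hαi).smul hb2
    | 2 => exact hd2
    | 3 => exact hb2.neg
    | 4 => exact ((hb1.sub (differentiableOn_const _)).mul hαi).smul hd2
    | i + 5 => exact differentiableOn_const _
  have hrun : ∀ w ∈ E, runWord (catWord 6 (transvectionWord (b w) (δ w)) (z w)) (6 + N) (a w) =
      μ w • baseRow r := by
    intro w hw
    rw [runWord_catWord (by decide), runWord_transvectionWord (hδb w hw) (hα' w hw), ← hr w hw,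
      ← runWord_smul]
    congr 1
    change a w + μ w • (a' w - (μ w)⁻¹ • a w) = μ w • a' w
    rw [smul_sub, smul_smul, mul_inv_cancel₀ (hμ w hw), one_smul]
    abel
  have := Lifts.of_ne_zero (N := 6 + N) (Even.add (by decide) hN)
    (letterwise_catWord (P := fun f => DifferentiableOn ℂ f E) ht hz 6) ha
    (fun w hw => by
      rw [hrun w hw]; simpa [baseRow] using hμ w hw)
  rwa [show N + 10 = 6 + N + 4 by ring]

end Lift

section Long

variable {r : ℕ}

theorem slotStep_add (k : ℕ) (v : Vec r) (s s' : Row r) :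
    slotStep k v (s + s') = slotStep k v s + slotStep k v s' := by
  unfold slotStep
  split_ifs
  · ext i <;> simp; ring
  · ext i <;> simp [add_dotProduct]; ring

theorem runWord_add_row (z : ℕ → Vec r) (n : ℕ) (s s' : Row r) :
    runWord z n (s + s') = runWord z n s + runWord z n s' := by
  induction n with
  | zero => rfl
  | succ n ih => simp only [runWord_succ, ih, slotStep_add]

/-- The first column of the matrix of a word. -/
def colOf (z : ℕ → Vec r) (n : ℕ) : Row r :=
  ((runWord z n (1, 0)).1, fun j => (runWord z n (0, Pi.single j 1)).1)

theorem rowDot_colOf (z : ℕ → Vec r) (n : ℕ) (s : Row r) :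
    rowDot s (colOf z n) = (runWord z n s).1 := by
  let f : Vec r →ₗ[ℂ] ℂ :=
    { toFun := fun v => (runWord z n (0, v)).1
      map_add' := fun v v' => by
        have : ((0 : ℂ), v + v') = (0, v) + (0, v') := by simp
        rw [this, runWord_add_row]; rfl
      map_smul' := fun c v => by
        have : ((0 : ℂ), c • v) = c • (0, v) := by simp
        rw [this, runWord_smul]; rfl }
  have h1 : s = s.1 • ((1, 0) : Row r) + (0, s.2) := by ext <;> simp
  have h2 := f.pi_apply_eq_sum_univ s.2
  conv_rhs => rw [h1, runWord_add_row, runWord_smul]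
  change f s.2 = _ at h2
  change _ = s.1 * _ + f s.2
  rw [h2]
  simp only [rowDot, colOf, dotProduct, smul_eq_mul, f, LinearMap.coe_mk, AddHom.coe_mk]
  congr 1
  refine Finset.sum_congr rfl fun j _ => ?_
  congr 4
  funext i
  simp [Pi.single_apply, eq_comm]

variable {W : Type} [NormedAddCommGroup W] [NormedSpace ℂ W]

theorem DifferentiableOn.colOf {z : W → ℕ → Vec r} {E : Set W}
    (hz : ∀ i, DifferentiableOn ℂ (fun w => z w i) E) (n : ℕ) :
    DifferentiableOn ℂ (fun w => colOf (z w) n) E :=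
  (differentiable_fst.comp_differentiableOn
    (DifferentiableOn.runWord hz (differentiableOn_const _) n)).prodMk
  (differentiableOn_pi.2 fun _ => differentiable_fst.comp_differentiableOn
    (DifferentiableOn.runWord hz (differentiableOn_const _) n))

variable [FiniteDimensional ℂ W]

/-- A unimodular holomorphic row has a lift on smaller balls. -/
theorem exists_lifts {ρ R : ℝ} (hρ : 0 < ρ) (hR : ρ < R) {a b : W → Row r}
    (ha : DifferentiableOn ℂ a (ball 0 R)) (hb : DifferentiableOn ℂ b (ball 0 R))
    (hab : ∀ w ∈ ball (0 : W) R, rowDot (a w) (b w) = 1) :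
    ∃ N, Even N ∧ Lifts N a (ball 0 ρ) := by
  have : ProperSpace W := FiniteDimensional.proper ℂ W
  have hmem : ∀ t ∈ Icc (0 : ℝ) 1, ∀ w ∈ closedBall (0 : W) ρ, (t : ℂ) • w ∈ ball (0 : W) R := by
    intro t ht w hw
    rw [mem_ball_zero_iff, norm_smul, Complex.norm_real, Real.norm_of_nonneg ht.1]
    rw [mem_closedBall_zero_iff] at hw
    nlinarith [norm_nonneg w, ht.2]
  have hscale : Continuous fun x : ℝ × W => (x.1 : ℂ) • x.2 := by fun_prop
  have hac : ContinuousOn (fun x : ℝ × W => a ((x.1 : ℂ) • x.2)) (Icc 0 1 ×ˢ closedBall 0 ρ) :=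
    ha.continuousOn.comp hscale.continuousOn fun x hx => hmem _ hx.1 _ hx.2
  have hbc : ContinuousOn (fun x : ℝ × W => b ((x.1 : ℂ) • x.2)) (Icc 0 1 ×ˢ closedBall 0 ρ) :=
    hb.continuousOn.comp hscale.continuousOn fun x hx => hmem _ hx.1 _ hx.2
  let Φ : Row r × Row r × Row r → ℂ × ℂ := fun x => (rowDot x.1 x.2.2,
    rowDot x.1 x.2.2 - x.2.2.1 * (x.1.1 - rowDot x.1 x.2.2 * x.2.1.1))
  have hΦ : Continuous Φ := by
    have h1 : Continuous fun x : Row r × Row r × Row r => rowDot x.1 x.2.2 :=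
      contDiff_rowDot.continuous.comp (continuous_fst.prodMk (by fun_prop))
    fun_prop
  let H : (ℝ × ℝ) × W → ℂ × ℂ := fun x => Φ (a ((x.1.2 : ℂ) • x.2), a ((x.1.1 : ℂ) • x.2),
    b ((x.1.1 : ℂ) • x.2))
  have hH : ContinuousOn H ((Icc 0 1 ×ˢ Icc 0 1) ×ˢ closedBall 0 ρ) := by
    refine hΦ.comp_continuousOn (ContinuousOn.prodMk ?_ (ContinuousOn.prodMk ?_ ?_))
    · exact hac.comp (f := fun x : (ℝ × ℝ) × W => (x.1.2, x.2)) (by fun_prop)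
        fun x hx => ⟨hx.1.2, hx.2⟩
    · exact hac.comp (f := fun x : (ℝ × ℝ) × W => (x.1.1, x.2)) (by fun_prop)
        fun x hx => ⟨hx.1.1, hx.2⟩
    · exact hbc.comp (f := fun x : (ℝ × ℝ) × W => (x.1.1, x.2)) (by fun_prop)
        fun x hx => ⟨hx.1.1, hx.2⟩
  obtain ⟨δ, hδ, hHδ⟩ := Metric.uniformContinuousOn_iff.1
    (((isCompact_Icc.prod isCompact_Icc).prod
      (isCompact_closedBall (0 : W) ρ)).uniformContinuousOn_of_continuous hH) 1 one_pos
  obtain ⟨n, hn⟩ := exists_nat_one_div_lt hδ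
  have hn0 : (0 : ℝ) < n + 1 := by positivity
  have hIcc : ∀ k : ℕ, k ≤ n + 1 → (k / (n + 1) : ℝ) ∈ Icc (0 : ℝ) 1 := by
    intro k hk
    have : (k : ℝ) ≤ n + 1 := by exact_mod_cast hk
    exact ⟨by positivity, by rw [div_le_one hn0]; exact this⟩
  have hscd : ∀ t ∈ Icc (0 : ℝ) 1, ∀ {f : W → Row r}, DifferentiableOn ℂ f (ball 0 R) →
      DifferentiableOn ℂ (fun w => f ((t : ℂ) • w)) (ball 0 ρ) := by
    intro t ht f hf
    exact hf.comp (f := fun w : W => (t : ℂ) • w) (by fun_prop)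
      fun w hw => hmem t ht w (ball_subset_closedBall hw)
  have key : ∀ k : ℕ, k ≤ n + 1 → ∃ N, Even N ∧
      Lifts N (fun w => a (((k / (n + 1) : ℝ) : ℂ) • w)) (ball 0 ρ) := by
    intro k
    induction k with
    | zero =>
      intro _
      refine ⟨4, by decide, ?_⟩
      have h1 := hab 0 (by simp; linarith)
      have h0 : a 0 ≠ 0 := fun h => by simp [h, rowDot] at h1
      simp only [Nat.cast_zero, zero_div, Complex.ofReal_zero, zero_smul]
      by_cases h : (a 0).1 = 0
      · have h2 : (a 0).2 ≠ 0 := fun h2 => h0 (Prod.ext h h2)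
        obtain ⟨j, hj⟩ := Function.ne_iff.1 h2
        exact Lifts.of_snd_ne_zero (differentiableOn_const _) fun _ _ => hj
      · exact Lifts.of_fst_ne_zero (differentiableOn_const _) fun _ _ => h
    | succ k ih =>
      intro hk
      obtain ⟨N, hN, hl⟩ := ih (by omega)
      have h1 := hIcc k (by omega)
      have h2 := hIcc (k + 1) hk
      have hnear : ∀ w ∈ ball (0 : W) ρ, dist (H ((k / (n + 1), (k + 1 : ℕ) / (n + 1)), w)) 1 < 1 := by
        intro w hw
        have hwK := ball_subset_closedBall hw
        have h3 := hHδ ((k / (n + 1), (k + 1 : ℕ) / (n + 1)), w) ⟨⟨h1, h2⟩, hwK⟩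
          ((k / (n + 1), k / (n + 1)), w) ⟨⟨h1, h1⟩, hwK⟩ ?_
        · have h4 : H ((k / (n + 1), k / (n + 1)), w) = 1 := by
            simp only [H, Φ, hab _ (hmem _ h1 w hwK)]
            ext <;> simp
          rwa [h4] at h3
        · simp only [Prod.dist_eq, dist_self, Real.dist_eq]
          rw [show ((k + 1 : ℕ) / (n + 1) - k / (n + 1) : ℝ) = 1 / (n + 1) by push_cast; ring,
            abs_of_pos (by positivity)]
          simpa using ⟨hδ, by simpa using hn⟩
      have hne : ∀ z : ℂ, dist z 1 < 1 → z ≠ 0 := by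
        rintro z hz rfl
        simp at hz
      refine ⟨N + 10, hN.add (by decide), Lifts.of_near hN (hscd _ h2 ha) (hscd _ h1 ha)
        (hscd _ h1 hb) (fun w hw => hab _ (hmem _ h1 w (ball_subset_closedBall hw)))
        (fun w hw => ?_) (fun w hw => ?_) hl⟩
      · exact hne _ ((le_max_left _ _).trans_lt (hnear w hw))
      · exact hne _ ((le_max_right _ _).trans_lt (hnear w hw))
  obtain ⟨N, hN, hl⟩ := key (n + 1) le_rfl
  have h2 : (((n + 1 : ℕ) : ℝ) / (n + 1)) = 1 := by push_cast; field_simp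
  refine ⟨N, hN, ?_⟩
  simpa only [h2, Complex.ofReal_one, one_smul] using hl

/-- Lifting a unimodular row reduces to lifting entire nowhere vanishing rows. -/
theorem exists_entire_reduction {ρ R : ℝ} (hρ : 0 < ρ) (hR : ρ < R) {a b : W → Row r}
    (ha : DifferentiableOn ℂ a (ball 0 R)) (hb : DifferentiableOn ℂ b (ball 0 R))
    (hab : ∀ w ∈ ball (0 : W) R, rowDot (a w) (b w) = 1) :
    ∃ a' : W → Row r, Differentiable ℂ a' ∧ (∀ w, a' w ≠ 0) ∧
      ∀ N, Even N → Lifts N a' (ball 0 ρ) → Lifts (N + 10) a (ball 0 ρ) := by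
  have : ProperSpace W := FiniteDimensional.proper ℂ W
  obtain ⟨N₀, hN₀, z, hz, hzr⟩ := exists_lifts (ρ := (ρ + R) / 2) (by linarith) (by linarith)
    ha hb hab
  have hsub : closedBall (0 : W) ρ ⊆ ball 0 ((ρ + R) / 2) :=
    closedBall_subset_ball (by linarith)
  let y : W → Fin N₀ × Fin (r + 1) → ℂ := fun w => coords N₀ (z w)
  have hy : DifferentiableOn ℂ y (ball 0 ((ρ + R) / 2)) := differentiableOn_coords hz
  have hyr : ∀ w ∈ ball (0 : W) ((ρ + R) / 2), runWord (letters (y w)) N₀ (a w) = baseRow r := by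
    intro w hw
    rw [runWord_letters_coords, hzr w hw]
  let inv : (Fin N₀ × Fin (r + 1) → ℂ) → Row r := fun y =>
    runWord (invWord N₀ (letters y)) (N₀ + 2) (baseRow r)
  have hinv : ContDiff ℂ ∞ inv := contDiff_runWord (letterwise_invWord
    (P := fun f => ContDiff ℂ ∞ f) (fun i => (contDiff_letters i).neg) contDiff_const _)
    contDiff_const _
  have hinvr : ∀ y, runWord (letters y) N₀ (inv y) = baseRow r := by
    intro y
    have h1 : Function.Injective (fun s => runWord (invWord N₀ (letters y)) (N₀ + 2) s) :=
      fun s s' h => runWord_cancel h (Nat.zero_le _) fun _ _ _ => rfl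
    exact h1 (runWord_invWord hN₀ (letters y) (inv y))
  let Φ : (Fin N₀ × Fin (r + 1) → ℂ) × Row r → ℂ × ℂ := fun x =>
    ((runWord (letters x.1) N₀ x.2).1, (runWord (letters x.1) N₀ x.2).1 -
      (runWord (letters x.1) N₀ (1, 0)).1 *
        (x.2.1 - (runWord (letters x.1) N₀ x.2).1 * (inv x.1).1))
  have hΦ : Continuous Φ := by
    have h1 := (contDiff_run_letters (r := r) N₀ N₀).continuous
    have h2 := hinv.continuous
    have h3 : Continuous fun x : (Fin N₀ × Fin (r + 1) → ℂ) × Row r =>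
        runWord (letters x.1) N₀ (1, 0) :=
      h1.comp (g := fun x : (Fin N₀ × Fin (r + 1) → ℂ) × Row r => runWord (letters x.1) N₀ x.2)
        (f := fun x : (Fin N₀ × Fin (r + 1) → ℂ) × Row r => (x.1, ((1, 0) : Row r))) (by fun_prop)
    fun_prop
  have hC : IsCompact ((fun w => (y w, a w)) '' closedBall 0 ρ) :=
    (isCompact_closedBall _ _).image_of_continuousOn
      ((hy.continuousOn.mono hsub).prodMk (ha.continuousOn.mono
        (closedBall_subset_ball hR)))
  obtain ⟨δ, hδ, hΦδ⟩ := hC.exists_norm_sub_le hΦ (η := 1 / 2) (by norm_num)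
  obtain ⟨g, hg, hgy⟩ := exists_entire_approx_on_ball hρ (show ρ < (ρ + R) / 2 by linarith) hδ hy
  have hgl : ∀ i, Differentiable ℂ fun w => letters (g w) i := fun i =>
    ((contDiff_letters i).differentiable (by simp)).comp hg
  refine ⟨fun w => inv (g w), (hinv.differentiable (by simp)).comp hg, fun w h0 => ?_, ?_⟩
  · have h1 := hinvr (g w)
    have h2 : runWord (letters (g w)) N₀ 0 = 0 := by
      simpa using runWord_smul (letters (g w)) N₀ 0 0
    simp only [] at h0
    rw [h0, h2] at h1
    simpa [baseRow] using congrArg Prod.fst h1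
  · intro N hN hl
    have hnear : ∀ w ∈ ball (0 : W) ρ, ‖Φ (g w, a w) - 1‖ ≤ 1 / 2 := by
      intro w hw
      have hwK := ball_subset_closedBall hw
      have hw' := hsub hwK
      have h1 : Φ (y w, a w) = 1 := by
        have h2 : inv (y w) = a w := by
          simp only [inv]
          rw [← hyr w hw', runWord_invWord hN₀]
        simp only [Φ, hyr w hw', h2]
        ext <;> simp [baseRow]
      rw [← h1]
      refine hΦδ _ ⟨w, hwK, rfl⟩ _ ?_
      simpa [Prod.norm_def, hδ.le] using hgy w hw
    have hne : ∀ z : ℂ, ‖z - 1‖ ≤ 1 / 2 → z ≠ 0 := by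
      rintro z hz rfl
      norm_num at hz
    refine Lifts.of_near hN (b := fun w => colOf (letters (g w)) N₀)
      (ha.mono (ball_subset_ball hR.le))
      ((hinv.differentiable (by simp)).comp hg).differentiableOn
      (DifferentiableOn.colOf (fun i => (hgl i).differentiableOn) _) ?_ ?_ ?_ hl
    · intro w _
      rw [rowDot_colOf]
      exact congrArg Prod.fst (hinvr (g w))
    · intro w hw
      rw [rowDot_colOf]
      exact hne _ ((le_max_left _ _).trans (hnear w hw))
    · intro w hw
      rw [rowDot_colOf]
      exact hne _ ((le_max_right _ _).trans (hnear w hw))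

end Long

section Box

variable {m : ℕ}

/-- A real coordinate of a complex vector: real part for `false`, imaginary part for `true`. -/
def realCoord (k : Fin m × Bool) (w : Fin m → ℂ) : ℝ := if k.2 then (w k.1).im else (w k.1).re

/-- An open box. -/
def box (lo hi : Fin m × Bool → ℝ) : Set (Fin m → ℂ) :=
  {w | ∀ k, lo k < realCoord k w ∧ realCoord k w < hi k}

/-- A closed box. -/
def closedBox (lo hi : Fin m × Bool → ℝ) : Set (Fin m → ℂ) :=
  {w | ∀ k, lo k ≤ realCoord k w ∧ realCoord k w ≤ hi k}

variable {lo hi lo' hi' : Fin m × Bool → ℝ}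

theorem continuous_realCoord (k : Fin m × Bool) : Continuous (realCoord k) := by
  unfold realCoord
  split_ifs <;> fun_prop

theorem isCompact_closedBox : IsCompact (closedBox lo hi) := by
  have hc : IsClosed (closedBox lo hi) := by
    have : closedBox lo hi = ⋂ k, {w | lo k ≤ realCoord k w ∧ realCoord k w ≤ hi k} := by
      ext w; simp [closedBox]
    rw [this]
    exact isClosed_iInter fun k => (isClosed_le continuous_const (continuous_realCoord k)).inter
      (isClosed_le (continuous_realCoord k) continuous_const)
  let M : ℝ := ∑ k, (|lo k| + |hi k|)
  have hM : ∀ w ∈ closedBox lo hi, ∀ k, |realCoord k w| ≤ M := by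
    intro w hw k
    have h1 : |lo k| + |hi k| ≤ M :=
      Finset.single_le_sum (f := fun k => |lo k| + |hi k|) (fun _ _ => by positivity)
        (Finset.mem_univ k)
    refine le_trans (abs_le.2 ⟨?_, ?_⟩) h1
    · linarith [(hw k).1, neg_abs_le (lo k), abs_nonneg (hi k)]
    · linarith [(hw k).2, le_abs_self (hi k), abs_nonneg (lo k)]
  refine (isCompact_closedBall (0 : Fin m → ℂ) (2 * |M|)).of_isClosed_subset hc fun w hw => ?_
  rw [mem_closedBall_zero_iff, pi_norm_le_iff_of_nonneg (by positivity)]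
  intro j
  have h1 := hM w hw (j, false)
  have h2 := hM w hw (j, true)
  simp only [realCoord] at h1 h2
  have := Complex.norm_le_abs_re_add_abs_im (w j)
  simp at h1 h2
  linarith [le_abs_self M]

theorem realCoord_convex_comb (k : Fin m × Bool) (w w' : Fin m → ℂ) (s t : ℝ) :
    realCoord k (s • w + t • w') = s * realCoord k w + t * realCoord k w' := by
  unfold realCoord
  split_ifs <;> simp

theorem convex_box : Convex ℝ (box lo hi) := by
  intro w hw w' hw' s t hs ht hst k
  rw [realCoord_convex_comb]
  exact (convex_Ioo (lo k) (hi k)) (hw k) (hw' k) hs ht hst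

theorem convex_closedBox : Convex ℝ (closedBox lo hi) := by
  intro w hw w' hw' s t hs ht hst k
  rw [realCoord_convex_comb]
  exact (convex_Icc (lo k) (hi k)) (hw k) (hw' k) hs ht hst

theorem box_subset_closedBox (h : ∀ k, lo' k ≤ lo k) (h' : ∀ k, hi k ≤ hi' k) :
    box lo hi ⊆ closedBox lo' hi' :=
  fun _ hw k => ⟨(h k).trans (hw k).1.le, (hw k).2.le.trans (h' k)⟩

theorem box_subset_box (h : ∀ k, lo' k ≤ lo k) (h' : ∀ k, hi k ≤ hi' k) :
    box lo hi ⊆ box lo' hi' :=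
  fun _ hw k => ⟨(h k).trans_lt (hw k).1, (hw k).2.trans_le (h' k)⟩

theorem closedBox_subset_box (h : ∀ k, lo' k < lo k) (h' : ∀ k, hi k < hi' k) :
    closedBox lo hi ⊆ box lo' hi' :=
  fun _ hw k => ⟨(h k).trans_le (hw k).1, (hw k).2.trans_lt (h' k)⟩

theorem box_nonempty (h : ∀ k, lo k < hi k) : (box lo hi).Nonempty := by
  refine ⟨fun j => ⟨(lo (j, false) + hi (j, false)) / 2, (lo (j, true) + hi (j, true)) / 2⟩, ?_⟩
  rintro ⟨j, b⟩
  have := h (j, b)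
  cases b <;> simp only [realCoord] <;> constructor <;> simp <;> linarith

/-- A complex linear form with the given real part. -/
noncomputable def coordForm (k : Fin m × Bool) : (Fin m → ℂ) →L[ℂ] ℂ :=
  (if k.2 then -Complex.I else 1) • ContinuousLinearMap.proj k.1

theorem exists_box_eq_slab (lo hi : Fin m × Bool → ℝ) (k : Fin m × Bool) :
    ∃ (Ω : Set (Fin m → ℂ)) (y₁ y₂ : ℝ), IsOpen Ω ∧
      (∃ e : Fin m → ℂ, coordForm k e = 1 ∧ ∀ w ∈ Ω, ∀ c : ℂ, w + c • e ∈ Ω) ∧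
      ∀ s t, box (Function.update lo k s) (Function.update hi k t) =
        slab Ω (coordForm k) y₁ y₂ s t := by
  obtain ⟨j, b⟩ := k
  let Ω : Set (Fin m → ℂ) :=
    {w | ∀ i, i.1 ≠ j → lo i < realCoord i w ∧ realCoord i w < hi i}
  have hΩ : IsOpen Ω := by
    have : Ω = ⋂ i, ⋂ (_ : i.1 ≠ j), {w | lo i < realCoord i w ∧ realCoord i w < hi i} := by
      ext w; simp only [Ω, mem_iInter]; rfl
    rw [this]
    exact isOpen_iInter_of_finite fun i => isOpen_iInter_of_finite fun _ =>
      (isOpen_lt continuous_const (continuous_realCoord i)).inter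
        (isOpen_lt (continuous_realCoord i) continuous_const)
  have hinv : ∀ d : ℂ, ∀ w ∈ Ω, ∀ c : ℂ, w + c • Pi.single j d ∈ Ω := by
    intro d w hw c i hi
    have : realCoord i (w + c • Pi.single j d) = realCoord i w := by
      simp [realCoord, hi]
    rw [this]
    exact hw i hi
  have hsplit : ∀ lo hi : Fin m × Bool → ℝ, ∀ w, w ∈ box lo hi ↔
      (∀ i, i.1 ≠ j → lo i < realCoord i w ∧ realCoord i w < hi i) ∧
        (lo (j, false) < (w j).re ∧ (w j).re < hi (j, false)) ∧
        (lo (j, true) < (w j).im ∧ (w j).im < hi (j, true)) := by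
    intro lo hi w
    constructor
    · intro h
      exact ⟨fun i _ => h i, by simpa [realCoord] using h (j, false),
        by simpa [realCoord] using h (j, true)⟩
    · rintro ⟨h1, h2, h3⟩ ⟨i, b⟩
      by_cases hi : i = j
      · subst hi
        cases b
        · simpa [realCoord] using h2
        · simpa [realCoord] using h3
      · exact h1 (i, b) hi
  have hupd : ∀ (f : Fin m × Bool → ℝ) (s : ℝ) (i : Fin m × Bool), i.1 ≠ j →
      Function.update f (j, b) s i = f i := by
    intro f s i hi
    exact Function.update_of_ne (fun h => hi (by rw [h])) _ _
  cases b
  · refine ⟨Ω, lo (j, true), hi (j, true), hΩ, ⟨Pi.single j 1, by simp [coordForm], hinv 1⟩, ?_⟩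
    intro s t
    ext w
    rw [hsplit]
    have h1 : (∀ i : Fin m × Bool, i.1 ≠ j → Function.update lo (j, false) s i < realCoord i w ∧
        realCoord i w < Function.update hi (j, false) t i) ↔ w ∈ Ω :=
      forall_congr' fun i => forall_congr' fun hi => by rw [hupd _ _ _ hi, hupd _ _ _ hi]
    rw [h1]
    simp [slab, coordForm]
  · refine ⟨Ω, -hi (j, false), -lo (j, false), hΩ,
      ⟨Pi.single j Complex.I, by simp [coordForm], hinv _⟩, ?_⟩
    intro s t
    ext w
    rw [hsplit]
    have h1 : (∀ i : Fin m × Bool, i.1 ≠ j → Function.update lo (j, true) s i < realCoord i w ∧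
        realCoord i w < Function.update hi (j, true) t i) ↔ w ∈ Ω :=
      forall_congr' fun i => forall_congr' fun hi => by rw [hupd _ _ _ hi, hupd _ _ _ hi]
    rw [h1]
    simp [slab, coordForm]
    tauto

end Box

section Uniform

variable {m r : ℕ}

/-- The box `box lo hi`, enlarged by `θ`, with side `(s, t)` in the direction `k`. -/
def stripBox (lo hi : Fin m × Bool → ℝ) (k : Fin m × Bool) (θ s t : ℝ) : Set (Fin m → ℂ) :=
  box (Function.update (fun j => lo j - θ) k s) (Function.update (fun j => hi j + θ) k t)

/-- The closed box `closedBox lo hi`, enlarged by `θ`, with side `[s, t]` in the direction `k`. -/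
def closedStripBox (lo hi : Fin m × Bool → ℝ) (k : Fin m × Bool) (θ s t : ℝ) : Set (Fin m → ℂ) :=
  closedBox (Function.update (fun j => lo j - θ) k s) (Function.update (fun j => hi j + θ) k t)

variable {lo hi : Fin m × Bool → ℝ} {k : Fin m × Bool} {θ θ' s s' t t' : ℝ}

theorem stripBox_subset_closedStripBox (hθ : θ ≤ θ') (hs : s' ≤ s) (ht : t ≤ t') :
    stripBox lo hi k θ s t ⊆ closedStripBox lo hi k θ' s' t' := by
  refine box_subset_closedBox (fun j => ?_) (fun j => ?_) <;> by_cases h : j = k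
  · subst h; simpa
  · simp only [Function.update_of_ne h]; linarith
  · subst h; simpa
  · simpa [h]

theorem closedStripBox_subset_stripBox (hθ : θ < θ') (hs : s' < s) (ht : t < t') :
    closedStripBox lo hi k θ s t ⊆ stripBox lo hi k θ' s' t' := by
  refine closedBox_subset_box (fun j => ?_) (fun j => ?_) <;> by_cases h : j = k
  · subst h; simpa
  · simpa [h]
  · subst h; simpa
  · simpa [h]

theorem stripBox_nonempty (h : ∀ j, lo j < hi j) (hθ : 0 ≤ θ) (hst : s < t) :
    (stripBox lo hi k θ s t).Nonempty := by
  refine box_nonempty fun j => ?_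
  by_cases hj : j = k
  · subst hj; simpa
  · have := h j
    simp [hj]; linarith

theorem letterwise_refWord {X : Type*} {P : (X → Vec r) → Prop} {z : X → ℕ → Vec r}
    (hc : ∀ c, P fun _ => c) (h : ∀ i, P fun x => z x i) (N i : ℕ) :
    P fun x => refWord N (z x) i :=
  letterwise_blockWord (z₁ := z) (z₂ := fun _ => 0) (z₃ := fun _ => 0) (g := fun _ => 0) hc h
    (fun _ => hc _) (fun _ => hc _) (fun _ => hc _) N i

theorem runWord_refWord {n : ℕ} {z : ℕ → Vec r} {a : Row r}
    (h : runWord z (2 * n) a = baseRow r) :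
    runWord (refWord (2 * n) z) (2 * (3 * n + 3) + 2) a = (1, vecOne r) :=
  runWord_blockWord (by rw [h]; simp [runWord_zero_word])

theorem differentiableOn_coords_refWord {W : Type} [NormedAddCommGroup W] [NormedSpace ℂ W]
    {E : Set W} {z : W → ℕ → Vec r} (hz : ∀ i, DifferentiableOn ℂ (fun w => z w i) E) (N L : ℕ) :
    DifferentiableOn ℂ (fun w => coords L (refWord N (z w))) E :=
  differentiableOn_coords fun i =>
    letterwise_refWord (P := fun f => DifferentiableOn ℂ f E) (z := z)
      (fun _ => differentiableOn_const _) hz N i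

/-- Extending a solution across a strip on which a second lift is given. -/
theorem exists_extend_strip {n : ℕ} {a : (Fin m → ℂ) → Row r} (ha : Differentiable ℂ a)
    (hlt : ∀ j, lo j < hi j) (hθ : 0 < θ) {τ c : ℝ} (hτ : 0 < τ) {x : ℝ} (hx : x ≤ c - 4 * τ)
    {y₀ y₁ : (Fin m → ℂ) → ℕ → Vec r}
    (hy₀ : ∀ i, DifferentiableOn ℂ (fun w => y₀ w i)
      (stripBox lo hi k (2 * θ) (c - 12 * τ) (c + 3 * τ)))
    (hr₀ : ∀ w ∈ stripBox lo hi k (2 * θ) (c - 12 * τ) (c + 3 * τ),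
      runWord (y₀ w) (2 * n) (a w) = baseRow r)
    (hy₁ : ∀ i, DifferentiableOn ℂ (fun w => y₁ w i)
      (stripBox lo hi k (2 * θ) (c - 6 * τ) (c + 9 * τ)))
    (hr₁ : ∀ w ∈ stripBox lo hi k (2 * θ) (c - 6 * τ) (c + 9 * τ),
      runWord (y₁ w) (2 * n) (a w) = baseRow r)
    (hV : ∀ η > 0, ∃ V : (Fin m → ℂ) → Fin (2 * (3 * n + 3) + 2) × Fin (r + 1) → ℂ,
      DifferentiableOn ℂ V (stripBox lo hi k 0 x (c - 2 * τ)) ∧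
      (∀ w ∈ stripBox lo hi k 0 x (c - 2 * τ), (rowData r (3 * n + 3)).q (V w) (a w) = 1) ∧
      ∀ w ∈ stripBox lo hi k 0 (c - 4 * τ) (c - 2 * τ),
        ‖V w - coords _ (refWord (2 * n) (y₀ w))‖ ≤ η)
    {η : ℝ} (hη : 0 < η) :
    ∃ V : (Fin m → ℂ) → Fin (2 * (3 * n + 3) + 2) × Fin (r + 1) → ℂ,
      DifferentiableOn ℂ V (stripBox lo hi k 0 x (c + 4 * τ)) ∧
      (∀ w ∈ stripBox lo hi k 0 x (c + 4 * τ), (rowData r (3 * n + 3)).q (V w) (a w) = 1) ∧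
      ∀ w ∈ stripBox lo hi k 0 (c + 2 * τ) (c + 4 * τ),
        ‖V w - coords _ (refWord (2 * n) (y₁ w))‖ ≤ η := by
  obtain ⟨Ω, b₁, b₂, hΩ, he, hslab⟩ := exists_box_eq_slab (fun j => lo j - 0) (fun j => hi j + 0) k
  set E := stripBox lo hi k θ (c - 5 * τ) (c + 2 * τ)
  set K := closedStripBox lo hi k θ (c - 5 * τ) (c + 2 * τ)
  have hK : IsCompact K := isCompact_closedBox
  have hEK : E ⊆ K := stripBox_subset_closedStripBox le_rfl le_rfl le_rfl
  have hK₀ : K ⊆ stripBox lo hi k (2 * θ) (c - 12 * τ) (c + 3 * τ) :=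
    closedStripBox_subset_stripBox (by linarith) (by linarith) (by linarith)
  have hK₁ : K ⊆ stripBox lo hi k (2 * θ) (c - 6 * τ) (c + 9 * τ) :=
    closedStripBox_subset_stripBox (by linarith) (by linarith) (by linarith)
  obtain ⟨p₀, hp₀⟩ : E.Nonempty := stripBox_nonempty hlt hθ.le (by linarith)
  obtain ⟨M, p, hp, hM⟩ := (connected_refWord hK hEK convex_box convex_closedBox hp₀
    ha.differentiableOn ha.continuous.continuousOn (fun i => (hy₀ i).mono (hEK.trans hK₀))
    (fun i => ((hy₀ i).mono hK₀).continuousOn) (fun w hw => hr₀ w (hK₀ hw))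
    (fun i => (hy₁ i).mono (hEK.trans hK₁))
    (fun i => ((hy₁ i).mono hK₁).continuousOn) (fun w hw => hr₁ w (hK₁ hw))).2
  have hcpt : ∀ s t, IsCompact (closedStripBox lo hi k 0 s t) := fun s t => isCompact_closedBox
  have hsub : ∀ {s t s' t' : ℝ}, s' ≤ s → t ≤ t' →
      stripBox lo hi k 0 s t ⊆ closedStripBox lo hi k 0 s' t' := fun h h' =>
    stripBox_subset_closedStripBox le_rfl h h'
  have hpE : closedStripBox lo hi k 0 (c - 4 * τ) (c + τ) ⊆ E :=
    closedStripBox_subset_stripBox hθ (by linarith) (by linarith)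
  obtain ⟨B, hB⟩ := (hcpt _ _).exists_bound_of_continuousOn (hp.mono hpE).continuousOn
  have hd₀ := differentiableOn_coords_refWord hy₀ (2 * n) (2 * (3 * n + 3) + 2)
  have hd₁ := differentiableOn_coords_refWord hy₁ (2 * n) (2 * (3 * n + 3) + 2)
  have hC₀ : closedStripBox lo hi k 0 (c - 4 * τ) (c - 2 * τ) ⊆
      stripBox lo hi k (2 * θ) (c - 12 * τ) (c + 3 * τ) :=
    closedStripBox_subset_stripBox (by linarith) (by linarith) (by linarith)
  have hC₁ : closedStripBox lo hi k 0 (c - 4 * τ) (c + 4 * τ) ⊆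
      stripBox lo hi k (2 * θ) (c - 6 * τ) (c + 9 * τ) :=
    closedStripBox_subset_stripBox (by linarith) (by linarith) (by linarith)
  have key := AffineData.exists_extend_slab (S := rowData r (3 * n + 3)) (y₁ := b₁) (y₂ := b₂)
    (lo := x) he hΩ hτ hx (a := a) ha.differentiableOn
    (c₀ := fun w => coords _ (refWord (2 * n) (y₀ w)))
    (c₁ := fun w => coords _ (refWord (2 * n) (y₁ w))) M (p := p) (B := B)
  simp only [← hslab] at key
  exact key (hp.mono ((hsub le_rfl le_rfl).trans hpE)) (fun w hw => hB w (hsub le_rfl le_rfl hw))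
    (fun w hw => hM w (hpE (hsub le_rfl (by linarith) hw)))
    ((hcpt _ _).image_of_continuousOn ((hd₀.mono hC₀).continuousOn.prodMk
      ha.continuous.continuousOn))
    ((hcpt _ _).image_of_continuousOn ((hd₁.mono hC₁).continuousOn.prodMk
      ha.continuous.continuousOn))
    (fun w hw => ⟨w, hsub le_rfl le_rfl hw, rfl⟩) (fun w hw => ⟨w, hsub le_rfl le_rfl hw, rfl⟩)
    (by
      rintro _ ⟨w, hw, rfl⟩
      dsimp only
      rw [rowData_u, runWord_refWord (hr₀ w (hC₀ hw))]
      simp [vecOne])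
    (hd₁.mono ((hsub le_rfl le_rfl).trans hC₁))
    (fun w hw => by rw [rowData_q, runWord_refWord (hr₁ w (hC₁ (hsub le_rfl le_rfl hw)))])
    hV hη

/-- Lifts over overlapping strips give a longer lift over their union. -/
theorem Lifts.of_strips {n : ℕ} {a : (Fin m → ℂ) → Row r} (ha : Differentiable ℂ a)
    (hlt : ∀ j, lo j < hi j) (hθ : 0 < θ) {τ : ℝ} (hτ : 0 < τ) {M : ℕ}
    (hM : hi k ≤ lo k + 6 * τ * M)
    (hl : ∀ i : ℕ, i ≤ M → Lifts (2 * n) a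
      (stripBox lo hi k (2 * θ) (lo k + 6 * τ * i - 6 * τ) (lo k + 6 * τ * i + 9 * τ))) :
    Lifts (6 * n + 12) a (box lo hi) := by
  choose! y hy using hl
  have claim : ∀ i : ℕ, i ≤ M → ∀ η > 0,
      ∃ V : (Fin m → ℂ) → Fin (2 * (3 * n + 3) + 2) × Fin (r + 1) → ℂ,
      DifferentiableOn ℂ V (stripBox lo hi k 0 (lo k) (lo k + 6 * τ * i + 4 * τ)) ∧
      (∀ w ∈ stripBox lo hi k 0 (lo k) (lo k + 6 * τ * i + 4 * τ),
        (rowData r (3 * n + 3)).q (V w) (a w) = 1) ∧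
      ∀ w ∈ stripBox lo hi k 0 (lo k + 6 * τ * i + 2 * τ) (lo k + 6 * τ * i + 4 * τ),
        ‖V w - coords _ (refWord (2 * n) (y i w))‖ ≤ η := by
    intro i
    induction i with
    | zero =>
      intro hi₀ η hη
      have hsub : stripBox lo hi k 0 (lo k) (lo k + 6 * τ * (0 : ℕ) + 4 * τ) ⊆
          stripBox lo hi k (2 * θ) (lo k + 6 * τ * (0 : ℕ) - 6 * τ)
            (lo k + 6 * τ * (0 : ℕ) + 9 * τ) :=
        (stripBox_subset_closedStripBox le_rfl le_rfl le_rfl).trans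
          (closedStripBox_subset_stripBox (by linarith) (by simp; linarith) (by linarith))
      refine ⟨fun w => coords _ (refWord (2 * n) (y 0 w)),
        (differentiableOn_coords_refWord (hy 0 hi₀).1 _ _).mono hsub, fun w hw => ?_,
        fun w hw => by simpa using hη.le⟩
      rw [rowData_q, runWord_refWord ((hy 0 hi₀).2 w (hsub hw))]
    | succ i ih =>
      intro hi₁ η hη
      have hi₀ : i ≤ M := by omega
      have h0 := hy i hi₀
      have h1 := hy (i + 1) hi₁
      have h2 := ih hi₀
      set c := lo k + 6 * τ * ((i + 1 : ℕ) : ℝ) with hc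
      have hci : lo k + 6 * τ * (i : ℝ) = c - 6 * τ := by rw [hc]; push_cast; ring
      rw [hci, show c - 6 * τ - 6 * τ = c - 12 * τ by ring,
        show c - 6 * τ + 9 * τ = c + 3 * τ by ring] at h0
      rw [hci, show c - 6 * τ + 4 * τ = c - 2 * τ by ring,
        show c - 6 * τ + 2 * τ = c - 4 * τ by ring] at h2
      have hx : lo k ≤ c - 4 * τ := by
        have : (0 : ℝ) ≤ τ * i := by positivity
        linarith
      exact exists_extend_strip ha hlt hθ hτ hx h0.1 h0.2 h1.1 h1.2 h2 hη
  obtain ⟨V, hV, hq, -⟩ := claim M le_rfl 1 one_pos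
  have hsub : box lo hi ⊆ stripBox lo hi k 0 (lo k) (lo k + 6 * τ * M + 4 * τ) := by
    refine box_subset_box (fun j => ?_) (fun j => ?_) <;> by_cases h : j = k
    · subst h; simp
    · simp [h]
    · subst h; simp; linarith
    · simp [h]
  have := Lifts.of_ne_zero (N := 2 * (3 * n + 3) + 2) (by simp [parity_simps]) (E := box lo hi)
    (z := fun w => letters (V w)) (fun i => (((contDiff_letters i).differentiable (by simp)).comp_differentiableOn
      (hV.mono hsub))) ha.differentiableOn (fun w hw => by
        have : (runWord (letters (V w)) (2 * (3 * n + 3) + 2) (a w)).1 = 1 := hq w (hsub hw)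
        rw [this]; exact one_ne_zero)
  rwa [show 2 * (3 * n + 3) + 2 + 4 = 6 * n + 12 by ring] at this

/-- Rows without zeros lift, with words of length `N`, over boxes which are short in the directions
outside `S`. -/
def UniformLift (r N : ℕ) (S : Finset (Fin m × Bool)) : Prop :=
  ∀ a : (Fin m → ℂ) → Row r, Differentiable ℂ a → (∀ w, a w ≠ 0) → ∀ R > 0, ∃ ε > 0,
    ∀ lo hi : Fin m × Bool → ℝ, (∀ k, -R ≤ lo k ∧ hi k ≤ R) → (∀ k ∉ S, hi k - lo k ≤ ε) →
      Lifts N a (box lo hi)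

theorem norm_sub_lt_of_mem_box {w w' : Fin m → ℂ} {ε : ℝ} (hε : 0 < ε) (hw : w ∈ box lo hi)
    (hw' : w' ∈ box lo hi) (h : ∀ k, hi k - lo k ≤ ε) : ‖w - w'‖ < 3 * ε := by
  rw [pi_norm_lt_iff (by positivity)]
  intro j
  have h1 := hw (j, false)
  have h2 := hw (j, true)
  have h3 := hw' (j, false)
  have h4 := hw' (j, true)
  have h5 := h (j, false)
  have h6 := h (j, true)
  simp only [realCoord, Bool.false_eq_true, if_false, if_true] at h1 h2 h3 h4
  have h7 : |(w j - w' j).re| ≤ ε := by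
    rw [Complex.sub_re, abs_le]; constructor <;> linarith
  have h8 : |(w j - w' j).im| ≤ ε := by
    rw [Complex.sub_im, abs_le]; constructor <;> linarith
  have := Complex.norm_le_abs_re_add_abs_im (w j - w' j)
  simp only [Pi.sub_apply]
  linarith

theorem uniformLift_empty (r : ℕ) : UniformLift (m := m) r 4 ∅ := by
  intro a ha hne R hR
  let c : Option (Fin (r + 1)) → Set (Fin m → ℂ) := fun o =>
    o.elim {w | (a w).1 ≠ 0} fun k => {w | (a w).2 k ≠ 0}
  have h1 : Continuous fun w => (a w).1 := continuous_fst.comp ha.continuous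
  have h2 : ∀ k, Continuous fun w => (a w).2 k := fun k =>
    (continuous_apply k).comp (continuous_snd.comp ha.continuous)
  have hc : ∀ o, IsOpen (c o) := by
    rintro (_ | k)
    · exact isOpen_ne_fun h1 continuous_const
    · exact isOpen_ne_fun (h2 k) continuous_const
  have hcov : closedBox (fun _ : Fin m × Bool => -R) (fun _ => R) ⊆ ⋃ o, c o := by
    intro w _
    by_contra h
    simp only [mem_iUnion, not_exists] at h
    refine hne w (Prod.ext ?_ (funext fun k => ?_))
    · simpa [c] using h none
    · simpa [c] using h (some k)
  obtain ⟨δ, hδ, hL⟩ := lebesgue_number_lemma_of_metric isCompact_closedBox hc hcov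
  refine ⟨δ / 3, by positivity, fun lo hi hR hs => ?_⟩
  by_cases hem : (box lo hi).Nonempty
  · obtain ⟨w₀, hw₀⟩ := hem
    obtain ⟨o, ho⟩ := hL w₀ (box_subset_closedBox (fun k => (hR k).1) (fun k => (hR k).2) hw₀)
    have hsub : box lo hi ⊆ c o := fun w hw => ho (by
      rw [mem_ball_iff_norm]
      have := norm_sub_lt_of_mem_box (by positivity) hw hw₀ fun k => hs k (by simp)
      linarith)
    rcases o with _ | k
    · exact Lifts.of_fst_ne_zero ha.differentiableOn fun w hw => hsub hw
    · exact Lifts.of_snd_ne_zero ha.differentiableOn (k := k) fun w hw => hsub hw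
  · rw [not_nonempty_iff_eq_empty.1 hem]
    exact ⟨fun _ _ => 0, fun _ => differentiableOn_const _, by simp⟩

theorem UniformLift.insert {n : ℕ} {S : Finset (Fin m × Bool)} (h : UniformLift r (2 * n) S)
    (k : Fin m × Bool) : UniformLift r (6 * n + 12) (insert k S) := by
  intro a ha hne R hR
  obtain ⟨ε, hε, hl⟩ := h a ha hne (R + 1) (by linarith)
  refine ⟨ε / 2, by positivity, fun lo hi hR hs => ?_⟩
  by_cases hlt : ∀ j, lo j < hi j
  swap
  · have : box lo hi = ∅ := by
      rw [eq_empty_iff_forall_notMem]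
      exact fun w hw => hlt fun j => (hw j).1.trans (hw j).2
    rw [this]
    exact ⟨fun _ _ => 0, fun _ => differentiableOn_const _, by simp⟩
  have hδ : 0 < min ε 1 := lt_min hε one_pos
  have hd : 0 < hi k - lo k := sub_pos.2 (hlt k)
  obtain ⟨M, hM⟩ := exists_nat_gt ((hi k - lo k) * 15 / (6 * min ε 1))
  have hM0 : (0 : ℝ) < M := lt_of_le_of_lt (by positivity) hM
  set τ := (hi k - lo k) / (6 * M) with hτ
  have hτ0 : 0 < τ := by positivity
  have hτM : 6 * τ * M = hi k - lo k := by rw [hτ]; field_simp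
  have hτδ : 15 * τ ≤ min ε 1 := by
    rw [div_lt_iff₀ (by positivity)] at hM
    rw [hτ, mul_div_assoc', div_le_iff₀ (by positivity)]
    linarith
  have hθ : 0 < min ε 1 / 8 := by positivity
  have hε1 := min_le_left ε 1
  have hε2 := min_le_right ε 1
  refine Lifts.of_strips (k := k) ha hlt hθ hτ0 (M := M) (by linarith) fun i hi₀ => hl _ _ ?_ ?_
  · have hi₁ : 6 * τ * i ≤ 6 * τ * M := by
      have : (i : ℝ) ≤ M := by exact_mod_cast hi₀
      gcongr
    have hi₂ : 0 ≤ 6 * τ * i := by positivity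
    intro j
    by_cases hj : j = k
    · subst hj
      have := hR j
      simp only [Function.update_self]
      constructor <;> linarith
    · have := hR j
      simp only [Function.update_of_ne hj]
      constructor <;> linarith
  · intro j hjS
    by_cases hj : j = k
    · subst hj
      simp only [Function.update_self]
      linarith
    · have := hs j (by simp [hj, hjS])
      simp only [Function.update_of_ne hj]
      linarith

theorem exists_uniformLift (r : ℕ) (S : Finset (Fin m × Bool)) : ∃ n, UniformLift r (2 * n) S := by
  induction S using Finset.induction_on with
  | empty => exact ⟨2, uniformLift_empty r⟩
  | insert k S _ ih =>
    obtain ⟨n, hn⟩ := ih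
    exact ⟨3 * n + 6, by simpa [mul_add, ← mul_assoc] using hn.insert k⟩

/-- The length of a lift of a row without zeros depends only on the dimensions. -/
theorem exists_forall_lifts_of_ne_zero (m r : ℕ) : ∃ n, ∀ a : EuclideanSpace ℂ (Fin m) → Row r,
    Differentiable ℂ a → (∀ w, a w ≠ 0) → ∀ R, Lifts (2 * n) a (ball 0 R) := by
  obtain ⟨n, hn⟩ := exists_uniformLift (m := m) r Finset.univ
  refine ⟨n, fun a ha hne R => ?_⟩
  let e := EuclideanSpace.equiv (Fin m) ℂ
  obtain ⟨ε, -, hl⟩ := hn (a ∘ e.symm) (ha.comp e.symm.differentiable) (fun w => hne _)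
    (max R 1) (by positivity)
  obtain ⟨z, hz, hr⟩ := hl (fun _ => -max R 1) (fun _ => max R 1) (fun _ => ⟨le_rfl, le_rfl⟩)
    (by simp)
  have hsub : MapsTo e (ball 0 R) (box (fun _ => -max R 1) (fun _ => max R 1)) := by
    intro w hw k
    rw [mem_ball_zero_iff] at hw
    have h1 : ‖w k.1‖ ≤ ‖w‖ := PiLp.norm_apply_le w k.1
    rw [← abs_lt]
    refine lt_of_le_of_lt ?_ (hw.trans_le (le_max_left R 1))
    refine le_trans ?_ h1
    unfold realCoord
    split_ifs
    · exact Complex.abs_im_le_norm _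
    · exact Complex.abs_re_le_norm _
  exact ⟨fun w => z (e w), fun i => (hz i).comp e.differentiable.differentiableOn hsub,
    fun w hw => by simpa using hr (e w) (hsub hw)⟩

/-- The length of a lift of a unimodular row depends only on the dimensions. -/
theorem exists_forall_lifts (m r : ℕ) : ∃ n, ∀ (R : ℝ) (a b : EuclideanSpace ℂ (Fin m) → Row r),
    DifferentiableOn ℂ a (ball 0 R) → DifferentiableOn ℂ b (ball 0 R) →
    (∀ w ∈ ball 0 R, rowDot (a w) (b w) = 1) → ∀ ρ, 0 < ρ → ρ < R →
    Lifts (2 * n) a (ball 0 ρ) := by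
  obtain ⟨n, hn⟩ := exists_forall_lifts_of_ne_zero m r
  refine ⟨n + 5, fun R a b ha hb hab ρ hρ hρR => ?_⟩
  obtain ⟨a', ha', hne, hl⟩ := exists_entire_reduction hρ hρR ha hb hab
  simpa [mul_add] using hl (2 * n) (even_two_mul n) (hn a' ha' hne ρ)

end Uniform

section Exhaust

variable {r : ℕ} {W : Type} [NormedAddCommGroup W] [NormedSpace ℂ W] [FiniteDimensional ℂ W]

/-- A solution over a ball is approximated by a solution over a larger ball. -/
theorem exists_reach_larger_ball {n : ℕ} {a : W → Row r} {y y' : W → ℕ → Vec r}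
    {ρ ρ' ρ'' s s' : ℝ} (hρ : 0 < ρ) (hρ' : ρ < ρ') (hs : ρ' < s) (hρ'' : ρ' < ρ'') (hs' : ρ'' ≤ s')
    (ha : DifferentiableOn ℂ a (ball 0 s'))
    (hy : ∀ i, DifferentiableOn ℂ (fun w => y w i) (ball 0 s))
    (hyr : ∀ w ∈ ball (0 : W) s, runWord (y w) (2 * n) (a w) = baseRow r)
    (hy' : ∀ i, DifferentiableOn ℂ (fun w => y' w i) (ball 0 s'))
    (hyr' : ∀ w ∈ ball (0 : W) s', runWord (y' w) (2 * n) (a w) = baseRow r)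
    {F : W → Fin (2 * (3 * n + 3) + 2) × Fin (r + 1) → ℂ}
    (hF : (rowData r (3 * n + 3)).Reach (ball 0 ρ') a
      (fun w => coords _ (refWord (2 * n) (y w))) F) {η : ℝ} (hη : 0 < η) :
    ∃ F' : W → Fin (2 * (3 * n + 3) + 2) × Fin (r + 1) → ℂ,
      (rowData r (3 * n + 3)).Reach (ball 0 ρ'') a
        (fun w => coords _ (refWord (2 * n) (y' w))) F' ∧
      ∀ w ∈ ball (0 : W) ρ, ‖F' w - F w‖ ≤ η := by
  have : ProperSpace W := FiniteDimensional.proper ℂ W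
  have hEK : ball (0 : W) ρ' ⊆ closedBall 0 ρ' := ball_subset_closedBall
  have hK : closedBall (0 : W) ρ' ⊆ ball 0 s := closedBall_subset_ball hs
  have hK' : closedBall (0 : W) ρ' ⊆ ball 0 s' := closedBall_subset_ball (hρ''.trans_le hs')
  obtain ⟨M, p, hp, hM⟩ := (connected_refWord (isCompact_closedBall (0 : W) ρ') hEK
    (convex_ball _ _) (convex_closedBall _ _) (mem_ball_self (hρ.trans hρ'))
    (ha.mono (hEK.trans hK')) (ha.mono hK').continuousOn (fun i => (hy i).mono (hEK.trans hK))
    (fun i => ((hy i).mono hK).continuousOn) (fun w hw => hyr w (hK hw))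
    (fun i => (hy' i).mono (hEK.trans hK')) (fun i => ((hy' i).mono hK').continuousOn)
    (fun w hw => hyr' w (hK' hw))).2.trans hF
  have hc' := differentiableOn_coords_refWord hy' (2 * n) (2 * (3 * n + 3) + 2)
  have hρK : closedBall (0 : W) ρ ⊆ ball 0 ρ' := closedBall_subset_ball hρ'
  have hρK' : closedBall (0 : W) ρ ⊆ ball 0 s' := hρK.trans (hEK.trans hK')
  have hcont : ContinuousOn (fun w => (p w, coords _ (refWord (2 * n) (y' w)), a w))
      (closedBall 0 ρ) :=
    (hp.mono hρK).continuousOn.prodMk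
      ((hc'.mono hρK').continuousOn.prodMk (ha.mono hρK').continuousOn)
  obtain ⟨δ, hδ, hmap⟩ := ((isCompact_closedBall (0 : W) ρ).image_of_continuousOn
    hcont).exists_norm_sub_le M.smooth.continuous hη
  have : CompleteSpace M.P := FiniteDimensional.complete ℂ M.P
  obtain ⟨p', hp', hpp⟩ := exists_entire_approx_on_ball hρ hρ' hδ hp
  refine ⟨fun w => M.map (p' w) (coords _ (refWord (2 * n) (y' w))) (a w),
    ⟨M, p', hp'.differentiableOn, fun _ _ => rfl⟩, fun w hw => ?_⟩
  rw [hM w (hρK (ball_subset_closedBall hw))]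
  exact hmap _ ⟨w, ball_subset_closedBall hw, rfl⟩ (p' w, coords _ (refWord (2 * n) (y' w)), a w)
    (by simpa [Prod.norm_def] using hpp w hw)

theorem exists_seq_of_forall_exists {α : Type*} {P : ℕ → α → Prop} {Q : ℕ → α → α → Prop} {x₀ : α}
    (h₀ : P 0 x₀) (h : ∀ k x, P k x → ∃ x', P (k + 1) x' ∧ Q k x x') :
    ∃ f : ℕ → α, ∀ k, P k (f k) ∧ Q k (f k) (f (k + 1)) := by
  choose! g hg using h
  have hP : ∀ k, P k (Nat.rec x₀ (fun k x => g k x) k) := by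
    intro k
    induction k with
    | zero => exact h₀
    | succ k ih => exact (hg k _ ih).1
  exact ⟨fun k => Nat.rec x₀ (fun k x => g k x) k, fun k => ⟨hP k, (hg k _ (hP k)).2⟩⟩

/-- A locally uniform limit over an exhaustion by balls. -/
theorem exists_limit_exhaustion {F : Type*} [NormedAddCommGroup F] [NormedSpace ℂ F]
    [CompleteSpace F] {ρ : ℕ → ℝ} (hmono : Monotone ρ) {R : ℝ} (hex : ∀ x < R, ∃ k, x < ρ k)
    {f : ℕ → W → F}
    (hf : ∀ k, DifferentiableOn ℂ (f k) (ball 0 (ρ k)))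
    (hb : ∀ k, ∀ w ∈ ball (0 : W) (ρ k), ‖f (k + 1) w - f k w‖ ≤ 1 / 2 / 2 ^ k) :
    ∃ g : W → F, DifferentiableOn ℂ g (ball 0 R) ∧
      ∀ w ∈ ball (0 : W) R, Tendsto (fun k => f k w) atTop (𝓝 (g w)) := by
  have h1 : ∀ j, ∃ g : W → F, DifferentiableOn ℂ g (ball 0 (ρ j)) ∧
      ∀ w ∈ ball (0 : W) (ρ j), Tendsto (fun k => f k w) atTop (𝓝 (g w)) := by
    intro j
    have hsub : ∀ k, ball (0 : W) (ρ j) ⊆ ball 0 (ρ (k + j)) := fun k =>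
      ball_subset_ball (hmono (by omega))
    obtain ⟨g, hg, ht⟩ := exists_holomorphic_limit isOpen_ball (f := fun k => f (k + j)) (C := 1)
      (fun k => (hf (k + j)).mono (hsub k)) (fun k w hw => by
        have := hb (k + j) w (hsub k hw)
        rw [show k + 1 + j = k + j + 1 by ring]
        refine this.trans ?_
        gcongr
        · norm_num
        · omega)
    exact ⟨g, hg, fun w hw => (tendsto_add_atTop_iff_nat j).1 (ht w hw)⟩
  choose g hg ht using h1
  have hlim : ∀ j, ∀ w ∈ ball (0 : W) (ρ j), limUnder atTop (fun k => f k w) = g j w :=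
    fun j w hw => (ht j w hw).limUnder_eq
  refine ⟨fun w => limUnder atTop fun k => f k w, fun w hw => ?_, fun w hw => ?_⟩ <;>
  obtain ⟨j, hj⟩ := hex ‖w‖ (mem_ball_zero_iff.1 hw) <;> rw [← mem_ball_zero_iff] at hj
  · exact (((hg j).congr fun w hw => hlim j w hw).differentiableAt
      (isOpen_ball.mem_nhds hj)).differentiableWithinAt
  · dsimp only; rw [hlim j w hj]; exact ht j w hj

theorem AffineData.q_eq_one_of_tendsto {J A : Type} [Fintype J] [DecidableEq J]
    [NormedAddCommGroup A] [NormedSpace ℂ A] {S : AffineData J A} {f : ℕ → J → ℂ} {v : J → ℂ}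
    {a : A} (hf : Tendsto f atTop (𝓝 v)) (hq : ∀ᶠ k in atTop, S.q (f k) a = 1) : S.q v a = 1 := by
  have h1 : Continuous fun v => S.q v a :=
    S.q_smooth.continuous.comp (continuous_id.prodMk continuous_const)
  have h2 : Tendsto (fun k => S.q (f k) a) atTop (𝓝 (S.q v a)) := (h1.tendsto v).comp hf
  exact tendsto_nhds_unique h2 (tendsto_const_nhds.congr' (hq.mono fun k hk => hk.symm))

/-- Lifts of bounded length over smaller balls give a lift over the ball. -/
theorem Lifts.of_exhaustion {n : ℕ} {a : W → Row r} (ha : DifferentiableOn ℂ a (ball 0 1))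
    (hl : ∀ ρ, 0 < ρ → ρ < 1 → Lifts (2 * n) a (ball 0 ρ)) : Lifts (6 * n + 12) a (ball 0 1) := by
  let ρ : ℕ → ℝ := fun k => 1 - 1 / ((k : ℝ) + 2)
  have hmono : StrictMono ρ := by
    refine strictMono_nat_of_lt_succ fun k => ?_
    simp only [ρ]
    gcongr
    linarith
  have hpos : ∀ k, 0 < ρ k := by
    intro k
    simp only [ρ, sub_pos]
    rw [div_lt_one (by positivity)]
    linarith [k.cast_nonneg (α := ℝ)]
  have hlt : ∀ k, ρ k < 1 := fun k => by simp only [ρ]; linarith [show 0 < 1 / ((k : ℝ) + 2) by positivity]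
  have hex : ∀ x < (1 : ℝ), ∃ k, x < ρ k := by
    intro x hx
    obtain ⟨k, hk⟩ := exists_nat_one_div_lt (sub_pos.2 hx)
    refine ⟨k, ?_⟩
    have : 1 / ((k : ℝ) + 2) ≤ 1 / ((k : ℝ) + 1) := by gcongr; norm_num
    simp only [ρ]; linarith
  have hlk : ∀ k, Lifts (2 * n) a (ball 0 (ρ (k + 2))) := fun k => hl _ (hpos _) (hlt _)
  choose y hy hyr using hlk
  obtain ⟨F, hF⟩ := exists_seq_of_forall_exists
    (P := fun k F => (rowData r (3 * n + 3)).Reach (ball 0 (ρ (k + 1))) a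
      (fun w => coords _ (refWord (2 * n) (y k w))) F)
    (Q := fun k F F' => ∀ w ∈ ball (0 : W) (ρ k), ‖F' w - F w‖ ≤ 1 / 2 / 2 ^ k)
    (AffineData.Reach.of_eqOn fun _ _ => rfl)
    (fun k F hF => exists_reach_larger_ball (hpos k) (hmono (by omega)) (hmono (by omega))
      (hmono (by omega)) (hmono (by omega)).le (ha.mono (ball_subset_ball (hlt _).le)) (hy k) (hyr k)
      (hy (k + 1)) (hyr (k + 1)) hF (by positivity))
  have hsub : ∀ k, ball (0 : W) (ρ k) ⊆ ball 0 (ρ (k + 1)) := fun k =>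
    ball_subset_ball (hmono (by omega)).le
  have hsub' : ∀ k, ball (0 : W) (ρ k) ⊆ ball 0 (ρ (k + 2)) := fun k =>
    ball_subset_ball (hmono (by omega)).le
  have hFd : ∀ k, DifferentiableOn ℂ (F k) (ball 0 (ρ k)) := by
    intro k
    obtain ⟨M, p, hp, hM⟩ := (hF k).1.mono (hsub k)
    refine DifferentiableOn.congr ?_ hM
    exact (M.smooth.differentiable (by simp)).comp_differentiableOn (hp.prodMk
      (((differentiableOn_coords_refWord (hy k) _ _).mono (hsub' k)).prodMk
        (ha.mono (ball_subset_ball (hlt k).le))))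
  have hFq : ∀ k, ∀ w ∈ ball (0 : W) (ρ k), (rowData r (3 * n + 3)).q (F k w) (a w) = 1 := by
    intro k w hw
    obtain ⟨M, p, hp, hM⟩ := (hF k).1.mono (hsub k)
    rw [hM w hw, M.q_map, rowData_q, runWord_refWord (hyr k w (hsub' k hw))]
  obtain ⟨V, hV, ht⟩ := exists_limit_exhaustion hmono.monotone hex hFd fun k => (hF k).2
  have hq : ∀ w ∈ ball (0 : W) 1, (rowData r (3 * n + 3)).q (V w) (a w) = 1 := by
    intro w hw
    obtain ⟨j, hj⟩ := hex ‖w‖ (mem_ball_zero_iff.1 hw)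
    refine AffineData.q_eq_one_of_tendsto (ht w hw) ?_
    filter_upwards [eventually_ge_atTop j] with k hk
    exact hFq k w (mem_ball_zero_iff.2 (hj.trans_le (hmono.monotone hk)))
  have := Lifts.of_ne_zero (N := 2 * (3 * n + 3) + 2) (by simp [parity_simps]) (E := ball 0 1)
    (z := fun w => letters (V w))
    (fun i => ((contDiff_letters i).differentiable (by simp)).comp_differentiableOn hV) ha
    (fun w hw => by
      have : (runWord (letters (V w)) (2 * (3 * n + 3) + 2) (a w)).1 = 1 := hq w hw
      rw [this]; exact one_ne_zero)
  rwa [show 2 * (3 * n + 3) + 2 + 4 = 6 * n + 12 by ring] at this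

/-- A unimodular row over the unit ball is taken to `(1, 0)` by a holomorphic word. -/
theorem exists_lifts_ball {m : ℕ} {a b : EuclideanSpace ℂ (Fin m) → Row r}
    (ha : DifferentiableOn ℂ a (ball 0 1)) (hb : DifferentiableOn ℂ b (ball 0 1))
    (hab : ∀ w ∈ ball (0 : EuclideanSpace ℂ (Fin m)) 1, rowDot (a w) (b w) = 1) :
    ∃ n, Lifts (2 * n) a (ball 0 1) := by
  obtain ⟨n, hn⟩ := exists_forall_lifts m r
  exact ⟨3 * n + 6, by
    simpa [mul_add, ← mul_assoc] using Lifts.of_exhaustion ha fun ρ h h' => hn 1 a b ha hb hab ρ h h'⟩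

end Exhaust

section Assembly

variable {W : Type} [NormedAddCommGroup W] [NormedSpace ℂ W] {D : Set W}

/-- A matrix valued map with holomorphic entries. -/
def HolEntries {n : ℕ} (D : Set W) (G : W → Matrix (Fin n) (Fin n) ℂ) : Prop :=
  ∀ i j, DifferentiableOn ℂ (fun w => G w i j) D

/-- Unipotent lower triangular matrices. -/
def UnipotentLower {n : ℕ} (A : Matrix (Fin n) (Fin n) ℂ) : Prop :=
  (∀ i, A i i = 1) ∧ ∀ i j, i < j → A i j = 0

/-- Unipotent upper triangular matrices. -/
def UnipotentUpper {n : ℕ} (A : Matrix (Fin n) (Fin n) ℂ) : Prop :=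
  (∀ i, A i i = 1) ∧ ∀ i j, j < i → A i j = 0

theorem HolEntries.mul {n : ℕ} {G H : W → Matrix (Fin n) (Fin n) ℂ} (hG : HolEntries D G)
    (hH : HolEntries D H) : HolEntries D (fun w => G w * H w) := by
  intro i j
  simp only [Matrix.mul_apply]
  exact DifferentiableOn.fun_sum fun k _ => (hG i k).mul (hH k j)

theorem HolEntries.det {n : ℕ} {G : W → Matrix (Fin n) (Fin n) ℂ} (hG : HolEntries D G) :
    DifferentiableOn ℂ (fun w => (G w).det) D := by
  simp only [Matrix.det_apply]
  refine DifferentiableOn.fun_sum fun σ _ => DifferentiableOn.const_smul ?_ _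
  induction (Finset.univ : Finset (Fin n)) using Finset.induction_on with
  | empty => simp
  | insert i s hi ih =>
    simp only [Finset.prod_insert hi]
    exact (hG (σ i) i).mul ih

theorem HolEntries.adjugate {n : ℕ} {G : W → Matrix (Fin n) (Fin n) ℂ} (hG : HolEntries D G) :
    HolEntries D (fun w => (G w).adjugate) := by
  intro i j
  simp only [Matrix.adjugate_apply]
  refine HolEntries.det fun k l => ?_
  simp only [Matrix.updateRow_apply]
  split_ifs
  · exact differentiableOn_const _
  · exact hG k l

/-- Products of holomorphic maps into unipotent triangular matrices. -/
inductive HolFactor {n : ℕ} (D : Set W) : (W → Matrix (Fin n) (Fin n) ℂ) → Prop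
  | lower {G} : HolEntries D G → (∀ w ∈ D, UnipotentLower (G w)) → HolFactor D G
  | upper {G} : HolEntries D G → (∀ w ∈ D, UnipotentUpper (G w)) → HolFactor D G
  | mul {G H} : HolFactor D G → HolFactor D H → HolFactor D (fun w => G w * H w)
  | congr {G H} : HolFactor D G → (∀ w ∈ D, H w = G w) → HolFactor D H

theorem unipotentLower_one {n : ℕ} : UnipotentLower (1 : Matrix (Fin n) (Fin n) ℂ) :=
  ⟨fun _ => Matrix.one_apply_eq _, fun _ _ h => Matrix.one_apply_ne h.ne⟩

theorem unipotentUpper_one {n : ℕ} : UnipotentUpper (1 : Matrix (Fin n) (Fin n) ℂ) :=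
  ⟨fun _ => Matrix.one_apply_eq _, fun _ _ h => Matrix.one_apply_ne h.ne'⟩

theorem holEntries_const {n : ℕ} (A : Matrix (Fin n) (Fin n) ℂ) :
    HolEntries D fun _ => A := fun _ _ => differentiableOn_const _

/-- A product of unipotent triangular maps is an alternating product. -/
theorem HolFactor.exists_alternating {n : ℕ} {G : W → Matrix (Fin n) (Fin n) ℂ}
    (h : HolFactor D G) : ∃ (M : ℕ) (E : ℕ → W → Matrix (Fin n) (Fin n) ℂ), 1 ≤ M ∧ Even M ∧
      (∀ i, HolEntries D (E i)) ∧ (∀ i, Even i → ∀ w ∈ D, UnipotentLower (E i w)) ∧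
      (∀ i, ¬ Even i → ∀ w ∈ D, UnipotentUpper (E i w)) ∧
      ∀ w ∈ D, G w = ((List.range M).map fun i => E i w).prod := by
  induction h with
  | @lower G hG hL =>
    refine ⟨2, fun i => if i = 0 then G else fun _ => 1, by norm_num, even_two, fun i => ?_,
      fun i hi w hw => ?_, fun i hi w hw => ?_, fun w hw => ?_⟩
    · dsimp only
      split_ifs
      · exact hG
      · exact holEntries_const _
    · dsimp only
      split_ifs
      · exact hL w hw
      · exact unipotentLower_one
    · dsimp only
      rw [if_neg (show ¬ i = 0 by rintro rfl; simp at hi)]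
      exact unipotentUpper_one
    · simp [List.range_succ]
  | @upper G hG hU =>
    refine ⟨2, fun i => if i = 1 then G else fun _ => 1, by norm_num, even_two, fun i => ?_,
      fun i hi w hw => ?_, fun i hi w hw => ?_, fun w hw => ?_⟩
    · dsimp only
      split_ifs
      · exact hG
      · exact holEntries_const _
    · dsimp only
      rw [if_neg (show ¬ i = 1 by rintro rfl; simp at hi)]
      exact unipotentLower_one
    · dsimp only
      split_ifs
      · exact hU w hw
      · exact unipotentUpper_one
    · simp [List.range_succ]
  | @mul G H _ _ ihG ihH =>
    obtain ⟨M, E, hM, hM2, hE, hL, hU, hp⟩ := ihG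
    obtain ⟨M', E', hM', hM2', hE', hL', hU', hp'⟩ := ihH
    have hpar : ∀ i, ¬ i < M → (Even (i - M) ↔ Even i) := fun i hi => by
      rw [Nat.even_sub (not_lt.1 hi)]; simp [hM2]
    refine ⟨M + M', fun i => if i < M then E i else E' (i - M), by omega, hM2.add hM2',
      fun i => ?_, fun i hi w hw => ?_, fun i hi w hw => ?_, fun w hw => ?_⟩
    · dsimp only
      split_ifs
      · exact hE i
      · exact hE' _
    · dsimp only
      split_ifs with h
      · exact hL i hi w hw
      · exact hL' _ ((hpar i h).2 hi) w hw
    · dsimp only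
      split_ifs with h
      · exact hU i hi w hw
      · exact hU' _ (fun h' => hi ((hpar i h).1 h')) w hw
    · dsimp only
      rw [hp w hw, hp' w hw, List.range_add, List.map_append, List.prod_append, List.map_map]
      congr 2
      · exact List.map_congr_left fun i hi => by rw [if_pos (List.mem_range.1 hi)]
      · exact List.map_congr_left fun i hi => by simp
  | @congr G H _ hGH ih =>
    obtain ⟨M, E, h1, h2, h3, h4, h5, h6⟩ := ih
    exact ⟨M, E, h1, h2, h3, h4, h5, fun w hw => by rw [hGH w hw, h6 w hw]⟩

/-- The block matrix with diagonal blocks `1` and `A`, and first column `(1, c)`. -/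
def blockMatrix {n : ℕ} (c : Fin n → ℂ) (A : Matrix (Fin n) (Fin n) ℂ) :
    Matrix (Fin (n + 1)) (Fin (n + 1)) ℂ :=
  Fin.cons (Fin.cons 1 0) fun i => Fin.cons (c i) (A i)

@[simp] theorem blockMatrix_zero_zero {n : ℕ} (c : Fin n → ℂ) (A : Matrix (Fin n) (Fin n) ℂ) :
    blockMatrix c A 0 0 = 1 := rfl

@[simp] theorem blockMatrix_zero_succ {n : ℕ} (c : Fin n → ℂ) (A : Matrix (Fin n) (Fin n) ℂ)
    (j : Fin n) : blockMatrix c A 0 j.succ = 0 := rfl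

@[simp] theorem blockMatrix_succ_zero {n : ℕ} (c : Fin n → ℂ) (A : Matrix (Fin n) (Fin n) ℂ)
    (i : Fin n) : blockMatrix c A i.succ 0 = c i := rfl

@[simp] theorem blockMatrix_succ_succ {n : ℕ} (c : Fin n → ℂ) (A : Matrix (Fin n) (Fin n) ℂ)
    (i j : Fin n) : blockMatrix c A i.succ j.succ = A i j := rfl

theorem blockMatrix_mul {n : ℕ} (A B : Matrix (Fin n) (Fin n) ℂ) :
    blockMatrix 0 (A * B) = blockMatrix 0 A * blockMatrix 0 B := by
  ext i j
  refine Fin.cases ?_ (fun i => ?_) i <;> refine Fin.cases ?_ (fun j => ?_) j <;>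
    simp [Matrix.mul_apply, Fin.sum_univ_succ]

theorem blockMatrix_eq_mul {n : ℕ} (c : Fin n → ℂ) (A : Matrix (Fin n) (Fin n) ℂ) :
    blockMatrix c A = blockMatrix c 1 * blockMatrix 0 A := by
  ext i j
  refine Fin.cases ?_ (fun i => ?_) i <;> refine Fin.cases ?_ (fun j => ?_) j <;>
    simp [Matrix.mul_apply, Fin.sum_univ_succ, Matrix.one_apply]

theorem det_blockMatrix {n : ℕ} (c : Fin n → ℂ) (A : Matrix (Fin n) (Fin n) ℂ) :
    (blockMatrix c A).det = A.det := by
  rw [Matrix.det_succ_row_zero, Fin.sum_univ_succ]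
  simp only [blockMatrix_zero_succ]
  simp only [Fin.val_zero, pow_zero, blockMatrix_zero_zero, mul_zero, zero_mul,
    Finset.sum_const_zero, add_zero, one_mul]
  rfl

theorem HolEntries.blockMatrix {n : ℕ} {c : W → Fin n → ℂ}
    {A : W → Matrix (Fin n) (Fin n) ℂ} (hc : ∀ i, DifferentiableOn ℂ (fun w => c w i) D)
    (hA : HolEntries D A) : HolEntries D fun w => blockMatrix (c w) (A w) := by
  intro i j
  refine Fin.cases ?_ (fun i => ?_) i <;> refine Fin.cases ?_ (fun j => ?_) j
  · exact differentiableOn_const _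
  · exact differentiableOn_const _
  · exact hc i
  · exact hA i j

theorem UnipotentLower.blockMatrix {n : ℕ} {A : Matrix (Fin n) (Fin n) ℂ} (hA : UnipotentLower A)
    (c : Fin n → ℂ) : UnipotentLower (blockMatrix c A) := by
  refine ⟨fun i => ?_, fun i j => ?_⟩
  · refine Fin.cases rfl (fun i => hA.1 i) i
  · refine Fin.cases ?_ (fun i => ?_) i <;> refine Fin.cases ?_ (fun j => ?_) j <;> intro h
    · exact absurd h (lt_irrefl _)
    · rfl
    · exact absurd h (Fin.not_lt_zero _)
    · exact hA.2 i j (Fin.succ_lt_succ_iff.1 h)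

theorem UnipotentUpper.blockMatrix {n : ℕ} {A : Matrix (Fin n) (Fin n) ℂ}
    (hA : UnipotentUpper A) : UnipotentUpper (blockMatrix 0 A) := by
  refine ⟨fun i => ?_, fun i j => ?_⟩
  · refine Fin.cases rfl (fun i => hA.1 i) i
  · refine Fin.cases ?_ (fun i => ?_) i <;> refine Fin.cases ?_ (fun j => ?_) j <;> intro h
    · exact absurd h (lt_irrefl _)
    · rfl
    · rfl
    · exact hA.2 i j (Fin.succ_lt_succ_iff.1 h)

theorem HolFactor.blockMatrix {n : ℕ} {A : W → Matrix (Fin n) (Fin n) ℂ} (h : HolFactor D A) :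
    HolFactor D fun w => blockMatrix 0 (A w) := by
  induction h with
  | lower hG hL =>
    exact .lower (hG.blockMatrix (c := fun _ => 0) fun _ => differentiableOn_const _)
      fun w hw => (hL w hw).blockMatrix 0
  | upper hG hU =>
    exact .upper (hG.blockMatrix (c := fun _ => 0) fun _ => differentiableOn_const _)
      fun w hw => (hU w hw).blockMatrix
  | mul _ _ ihG ihH => exact (ihG.mul ihH).congr fun w _ => blockMatrix_mul _ _
  | congr _ hGH ih => exact ih.congr fun w hw => by rw [hGH w hw]

variable {r : ℕ}

/-- The matrix of an elementary operation. -/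
noncomputable def slotMatrix (k : ℕ) (v : Vec r) : Matrix (Fin (r + 2)) (Fin (r + 2)) ℂ :=
  if Even k then 1 + Matrix.vecMulVec (Pi.single 0 1) (Fin.cons 0 v)
  else 1 + Matrix.vecMulVec (Fin.cons 0 v) (Pi.single 0 1)

theorem slotMatrix_apply (k : ℕ) (v : Vec r) (i j : Fin (r + 2)) :
    slotMatrix k v i j = (1 : Matrix (Fin (r + 2)) (Fin (r + 2)) ℂ) i j +
      if Even k then (Pi.single 0 1 : Fin (r + 2) → ℂ) i * (Fin.cons 0 v : Fin (r + 2) → ℂ) j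
      else (Fin.cons 0 v : Fin (r + 2) → ℂ) i * (Pi.single 0 1 : Fin (r + 2) → ℂ) j := by
  unfold slotMatrix
  split_ifs <;> rfl

theorem slotMatrix_mul_neg (k : ℕ) (v : Vec r) : slotMatrix k v * slotMatrix k (-v) = 1 := by
  have hneg : (Fin.cons 0 (-v) : Fin (r + 2) → ℂ) = -Fin.cons 0 v := by
    funext i; refine Fin.cases ?_ (fun i => ?_) i <;> simp
  unfold slotMatrix
  split_ifs <;> rw [hneg] <;>
  simp [add_mul, mul_add, Matrix.vecMulVec_mul_vecMulVec, Matrix.vecMulVec_neg,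
    Matrix.neg_vecMulVec]

/-- The first row of a matrix. -/
def firstRow (A : Matrix (Fin (r + 2)) (Fin (r + 2)) ℂ) : Row r := (A 0 0, fun j => A 0 j.succ)

theorem firstRow_mul_slotMatrix (A : Matrix (Fin (r + 2)) (Fin (r + 2)) ℂ) (k : ℕ) (v : Vec r) :
    firstRow (A * slotMatrix k v) = slotStep k v (firstRow A) := by
  unfold slotStep firstRow
  split_ifs with h
  · simp only [slotMatrix, if_pos h, mul_add, mul_one, Matrix.mul_vecMulVec]
    ext <;> simp [Matrix.vecMulVec_apply]
  · simp only [slotMatrix, if_neg h, mul_add, mul_one, Matrix.mul_vecMulVec]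
    ext <;> simp [Matrix.vecMulVec_apply, Matrix.mulVec, dotProduct, Fin.sum_univ_succ]

theorem holFactor_slotMatrix (k : ℕ) {v : W → Vec r} (hv : DifferentiableOn ℂ v D) :
    HolFactor D fun w => slotMatrix k (v w) := by
  have hd : HolEntries D fun w => slotMatrix k (v w) := by
    have hc : ∀ i, DifferentiableOn ℂ (fun w => (Fin.cons 0 (v w) : Fin (r + 2) → ℂ) i) D := by
      intro i
      refine Fin.cases ?_ (fun i => ?_) i
      · exact differentiableOn_const _
      · exact differentiableOn_pi.1 hv i
    intro i j
    simp only [slotMatrix_apply]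
    split_ifs
    · exact ((hc j).const_mul _).const_add _
    · exact ((hc i).mul_const _).const_add _
  by_cases h : Even k
  · refine .upper hd fun w _ => ⟨fun i => ?_, fun i j hij => ?_⟩
    · rw [slotMatrix_apply, if_pos h]
      refine Fin.cases ?_ (fun i => ?_) i <;> simp
    · rw [slotMatrix_apply, if_pos h, Matrix.one_apply_ne hij.ne', Pi.single_eq_of_ne]
      · simp
      · exact (lt_of_le_of_lt (Fin.zero_le _) hij).ne'
  · refine .lower hd fun w _ => ⟨fun i => ?_, fun i j hij => ?_⟩
    · rw [slotMatrix_apply, if_neg h]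
      refine Fin.cases ?_ (fun i => ?_) i <;> simp
    · rw [slotMatrix_apply, if_neg h, Matrix.one_apply_ne hij.ne, Pi.single_eq_of_ne]
      · simp
      · exact (lt_of_le_of_lt (Fin.zero_le _) hij).ne'

theorem HolFactor.holEntries {n : ℕ} {G : W → Matrix (Fin n) (Fin n) ℂ} (h : HolFactor D G) :
    HolEntries D G := by
  induction h with
  | lower h _ => exact h
  | upper h _ => exact h
  | mul _ _ ihG ihH => exact ihG.mul ihH
  | congr _ hGH ih => exact fun i j => (ih i j).congr fun w hw => by rw [hGH w hw]

/-- The product of the matrices of the letters of a word, and of its inverse. -/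
theorem exists_wordMatrix {z : W → ℕ → Vec r} (hz : ∀ i, DifferentiableOn ℂ (fun w => z w i) D)
    (N : ℕ) : ∃ H H' : W → Matrix (Fin (r + 2)) (Fin (r + 2)) ℂ, HolFactor D H ∧ HolFactor D H' ∧
      (∀ w, H w * H' w = 1) ∧
      ∀ w (A : Matrix (Fin (r + 2)) (Fin (r + 2)) ℂ),
        firstRow (A * H w) = runWord (z w) N (firstRow A) := by
  induction N with
  | zero =>
    refine ⟨fun _ => 1, fun _ => 1, ?_, ?_, by simp, by simp⟩ <;>
    exact .lower (holEntries_const _) fun _ _ => unipotentLower_one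
  | succ N ih =>
    obtain ⟨H, H', hH, hH', hinv, hrow⟩ := ih
    refine ⟨fun w => H w * slotMatrix N (z w N), fun w => slotMatrix N (-z w N) * H' w,
      hH.mul (holFactor_slotMatrix N (hz N)), (holFactor_slotMatrix N (hz N).neg).mul hH',
      fun w => ?_, fun w A => ?_⟩
    · rw [mul_assoc, ← mul_assoc (slotMatrix _ _), slotMatrix_mul_neg, one_mul, hinv]
    · rw [← mul_assoc, firstRow_mul_slotMatrix, hrow, runWord_succ]

theorem HolFactor.det {n : ℕ} {G : W → Matrix (Fin n) (Fin n) ℂ} (h : HolFactor D G) :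
    ∀ w ∈ D, (G w).det = 1 := by
  induction h with
  | lower _ hL =>
    intro w hw
    rw [Matrix.det_of_isLowerTriangular _ fun i j hij => (hL w hw).2 i j hij]
    exact Finset.prod_eq_one fun i _ => (hL w hw).1 i
  | upper _ hU =>
    intro w hw
    rw [Matrix.det_of_isUpperTriangular fun i j hij => (hU w hw).2 i j hij]
    exact Finset.prod_eq_one fun i _ => (hU w hw).1 i
  | mul _ _ ihG ihH => intro w hw; rw [Matrix.det_mul, ihG w hw, ihH w hw, one_mul]
  | congr _ hGH ih => intro w hw; rw [hGH w hw, ih w hw]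

/-- Holomorphic maps from the ball to the special linear group are products of unipotent maps. -/
theorem holFactor_of_det_eq_one {m n : ℕ}
    {G : EuclideanSpace ℂ (Fin m) → Matrix (Fin n) (Fin n) ℂ} (hG : HolEntries (ball 0 1) G)
    (hdet : ∀ w ∈ ball (0 : EuclideanSpace ℂ (Fin m)) 1, (G w).det = 1) :
    HolFactor (ball 0 1) G := by
  induction n with
  | zero => exact .lower hG fun w _ => ⟨fun i => i.elim0, fun i => i.elim0⟩
  | succ n ih =>
    rcases n with _ | r
    · refine .lower hG fun w hw => ⟨fun i => ?_, fun i j hij => absurd hij (by omega)⟩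
      obtain rfl : i = 0 := by omega
      simpa [Matrix.det_fin_one] using hdet w hw
    have ha : DifferentiableOn ℂ (fun w => firstRow (G w)) (ball 0 1) :=
      (hG 0 0).prodMk (differentiableOn_pi.2 fun j => hG 0 j.succ)
    have hb : DifferentiableOn ℂ (fun w => ((G w).adjugate 0 0,
        fun j : Fin (r + 1) => (G w).adjugate j.succ 0)) (ball 0 1) :=
      (hG.adjugate 0 0).prodMk (differentiableOn_pi.2 fun j => hG.adjugate j.succ 0)
    obtain ⟨N, z, hz, hr⟩ := exists_lifts_ball ha hb fun w hw => by
      have := congrFun (congrFun (Matrix.mul_adjugate (G w)) 0) 0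
      rw [hdet w hw, Matrix.mul_apply, Fin.sum_univ_succ] at this
      simpa [rowDot, firstRow, dotProduct] using this
    obtain ⟨H, H', hH, hH', hinv, hrow⟩ := exists_wordMatrix hz (2 * N)
    have hGH := hG.mul hH.holEntries
    have hblock : ∀ w ∈ ball (0 : EuclideanSpace ℂ (Fin m)) 1, G w * H w =
        blockMatrix (fun i => (G w * H w) i.succ 0)
          (Matrix.of fun i j => (G w * H w) i.succ j.succ) := by
      intro w hw
      have h1 : firstRow (G w * H w) = baseRow r := by rw [hrow, hr w hw]
      ext i j
      refine Fin.cases ?_ (fun i => ?_) i <;> refine Fin.cases ?_ (fun j => ?_) j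
      · exact congrArg Prod.fst h1
      · exact congrFun (congrArg Prod.snd h1) j
      · rfl
      · rfl
    have hsub := ih (G := fun w => Matrix.of fun i j => (G w * H w) i.succ j.succ)
      (fun i j => hGH i.succ j.succ) fun w hw => by
        have := congrArg Matrix.det (hblock w hw)
        rw [det_blockMatrix, Matrix.det_mul, hdet w hw, hH.det w hw, one_mul] at this
        exact this.symm
    have hlow : HolFactor (ball (0 : EuclideanSpace ℂ (Fin m)) 1) fun w =>
        blockMatrix (fun i => (G w * H w) i.succ 0) 1 :=
      .lower ((holEntries_const 1).blockMatrix fun i => hGH i.succ 0)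
        fun w _ => unipotentLower_one.blockMatrix _
    refine ((hlow.mul hsub.blockMatrix).mul hH').congr fun w hw => ?_
    rw [← blockMatrix_eq_mul, ← hblock w hw, mul_assoc, hinv, mul_one]

end Assembly

/-- the Ivarsson–Kutzschebauch solution to the Vaserstein problem for the
open unit ball `B ⊂ ℂ^m`: every holomorphic map `G : B → SL_n(ℂ)` factors as a finite
product of holomorphic maps into unipotent lower/upper triangular matrices, alternating
starting with a lower triangular factor (here `i : Fin M` is the `(i.1+1)`-st factor, so
odd factors are lower triangular and even factors are upper triangular). -/
theorem vaserstein_factorization_ball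
    (m n : ℕ) (hm : 1 ≤ m) (hn : 2 ≤ n)
    (G : EuclideanSpace ℂ (Fin m) → Matrix (Fin n) (Fin n) ℂ)
    (hGholo : ∀ a b, DifferentiableOn ℂ (fun w => G w a b)
      (Metric.ball (0 : EuclideanSpace ℂ (Fin m)) 1))
    (hGdet : ∀ w ∈ Metric.ball (0 : EuclideanSpace ℂ (Fin m)) 1, (G w).det = 1) :
    ∃ (M : ℕ) (_ : 1 ≤ M)
      (E : Fin M → EuclideanSpace ℂ (Fin m) → Matrix (Fin n) (Fin n) ℂ),
      (∀ i a b, DifferentiableOn ℂ (fun w => E i w a b)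
        (Metric.ball (0 : EuclideanSpace ℂ (Fin m)) 1)) ∧
      (∀ i : Fin M, Odd (i.1 + 1) → ∀ w ∈ Metric.ball (0 : EuclideanSpace ℂ (Fin m)) 1,
        (∀ a, E i w a a = 1) ∧ (∀ a b : Fin n, a < b → E i w a b = 0)) ∧
      (∀ i : Fin M, Even (i.1 + 1) → ∀ w ∈ Metric.ball (0 : EuclideanSpace ℂ (Fin m)) 1,
        (∀ a, E i w a a = 1) ∧ (∀ a b : Fin n, b < a → E i w a b = 0)) ∧
      (∀ w ∈ Metric.ball (0 : EuclideanSpace ℂ (Fin m)) 1,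
        G w = (List.ofFn fun i => E i w).prod) := by
  obtain ⟨M, E, hM, -, hE, hL, hU, hp⟩ := (holFactor_of_det_eq_one hGholo hGdet).exists_alternating
  refine ⟨M, hM, fun i => E i, fun i => hE i, fun i hi w hw => hL i ?_ w hw,
    fun i hi w hw => hU i ?_ w hw, fun w hw => ?_⟩
  · simpa [Nat.odd_add_one, Nat.not_odd_iff_even] using hi
  · simpa [Nat.even_add_one] using hi
  · rw [hp w hw, List.ofFn_eq_map, ← List.map_coe_finRange_eq_range, List.map_map]
    rfl
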